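/- Let M be a simple non-regular binary matroid of rank r ≥ 7 with no AG(3,2)-minor, and suppose |M| = (r choose 2) + 4 + p for an integer p. Then every element x of M such that M/x is non-regular lies in at least r − 2 + p lines of M. -/

import Mathlib

open Matroid Set

variable {α : Type*}

/-- Deletion of a set of elements from a matroid. -/
def Matroid.del (M : Matroid α) (D : Set α) : Matroid α := M ↾ (M.E \ D)

/-- Contraction of a set of elements in a matroid, defined by duality. -/
def Matroid.con (M : Matroid α) (C : Set α) : Matroid α := ((M✶).del C)✶

/-- `N` is a minor of `M` if it is obtained from `M` by a contraction followed by a deletion. -/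
def Matroid.IsMinorOf (N M : Matroid α) : Prop := ∃ C D : Set α, N = (M.con C).del D

/-- `C` is a circuit of `M`: a dependent set all of whose proper subsets are independent. -/
def Matroid.IsCircuitSet (M : Matroid α) (C : Set α) : Prop :=
  M.Dep C ∧ ∀ D ⊂ C, M.Indep D

/-- A matroid is simple if it has no circuits of size one or two, equivalently every
one- or two-element subset of the ground set is independent. -/
def Matroid.IsSimpleM (M : Matroid α) : Prop := ∀ e ∈ M.E, ∀ f ∈ M.E, M.Indep {e, f}

/-- The rank of a set `X` in a matroid `M`: the supremum of the sizes of independent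
subsets of `X`. -/
noncomputable def Matroid.rks (M : Matroid α) (X : Set α) : ℕ :=
  sSup {n : ℕ | ∃ I ⊆ X, M.Indep I ∧ I.ncard = n}

/-- The rank of a matroid. -/
noncomputable def Matroid.rkM (M : Matroid α) : ℕ := M.rks M.E

/-- `M` is represented over the field `F` by the vector assignment `φ`:
a subset of the ground set is independent iff `φ` is linearly independent on it. -/
def Matroid.IsRepBy (M : Matroid α) (F : Type*) [Field F] {W : Type*} [AddCommGroup W]
    [Module F W] (φ : α → W) : Prop :=
  ∀ I ⊆ M.E, (M.Indep I ↔ LinearIndependent F (I.restrict φ))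

/-- `M` is representable over the field `F`. -/
def Matroid.IsRepOver (M : Matroid α) (F : Type) [Field F] : Prop :=
  ∃ (n : ℕ) (φ : α → (Fin n → F)), M.IsRepBy F φ

/-- A binary matroid is one representable over the two-element field `GF(2)`. -/
def Matroid.IsBinaryM (M : Matroid α) : Prop := M.IsRepOver (ZMod 2)

/-- A regular matroid is one representable over every field. -/
def Matroid.IsRegularM (M : Matroid α) : Prop := ∀ (F : Type) [Field F], M.IsRepOver F

/-- `M` is isomorphic to the binary vector matroid on the set of vectors `V`:
there is a representation of `M` over `GF(2)` mapping the ground set bijectively to `V`. -/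
def Matroid.IsBinaryIsoTo (M : Matroid α) {W : Type*} [AddCommGroup W] [Module (ZMod 2) W]
    (V : Set W) : Prop :=
  ∃ φ : α → W, M.IsRepBy (ZMod 2) φ ∧ Set.BijOn φ M.E V

/-- The eight points of the binary affine cube `AG(3,2)`: the vectors `(1, x)` in `GF(2)⁴`. -/
def agVecs : Set (Fin 4 → ZMod 2) := {x | x 0 = 1}

/-- `M` has a minor isomorphic to `AG(3,2)`. -/
def Matroid.HasAGMinor (M : Matroid α) : Prop :=
  ∃ N : Matroid α, N.IsMinorOf M ∧ N.IsBinaryIsoTo agVecs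

/-- The seven points of the Fano plane `F₇`: the nonzero vectors of `GF(2)³`. -/
def fanoVecs : Set (Fin 3 → ZMod 2) := {x | x ≠ 0}

/-- The vectors `eᵢ + eⱼ` (`i ≠ j`) representing the graphic matroid `M(K_n)`. -/
def kVecs (n : ℕ) : Set (Fin n → ZMod 2) :=
  {x | ∃ i j : Fin n, i ≠ j ∧ x = Pi.single i 1 + Pi.single j 1}

/-- `ℓ` is a line (3-element circuit) of `M` through `x`. -/
def Matroid.IsLineThru (M : Matroid α) (x : α) (ℓ : Set α) : Prop :=
  M.IsCircuitSet ℓ ∧ ℓ.ncard = 3 ∧ x ∈ ℓ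

/-- A matroid is connected if it is nonempty and every two distinct elements of the
ground set lie in a common circuit. -/
def Matroid.IsConnectedM (M : Matroid α) : Prop :=
  M.E.Nonempty ∧ ∀ e ∈ M.E, ∀ f ∈ M.E, e ≠ f →
    ∃ C, M.IsCircuitSet C ∧ e ∈ C ∧ f ∈ C

/-- A matroid is 3-connected if it is connected and has no 2-separation, i.e. no partition
`(A, B)` of the ground set with `|A| ≥ 2`, `|B| ≥ 2` and `r(A) + r(B) - r(M) ≤ 1`. -/
def Matroid.IsThreeConnected (M : Matroid α) : Prop :=
  M.IsConnectedM ∧ ¬ ∃ A B : Set α, A ∪ B = M.E ∧ Disjoint A B ∧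
    2 ≤ A.ncard ∧ 2 ≤ B.ncard ∧ M.rks A + M.rks B ≤ M.rkM + 1

def fmTab : Nat :=
  430762406827734748672010892741083859160872654579421098721642286952743303675652561814351278680858620872891486043791883322636329034565906054265962460922131462582939373569967963751734993674452732085305445449964586022980175998477163761085678843557295312501661795049004051042321346766838275183895282054139568039777602567688993859522314211420184374739675577199692892421749998663000290919545592429137302092955033844820202654135480955411045587643583690545677507232106749415485249821957178950164741252466104846132415255142762990907942283825513755981670810348548459081648587221719430172700404094504860694560311999954915752956355943753060322080314291517848297242973991908373460299075380578457260187412658520158156139928553963425610675347917911113552252420977480354980297228157740680266801656378301289394006542874430730170796149337154537945548941238797566901064519454782372299699647307141282384076506680868940730578299252252249903886697773826438987508170590520344929797497009855688533018209815701634518461605681541449842462422426749094781536383781383331769382791881283327926837241049698841357627248421264861548615272542362718978982606445539026351013111161616611096358058815011937653229818975475918604251013789535883567033483493147014030140899328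

def certU0 : List Nat := [
    88, 8454753, 216, 8454753, 224, 120, 16843321, 248, 16843321, 112, 8454729, 240, 8454729, 104,
    8454737, 232, 8454737, 184, 16942817, 152, 25232057, 144, 25232073, 136, 25232081, 58, 232,
    112, 16908825, 240, 16908825, 96, 8454737, 120, 8454761, 248, 8454761, 176, 16974561, 152,
    19039385, 136, 19039441, 144, 19039465, 50, 240, 104, 16908825, 96, 8454729, 120, 8454769,
    248, 8454769, 168, 16942305, 152, 21168793, 144, 21168841, 136, 21168881, 42, 248, 96,
    16843321, 104, 8454761, 112, 8454769, 160, 16843489, 152, 19039929, 144, 19039977, 136,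
    19039985, 34, 96, 120, 16843321, 112, 8454729, 104, 8454737, 192, 152, 35784289, 168,
    35816529, 176, 37945929, 184, 16942777, 58, 200, 144, 37880417, 160, 42009169, 176, 38011449,
    184, 16942793, 58, 144, 208, 136, 19006625, 160, 25232009, 168, 35914809, 184, 16942801, 58,
    66, 66, 104, 112, 16908825, 120, 8454761, 192, 152, 35784289, 160, 42009169, 176, 16974489,
    184, 35817065, 50, 200, 144, 37880417, 168, 35816529, 176, 16974569, 184, 35916313, 50, 144,
    208, 136, 19006625, 168, 19039401, 160, 42205721, 176, 16974545, 50, 66, 66, 136, 208,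
    35783777, 112, 120, 8454769, 192, 200, 16942225, 152, 21103265, 184, 21168817, 160, 42009161,
    168, 16942233, 42, 200, 144, 21103265, 176, 21168817, 160, 42205721, 168, 16942281, 42, 66,
    120, 192, 200, 16843409, 152, 21103265, 176, 19039921, 160, 16843449, 168, 35816553, 34, 200,
    144, 21103265, 184, 19039921, 160, 16843497, 168, 35914809, 34, 66, 192, 200, 21103265, 66,
    66, 112, 120, 8454769, 208, 168, 16942321, 176, 37945929, 184, 35916313, 42, 192, 152,
    35784289, 168, 16942233, 184, 35817073, 42, 66, 120, 208, 160, 16843505, 176, 38011449, 184,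
    35817065, 34, 192, 152, 35784289, 160, 16843449, 176, 37945969, 34, 66, 144, 192, 208,
    19006625, 66, 66, 66]

def certU : List Nat := certU0

def certA0 : List Nat := [
    88, 8454753, 216, 8454753, 344, 8454753, 472, 8454753, 480, 120, 16843321, 248, 16843321, 376,
    16843321, 504, 16843321, 112, 8454729, 240, 8454729, 368, 8454729, 496, 8454729, 104, 8454737,
    232, 8454737, 360, 8454737, 488, 8454737, 312, 16942945, 440, 16942945, 280, 25232185, 408,
    25232185, 272, 25232201, 400, 25232201, 264, 25232209, 392, 25232209, 184, 16942817, 152,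
    25232057, 144, 25232073, 136, 25232081, 58, 488, 112, 16908825, 240, 16908825, 368, 16908825,
    496, 16908825, 96, 8454737, 224, 8454737, 352, 8454737, 120, 8454761, 248, 8454761, 376,
    8454761, 504, 8454761, 304, 16974689, 432, 16974689, 280, 19039513, 408, 19039513, 264,
    19039569, 392, 19039569, 272, 19039593, 400, 19039593, 176, 16974561, 152, 19039385, 136,
    19039441, 144, 19039465, 50, 496, 104, 16908825, 232, 16908825, 360, 16908825, 96, 8454729,
    224, 8454729, 352, 8454729, 120, 8454769, 248, 8454769, 376, 8454769, 504, 8454769, 296,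
    16942433, 424, 16942433, 280, 21168921, 408, 21168921, 272, 21168969, 400, 21168969, 264,
    21169009, 392, 21169009, 168, 16942305, 152, 21168793, 144, 21168841, 136, 21168881, 42, 504,
    96, 16843321, 224, 16843321, 352, 16843321, 104, 8454761, 232, 8454761, 360, 8454761, 112,
    8454769, 240, 8454769, 368, 8454769, 288, 16843617, 416, 16843617, 280, 19040057, 408,
    19040057, 272, 19040105, 400, 19040105, 264, 19040113, 392, 19040113, 160, 16843489, 152,
    19039929, 144, 19039977, 136, 19039985, 34, 224, 120, 16843321, 248, 16843321, 376, 16843321,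
    112, 8454729, 240, 8454729, 368, 8454729, 104, 8454737, 232, 8454737, 360, 8454737, 184,
    16942817, 440, 16942817, 152, 25232057, 408, 25232057, 144, 25232073, 400, 25232073, 136,
    25232081, 392, 25232081, 352, 448, 50497433, 456, 40209897, 464, 40209393, 264, 69338193, 272,
    71434825, 280, 69469753, 312, 16942945, 58, 448, 296, 52561297, 304, 54657929, 280, 69338721,
    312, 16942905, 336, 92340937, 328, 92340945, 58, 456, 288, 35784081, 304, 36014585, 272,
    71434849, 312, 16942921, 336, 69633209, 320, 69633233, 58, 464, 288, 37880713, 296, 38111737,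
    264, 69338209, 312, 16942929, 328, 71762617, 320, 71762633, 58, 416, 192, 16942745, 296,
    42239377, 304, 42271625, 336, 75563593, 328, 75563601, 280, 77858529, 312, 44468153, 58, 424,
    200, 16942825, 288, 35816849, 304, 35982329, 336, 69469241, 320, 69370961, 272, 73665249, 312,
    44468169, 58, 432, 208, 16942833, 288, 37946249, 296, 38047225, 328, 71565881, 320, 71500361,
    264, 73665761, 312, 44468177, 58, 320, 280, 69338721, 296, 69370961, 304, 71500361, 312,
    16942905, 58, 328, 272, 71434849, 288, 75563601, 304, 71565881, 312, 16942921, 58, 336, 264,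
    69338209, 288, 75563593, 296, 69469241, 312, 16942929, 58, 96, 160, 208, 42009161, 200,
    42009169, 168, 176, 16942785, 82, 74, 192, 168, 35816529, 176, 37945929, 200, 208, 33719873,
    82, 74, 66, 160, 192, 16942745, 66, 66, 352, 120, 16843321, 248, 16843321, 376, 16843321, 112,
    8454729, 240, 8454729, 368, 8454729, 104, 8454737, 232, 8454737, 360, 8454737, 312, 16942945,
    440, 16942945, 280, 25232185, 408, 25232185, 272, 25232201, 400, 25232201, 264, 25232209, 392,
    25232209, 448, 168, 52561297, 176, 54657929, 152, 35784289, 208, 58786633, 200, 58786641, 184,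
    16942777, 58, 456, 160, 35784081, 176, 36014585, 144, 37880417, 208, 36078905, 192, 36078929,
    184, 16942793, 58, 464, 160, 37880713, 168, 38111737, 136, 35783777, 200, 38208313, 192,
    38208329, 184, 16942801, 58, 416, 320, 16942873, 168, 42239377, 176, 42271625, 152, 44304225,
    208, 42009161, 200, 42009169, 184, 36079545, 58, 424, 328, 16942953, 160, 35816849, 176,
    35982329, 144, 40110945, 208, 35914809, 192, 35816529, 184, 36079561, 58, 432, 336, 16942961,
    160, 37946249, 168, 38047225, 136, 40111457, 200, 38011449, 192, 37945929, 184, 36079569, 58,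
    192, 152, 35784289, 168, 35816529, 176, 37945929, 184, 16942777, 58, 200, 144, 37880417, 160,
    42009169, 176, 38011449, 184, 16942793, 58, 208, 136, 35783777, 160, 42009161, 168, 35914809,
    184, 16942801, 58, 96, 288, 336, 75563593, 328, 75563601, 296, 304, 16942913, 82, 74, 320,
    296, 69370961, 304, 71500361, 328, 336, 67274305, 82, 74, 66, 288, 320, 16942873, 66, 66, 232,
    112, 16908825, 240, 16908825, 368, 16908825, 96, 8454737, 120, 8454761, 248, 8454761, 376,
    8454761, 176, 16974561, 432, 16974561, 152, 19039385, 408, 19039385, 136, 19039441, 392,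
    19039441, 144, 19039465, 400, 19039465, 360, 448, 50529209, 456, 35950025, 464, 46597105, 264,
    69338193, 272, 71434857, 280, 69470233, 304, 16974689, 50, 448, 288, 52561297, 312, 54657961,
    280, 69338721, 304, 16974617, 328, 86148305, 336, 86148329, 50, 456, 296, 35784081, 312,
    36014553, 272, 71434849, 304, 16974697, 336, 77890713, 320, 77890769, 50, 464, 296, 37880745,
    288, 38111705, 264, 69338209, 304, 16974673, 328, 71666329, 320, 71666409, 50, 416, 200,
    16974537, 296, 42009489, 312, 42271705, 336, 75760153, 320, 75563601, 272, 79954657, 304,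
    35950569, 50, 424, 192, 16974521, 288, 42370449, 312, 35982249, 328, 69370961, 336, 69370985,
    280, 69471969, 304, 35950489, 50, 440, 208, 16974577, 296, 35817385, 288, 38112729, 328,
    69470745, 320, 69371497, 264, 69471457, 304, 35950545, 50, 320, 280, 69338721, 288, 75563601,
    304, 16974617, 312, 69371497, 50, 328, 272, 71434849, 296, 69370961, 304, 16974697, 312,
    69470745, 50, 336, 264, 69338209, 288, 75760153, 296, 69370985, 304, 16974673, 50, 104, 160,
    208, 42205721, 192, 42009169, 168, 184, 16974529, 82, 66, 200, 168, 35816529, 184, 35916313,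
    192, 208, 33751617, 82, 66, 74, 168, 192, 16974521, 66, 66, 360, 112, 16908825, 240, 16908825,
    368, 16908825, 96, 8454737, 120, 8454761, 248, 8454761, 376, 8454761, 304, 16974689, 432,
    16974689, 280, 19039513, 408, 19039513, 264, 19039569, 392, 19039569, 272, 19039593, 400,
    19039593, 448, 160, 52561297, 184, 54657961, 152, 35784289, 200, 52594001, 208, 52594025, 176,
    16974489, 50, 456, 168, 35784081, 184, 36014553, 144, 37880417, 208, 44336409, 192, 44336465,
    176, 16974569, 50, 464, 168, 37880745, 160, 38111705, 136, 35783777, 176, 16974545, 200,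
    38112025, 192, 38112105, 50, 416, 328, 16974665, 168, 42009489, 184, 42271705, 144, 46400353,
    208, 42205721, 192, 42009169, 176, 38047721, 50, 424, 320, 16974649, 160, 42370449, 184,
    35982249, 152, 35917665, 200, 35816529, 208, 35816553, 176, 38047641, 50, 440, 336, 16974705,
    168, 35817385, 160, 38112729, 136, 35917153, 176, 38047697, 200, 35916313, 192, 35817065, 50,
    192, 152, 35784289, 160, 42009169, 176, 16974489, 184, 35817065, 50, 200, 144, 37880417, 168,
    35816529, 176, 16974569, 184, 35916313, 50, 208, 136, 35783777, 160, 42205721, 168, 35816553,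
    176, 16974545, 50, 104, 288, 336, 75760153, 320, 75563601, 296, 312, 16974657, 82, 66, 328,
    296, 69370961, 312, 69470745, 320, 336, 67306049, 82, 66, 74, 296, 320, 16974649, 66, 66, 240,
    104, 16908825, 96, 8454729, 120, 8454769, 248, 8454769, 376, 8454769, 168, 16942305, 424,
    16942305, 152, 21168793, 408, 21168793, 144, 21168841, 400, 21168841, 136, 21168881, 392,
    21168881, 368, 448, 50496953, 456, 44467689, 464, 38079441, 264, 69338225, 272, 71434825, 280,
    69470233, 296, 16942433, 42, 448, 312, 52561329, 288, 54657929, 280, 69338721, 296, 16942361]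

def certA1 : List Nat := [
    336, 88277705, 328, 88277745, 42, 456, 304, 35784113, 288, 36014553, 272, 71434849, 296,
    16942409, 336, 69569689, 320, 69569777, 42, 464, 304, 37880713, 312, 38111705, 264, 69338209,
    296, 16942449, 328, 80020121, 320, 80020169, 42, 416, 208, 16942289, 304, 42009481, 312,
    42239449, 328, 75760153, 320, 75563593, 264, 77858017, 296, 38080497, 42, 432, 192, 16942265,
    312, 38047153, 288, 42402697, 336, 71500361, 328, 71500401, 280, 71569121, 296, 38080409, 42,
    440, 200, 16942313, 304, 35817393, 288, 36015065, 336, 69470745, 320, 69371505, 272, 71568097,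
    296, 38080457, 42, 320, 280, 69338721, 288, 75563593, 296, 16942361, 312, 69371505, 42, 328,
    272, 71434849, 288, 75760153, 296, 16942409, 304, 71500401, 42, 336, 264, 69338209, 296,
    16942449, 304, 71500361, 312, 69470745, 42, 112, 160, 200, 42205721, 192, 42009161, 176, 184,
    16942273, 74, 66, 208, 176, 37945929, 184, 35916313, 192, 200, 33719361, 74, 66, 82, 176, 192,
    16942265, 66, 66, 368, 104, 16908825, 96, 8454729, 120, 8454769, 248, 8454769, 376, 8454769,
    296, 16942433, 424, 16942433, 280, 21168921, 408, 21168921, 272, 21168969, 400, 21168969, 264,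
    21169009, 392, 21169009, 448, 184, 52561329, 160, 54657929, 152, 35784289, 168, 16942233, 208,
    54723401, 200, 54723441, 42, 456, 176, 35784113, 160, 36014553, 144, 37880417, 168, 16942281,
    208, 36015385, 192, 36015473, 42, 464, 176, 37880713, 184, 38111705, 136, 35783777, 200,
    46465817, 192, 46465865, 168, 16942321, 42, 416, 336, 16942417, 176, 42009481, 184, 42239449,
    136, 44303713, 200, 42205721, 192, 42009161, 168, 35983345, 42, 432, 320, 16942393, 184,
    38047153, 160, 42402697, 152, 38014817, 168, 35983257, 208, 37945929, 200, 37945969, 42, 440,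
    328, 16942441, 176, 35817393, 160, 36015065, 144, 38013793, 168, 35983305, 208, 35916313, 192,
    35817073, 42, 192, 152, 35784289, 160, 42009161, 168, 16942233, 184, 35817073, 42, 200, 144,
    37880417, 160, 42205721, 168, 16942281, 176, 37945969, 42, 208, 136, 35783777, 168, 16942321,
    176, 37945929, 184, 35916313, 42, 112, 288, 328, 75760153, 320, 75563593, 304, 312, 16942401,
    74, 66, 336, 304, 71500361, 312, 69470745, 320, 328, 67273793, 74, 66, 82, 304, 320, 16942393,
    66, 66, 248, 96, 16843321, 104, 8454761, 112, 8454769, 160, 16843489, 416, 16843489, 152,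
    19039929, 408, 19039929, 144, 19039977, 400, 19039977, 136, 19039985, 392, 19039985, 376, 448,
    50398105, 456, 35947977, 464, 38077393, 264, 69338225, 272, 71434857, 280, 69469753, 288,
    16843617, 34, 448, 304, 52561329, 296, 54657961, 280, 69338721, 288, 16843577, 336, 86148841,
    328, 86148849, 34, 456, 312, 35784113, 296, 36014585, 272, 71434849, 288, 16843625, 336,
    73698489, 320, 73698545, 34, 464, 312, 37880745, 304, 38111737, 264, 69338209, 288, 16843633,
    328, 73730745, 320, 73730793, 34, 424, 208, 16843473, 312, 35816873, 304, 42370553, 328,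
    69469241, 320, 69370985, 264, 69469409, 288, 35948529, 34, 432, 200, 16843465, 312, 37946289,
    296, 42402809, 336, 71565881, 320, 71500401, 272, 71566049, 288, 35948521, 34, 440, 192,
    16843417, 304, 38112689, 296, 36015017, 336, 69371497, 328, 69371505, 280, 69469921, 288,
    35948473, 34, 320, 280, 69338721, 288, 16843577, 296, 69370985, 304, 71500401, 34, 328, 272,
    71434849, 288, 16843625, 296, 69469241, 312, 69371505, 34, 336, 264, 69338209, 288, 16843633,
    304, 71565881, 312, 69371497, 34, 120, 168, 200, 35914809, 192, 35816553, 184, 176, 16843457,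
    74, 66, 208, 176, 38011449, 184, 35817065, 192, 200, 33620545, 74, 66, 82, 184, 192, 16843417,
    66, 66, 376, 96, 16843321, 104, 8454761, 112, 8454769, 288, 16843617, 416, 16843617, 280,
    19040057, 408, 19040057, 272, 19040105, 400, 19040105, 264, 19040113, 392, 19040113, 448, 176,
    52561329, 168, 54657961, 152, 35784289, 160, 16843449, 208, 52594537, 200, 52594545, 34, 456,
    184, 35784113, 168, 36014585, 144, 37880417, 160, 16843497, 208, 40144185, 192, 40144241, 34,
    464, 184, 37880745, 176, 38111737, 136, 35783777, 160, 16843505, 200, 40176441, 192, 40176489,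
    34, 424, 336, 16843601, 184, 35816873, 176, 42370553, 136, 35915105, 160, 44337137, 200,
    35914809, 192, 35816553, 34, 432, 328, 16843593, 184, 37946289, 168, 42402809, 144, 38011745,
    160, 44337129, 208, 38011449, 192, 37945969, 34, 440, 320, 16843545, 176, 38112689, 168,
    36015017, 152, 35915617, 160, 44337081, 208, 35817065, 200, 35817073, 34, 192, 152, 35784289,
    160, 16843449, 168, 35816553, 176, 37945969, 34, 200, 144, 37880417, 160, 16843497, 168,
    35914809, 184, 35817073, 34, 208, 136, 35783777, 160, 16843505, 176, 38011449, 184, 35817065,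
    34, 120, 296, 328, 69469241, 320, 69370985, 312, 304, 16843585, 74, 66, 336, 304, 71565881,
    312, 69371497, 320, 328, 67174977, 74, 66, 82, 312, 320, 16843545, 66, 66, 448, 280, 69338721,
    408, 69338721, 152, 35784289, 416, 296, 19006737, 424, 19006737, 168, 19006609, 304, 21103369,
    432, 21103369, 176, 21103241, 112, 75563593, 336, 75563593, 464, 75563593, 104, 75563601, 328,
    75563601, 456, 75563601, 120, 16843577, 312, 83952185, 440, 83952185, 208, 42009161, 200,
    42009169, 184, 52594617, 58, 424, 288, 19006737, 160, 19006609, 312, 21103401, 440, 21103401,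
    184, 21103273, 96, 69370961, 328, 69370961, 456, 69370961, 120, 69370985, 336, 69370985, 464,
    69370985, 112, 16942361, 304, 84017689, 432, 84017689, 200, 35816529, 208, 35816553, 176,
    54723481, 50, 432, 312, 19006769, 440, 19006769, 184, 19006641, 288, 21103369, 160, 21103241,
    96, 71500361, 336, 71500361, 464, 71500361, 120, 71500401, 328, 71500401, 456, 71500401, 104,
    16974617, 296, 84017689, 168, 52594073, 208, 37945929, 200, 37945969, 42, 440, 304, 19006769,
    176, 19006641, 296, 21103401, 168, 21103273, 104, 69371497, 336, 69371497, 464, 69371497, 112,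
    69371505, 328, 69371505, 456, 69371505, 96, 16942905, 288, 83952185, 160, 58786745, 208,
    35817065, 200, 35817073, 34, 96, 120, 16843321, 112, 8454729, 104, 8454737, 296, 69370961,
    304, 71500361, 312, 16942905, 168, 35816529, 176, 37945929, 184, 16942777, 58, 120, 104,
    8454761, 112, 8454769, 288, 16843577, 296, 69370985, 304, 71500401, 160, 16843449, 168,
    35816553, 176, 37945969, 34, 104, 112, 16908825, 288, 75563601, 304, 16974617, 312, 69371497,
    160, 42009169, 176, 16974489, 184, 35817065, 50, 112, 288, 75563593, 296, 16942361, 312,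
    69371505, 160, 42009161, 168, 16942233, 184, 35817073, 42, 456, 264, 21103393, 392, 21103393,
    136, 21103265, 272, 71434849, 400, 71434849, 288, 75563601, 144, 37880417, 160, 42009169, 34,
    464, 272, 19006753, 400, 19006753, 144, 19006625, 264, 69338209, 392, 69338209, 288, 75563593,
    136, 35783777, 160, 42009161, 34, 200, 136, 21103265, 392, 21103265, 328, 54657953, 144,
    37880417, 400, 37880417, 336, 54657889, 160, 42009169, 168, 35816529, 176, 37945969, 184,
    35817073, 320, 384, 36014369, 192, 208, 304, 71831105, 296, 69733953, 288, 78120513, 34, 82,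
    66, 74, 328, 264, 21103393, 392, 21103393, 272, 71434849, 400, 71434849, 288, 75563601, 296,
    69370961, 304, 71500401, 312, 69371505, 208, 52561249, 192, 384, 69568673, 320, 336, 176,
    67702337, 168, 67669569, 160, 67798593, 34, 82, 66, 74, 208, 144, 19006625, 400, 19006625,
    136, 35783777, 392, 35783777, 160, 42009161]

def certA2 : List Nat := [
    168, 35816553, 176, 37945929, 184, 35817065, 74, 336, 272, 19006753, 400, 19006753, 264,
    69338209, 392, 69338209, 288, 75563593, 296, 69370985, 304, 71500361, 312, 69371497, 74, 192,
    384, 312, 69469849, 304, 71569081, 296, 69471929, 288, 77858457, 272, 71600289, 264, 69535905,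
    136, 392, 320, 35981601, 400, 176, 38014785, 168, 35917633, 160, 44304193, 34, 82, 74, 74,
    320, 400, 38046113, 392, 35981729, 450, 66, 320, 384, 184, 35915545, 176, 38014777, 168,
    35917625, 160, 44304153, 144, 38045985, 136, 35981601, 392, 400, 304, 71569089, 296, 69471937,
    288, 77858497, 34, 82, 74, 66, 66, 456, 272, 71434849, 400, 71434849, 144, 37880417, 416, 296,
    8454929, 424, 8454929, 168, 8454801, 312, 21103449, 440, 21103449, 184, 21103321, 112,
    75760153, 336, 75760153, 464, 75760153, 96, 75563601, 320, 75563601, 120, 16843625, 304,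
    69338217, 432, 69338217, 208, 42205721, 192, 42009169, 176, 40144361, 50, 424, 288, 8454929,
    160, 8454801, 304, 21103481, 432, 21103481, 176, 21103353, 120, 69469241, 336, 69469241, 464,
    69469241, 104, 69370961, 320, 69370961, 112, 16942409, 312, 69338185, 440, 69338185, 208,
    35914809, 192, 35816529, 184, 36015561, 58, 432, 312, 8454961, 440, 8454961, 184, 8454833,
    296, 21103481, 168, 21103353, 96, 71565881, 336, 71565881, 464, 71565881, 112, 71500401, 320,
    71500401, 104, 16974697, 288, 69338217, 160, 44336617, 208, 38011449, 192, 37945969, 34, 440,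
    304, 8454961, 176, 8454833, 288, 21103449, 160, 21103321, 104, 69470745, 336, 69470745, 464,
    69470745, 120, 69371505, 320, 69371505, 96, 16942921, 296, 69338185, 168, 36079049, 208,
    35916313, 192, 35817073, 42, 96, 120, 16843321, 112, 8454729, 104, 8454737, 288, 75563601,
    304, 71565881, 312, 16942921, 160, 42009169, 176, 38011449, 184, 16942793, 58, 112, 104,
    16908825, 120, 8454769, 288, 75760153, 296, 16942409, 304, 71500401, 160, 42205721, 168,
    16942281, 176, 37945969, 42, 104, 120, 8454761, 296, 69370961, 304, 16974697, 312, 69470745,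
    168, 35816529, 176, 16974569, 184, 35916313, 50, 120, 288, 16843625, 296, 69469241, 312,
    69371505, 160, 16843497, 168, 35914809, 184, 35817073, 34, 464, 280, 8454945, 408, 8454945,
    152, 8454817, 264, 69338209, 392, 69338209, 288, 75760153, 136, 35783777, 160, 42205721, 34,
    192, 136, 21103265, 392, 21103265, 320, 36014497, 152, 35784289, 408, 35784289, 336, 36014433,
    160, 42009169, 168, 35816529, 176, 37945969, 184, 35817073, 328, 384, 54657825, 200, 208, 312,
    71830081, 288, 80216641, 296, 73927233, 34, 82, 74, 66, 320, 264, 21103393, 392, 21103393,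
    280, 69338721, 408, 69338721, 288, 75563601, 296, 69370961, 304, 71500401, 312, 69371505, 208,
    35784033, 200, 384, 88212129, 328, 336, 184, 67701313, 160, 67830337, 168, 67734081, 34, 82,
    74, 66, 208, 152, 8454817, 408, 8454817, 136, 35783777, 392, 35783777, 160, 42205721, 168,
    35914809, 176, 38011449, 184, 35916313, 66, 336, 280, 8454945, 408, 8454945, 264, 69338209,
    392, 69338209, 288, 75760153, 296, 69469241, 304, 71565881, 312, 69470745, 66, 200, 384, 304,
    71566025, 312, 71568105, 288, 79954633, 296, 73665257, 280, 69338785, 264, 69535905, 136, 392,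
    328, 35981601, 408, 184, 38013761, 160, 46400321, 168, 40110913, 34, 82, 66, 66, 328, 408,
    35784609, 392, 35981729, 458, 74, 264, 328, 392, 152, 67670041, 184, 67670041, 176, 67702841,
    168, 67670073, 160, 67801113, 136, 35981601, 384, 408, 312, 71568065, 288, 79954625, 296,
    73665217, 34, 82, 74, 66, 66, 66, 464, 264, 69338209, 392, 69338209, 136, 35783777, 416, 304,
    8454921, 432, 8454921, 176, 8454793, 312, 19006809, 440, 19006809, 184, 19006681, 104,
    75760153, 328, 75760153, 96, 75563593, 320, 75563593, 120, 16843633, 296, 71434865, 424,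
    71434865, 200, 42205721, 192, 42009161, 168, 40176625, 42, 424, 312, 8454953, 440, 8454953,
    184, 8454825, 304, 19006841, 432, 19006841, 176, 19006713, 96, 69469241, 328, 69469241, 104,
    69370985, 320, 69370985, 112, 16942449, 288, 71434865, 160, 46466033, 200, 35914809, 192,
    35816553, 34, 432, 288, 8454921, 160, 8454793, 296, 19006841, 168, 19006713, 120, 71565881,
    328, 71565881, 112, 71500361, 320, 71500361, 104, 16974673, 312, 71434833, 440, 71434833, 200,
    38011449, 192, 37945929, 184, 38112209, 58, 440, 296, 8454953, 168, 8454825, 288, 19006809,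
    160, 19006681, 112, 69470745, 328, 69470745, 120, 69371497, 320, 69371497, 96, 16942929, 304,
    71434833, 176, 38208465, 200, 35916313, 192, 35817065, 50, 96, 120, 16843321, 112, 8454729,
    104, 8454737, 288, 75563593, 296, 69469241, 312, 16942929, 160, 42009161, 168, 35914809, 184,
    16942801, 58, 104, 112, 16908825, 120, 8454761, 288, 75760153, 296, 69370985, 304, 16974673,
    160, 42205721, 168, 35816553, 176, 16974545, 50, 112, 120, 8454769, 296, 16942449, 304,
    71500361, 312, 69470745, 168, 16942321, 176, 37945929, 184, 35916313, 42, 120, 288, 16843633,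
    304, 71565881, 312, 69371497, 160, 16843505, 176, 38011449, 184, 35817065, 34, 192, 144,
    19006625, 400, 19006625, 320, 38111649, 152, 35784289, 408, 35784289, 328, 38111585, 160,
    42009161, 168, 35816553, 176, 37945929, 184, 35817065, 336, 384, 52561185, 200, 208, 288,
    78120001, 312, 69733441, 304, 73927745, 34, 82, 74, 66, 320, 272, 19006753, 400, 19006753,
    280, 69338721, 408, 69338721, 288, 75563593, 296, 69370985, 304, 71500361, 312, 69371497, 200,
    37880673, 208, 384, 86115489, 328, 336, 160, 67798081, 184, 67669057, 176, 67734593, 34, 82,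
    74, 66, 200, 152, 8454817, 408, 8454817, 144, 37880417, 400, 37880417, 160, 42205721, 168,
    35914809, 176, 38011449, 184, 35916313, 66, 328, 280, 8454945, 408, 8454945, 272, 71434849,
    400, 71434849, 288, 75760153, 296, 69469241, 304, 71565881, 312, 69470745, 66, 208, 384, 296,
    69469393, 288, 77858001, 312, 69471473, 304, 73665777, 280, 69338785, 272, 71600289, 144, 400,
    336, 38045985, 408, 160, 44303681, 184, 35917121, 176, 40111425, 34, 74, 66, 66, 336, 408,
    35784609, 400, 38046113, 466, 82, 272, 336, 400, 152, 67670041, 184, 67670041, 176, 67702841,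
    168, 67670073, 160, 67801113, 144, 38045985, 408, 384, 288, 77857985, 312, 69471425, 304,
    73665729, 34, 82, 74, 66, 66, 66, 96, 120, 16843321, 112, 8454729, 104, 8454737, 440, 320,
    16942905, 328, 16942921, 336, 16942929, 192, 16942777, 200, 16942793, 208, 16942801, 66, 192,
    152, 35784289, 408, 35784289, 168, 35816529, 424, 35816529, 176, 37945929, 432, 37945929, 184,
    16942777, 320, 392, 40111537, 400, 40111017, 280, 69338721, 296, 69370961, 304, 71500361, 312,
    16942905, 58, 328, 272, 71434849, 400, 71434849, 288, 75563601, 304, 71565881, 312, 16942921,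
    58, 336, 264, 69338209, 392, 69338209, 288, 75563593, 296, 69469241, 312, 16942929, 58, 160,
    208, 42009161, 200, 42009169, 136, 144, 16942785, 400, 16942785, 82, 74, 98, 328, 272,
    71434849, 400, 71434849, 288, 75563601, 416, 75563601, 304, 71565881, 432, 71565881, 312,
    16942921, 200, 392, 40111537, 408, 44304345, 144, 37880417, 160, 42009169, 176, 38011449, 184,
    16942793, 58, 208, 136, 35783777, 392, 35783777, 160, 42009161, 168, 35914809, 184, 16942801,
    58, 296, 336, 69469241, 320, 69370961, 264, 280, 16942913, 408, 16942913, 82, 66, 98, 208,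
    136, 35783777, 392, 35783777]

def certA3 : List Nat := [
    160, 42009161, 416, 42009161, 168, 35914809, 424, 35914809, 184, 16942801, 336, 400, 40111017,
    408, 44304345, 264, 69338209, 288, 75563593, 296, 69469241, 312, 16942929, 58, 320, 280,
    69338721, 408, 69338721, 296, 69370961, 304, 71500361, 312, 16942905, 58, 144, 200, 37880417,
    152, 176, 16942785, 432, 16942785, 98, 74, 66, 320, 280, 69338721, 408, 69338721, 296,
    69370961, 424, 69370961, 304, 71500361, 432, 71500361, 312, 16942905, 200, 144, 37880417, 400,
    37880417, 160, 42009169, 176, 38011449, 184, 16942793, 58, 264, 336, 69338209, 272, 288,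
    16942913, 416, 16942913, 98, 82, 74, 200, 144, 37880417, 400, 37880417, 160, 42009169, 416,
    42009169, 176, 38011449, 432, 38011449, 184, 16942793, 336, 264, 69338209, 392, 69338209, 288,
    75563593, 296, 69469241, 312, 16942929, 58, 136, 152, 168, 16942785, 424, 16942785, 98, 82,
    66, 272, 336, 264, 19006753, 392, 19006753, 288, 25232137, 416, 25232137, 296, 69469241, 424,
    69469241, 312, 16942929, 280, 304, 16942913, 432, 16942913, 98, 74, 66, 66, 392, 336,
    69338209, 208, 35783777, 144, 152, 8454817, 408, 8454817, 272, 35784097, 200, 21103265, 320,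
    35981729, 168, 104, 16974529, 176, 33686041, 432, 33686041, 160, 8454801, 416, 8454801, 184,
    8454825, 440, 8454825, 304, 33751977, 312, 35783961, 296, 35784081, 328, 384, 33751857, 400,
    34014201, 112, 35982681, 120, 33852841, 50, 112, 192, 33751641, 120, 8454769, 66, 120, 122,
    50, 184, 120, 16843457, 160, 33620537, 416, 33620537, 424, 8454825, 176, 8454833, 432,
    8454833, 288, 33620905, 296, 35783993, 312, 35784113, 328, 384, 33620753, 400, 33883097, 104,
    33850793, 112, 35982769, 34, 112, 192, 21168817, 104, 16908825, 66, 104, 106, 34, 176, 112,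
    16942273, 424, 33686041, 160, 8454793, 416, 8454793, 440, 8454833, 296, 33719689, 288,
    35783961, 304, 35784113, 328, 384, 33719569, 400, 33885177, 104, 44434777, 120, 40177073, 42,
    104, 192, 33719385, 120, 8454761, 66, 120, 122, 42, 160, 440, 33620537, 432, 8454793, 424,
    8454801, 312, 33720201, 304, 35783993, 288, 35784081, 328, 384, 33720113, 400, 33917913, 104,
    44434833, 112, 33918345, 120, 40177017, 58, 104, 192, 19039377, 112, 16908825, 120, 8454761,
    66, 120, 192, 33719929, 112, 8454769, 66, 112, 114, 58, 424, 288, 33751945, 104, 16974529,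
    416, 8454929, 432, 37880729, 440, 8454825, 328, 69633225, 304, 120, 35915201, 400, 67240473,
    280, 8454969, 384, 67240593, 264, 37880753, 296, 37880761, 136, 33751969, 192, 33852833, 42,
    120, 192, 19039913, 112, 8454769, 66, 112, 114, 66, 304, 440, 33620873, 120, 35915201, 312,
    8454961, 296, 37880761, 288, 69338281, 328, 136, 71566017, 384, 37880609, 400, 21103393, 104,
    77989033, 112, 21168945, 34, 104, 192, 33853353, 112, 16908825, 66, 112, 114, 66, 432, 312,
    33719721, 112, 16942273, 440, 8454961, 416, 8454793, 288, 400, 8454921, 434, 434, 296, 416,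
    33720233, 288, 8454929, 312, 69338249, 280, 440, 67240969, 298, 298, 120, 440, 16843457, 104,
    8454761, 112, 8454769, 122, 104, 288, 35917249, 112, 16908825, 106, 328, 384, 37880609, 400,
    21103393, 416, 77890793, 440, 69569737, 288, 136, 79954625, 312, 37880729, 112, 46531545, 50,
    42, 112, 114, 66, 152, 400, 8454817, 280, 35784097, 192, 21103265, 328, 35981729, 160, 104,
    16974529, 176, 33620521, 432, 33620521, 168, 8454801, 424, 8454801, 184, 8454809, 440,
    8454809, 304, 33751961, 312, 35783977, 288, 35784081, 320, 384, 33852721, 408, 34014089, 112,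
    33752025, 120, 40176937, 50, 120, 200, 33850921, 112, 8454769, 66, 112, 114, 50, 184, 112,
    16942273, 168, 33686537, 424, 33686537, 416, 8454809, 176, 8454833, 432, 8454833, 296,
    33719705, 288, 35783945, 312, 35784113, 320, 384, 33981713, 408, 33885097, 104, 33719769, 120,
    40177073, 42, 120, 200, 19039921, 104, 8454761, 66, 104, 106, 42, 176, 120, 16843457, 416,
    33620521, 440, 8454833, 168, 8454841, 424, 8454841, 288, 33620921, 296, 35783977, 304,
    35784113, 320, 384, 33850641, 408, 33883017, 104, 44434729, 112, 35982769, 34, 104, 200,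
    33850409, 112, 16908825, 66, 112, 114, 34, 168, 440, 33686537, 416, 8454801, 432, 8454841,
    312, 33720249, 304, 35783945, 296, 35784081, 320, 384, 33918257, 408, 33917865, 104, 44434833,
    112, 35982601, 120, 33720313, 58, 104, 200, 19039377, 112, 16908825, 120, 8454761, 66, 112,
    200, 33885193, 120, 8454769, 66, 120, 122, 58, 416, 296, 33751993, 104, 16974529, 424,
    8454929, 432, 35784617, 440, 8454809, 320, 92340921, 304, 112, 44303809, 408, 67174953, 272,
    8454921, 384, 67241617, 288, 35784585, 264, 35784625, 136, 33751969, 200, 33751969, 34, 112,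
    200, 21168857, 120, 8454769, 66, 120, 122, 66, 304, 440, 33719737, 112, 44303809, 312,
    8454961, 288, 35784585, 296, 69338265, 320, 136, 71569089, 384, 38111521, 408, 21103393, 104,
    77989081, 120, 19040049, 42, 104, 200, 33853401, 120, 8454761, 66, 120, 122, 66, 432, 312,
    33620889, 120, 16843457, 440, 8454961, 424, 8454841, 296, 408, 8454969, 434, 434, 288, 424,
    33720217, 296, 8454929, 312, 69338297, 272, 440, 67174969, 290, 290, 112, 440, 16942273, 104,
    16908825, 120, 8454769, 114, 104, 296, 35917249, 120, 8454761, 106, 320, 384, 38111521, 408,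
    21103393, 424, 86148249, 440, 86148793, 296, 136, 69471937, 312, 35784617, 120, 44435369, 50,
    34, 120, 122, 66, 272, 280, 8454945, 408, 8454945, 328, 21103393, 192, 35981729, 296, 104,
    16974657, 304, 67240473, 432, 67240473, 288, 8454929, 416, 8454929, 312, 8454953, 440,
    8454953, 176, 37946281, 184, 69338265, 168, 35784081, 320, 112, 67306073, 120, 19040041, 50,
    112, 120, 8454769, 82, 82, 304, 112, 16942401, 424, 67240473, 288, 8454921, 416, 8454921, 312,
    8454961, 440, 8454961, 168, 35816841, 160, 69338265, 176, 35784113, 320, 104, 67273817, 120,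
    19040049, 42, 104, 120, 8454761, 82, 82, 312, 120, 16843585, 288, 67174969, 416, 67174969,
    424, 8454953, 432, 8454961, 160, 42009513, 168, 69338297, 184, 35784113, 320, 104, 19039529,
    112, 21168945, 34, 104, 112, 16908825, 82, 82, 288, 440, 67174969, 432, 8454921, 424, 8454929,
    184, 35817353, 176, 69338297, 160, 35784081, 320, 104, 19039505, 112, 21168905, 120, 67274361,
    58, 264, 400, 200, 33917913, 136, 35783969, 168, 67667001, 384, 416, 33720065, 130, 130, 274,
    274, 424, 160, 33751945, 104, 16974657, 432, 67240473, 416, 8454929, 440, 8454953, 200,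
    36078921, 176, 120, 35915201, 384, 67306129, 400, 37946265, 264, 37946273, 136, 33686449, 168,
    33686457, 320, 38047137, 42, 320, 322, 112, 120, 8454769, 66, 66, 176, 440, 33620873, 120,
    35915201, 184, 8454833, 168, 33686457, 160, 35783977, 136, 416, 432, 33687457, 178, 178, 178,
    432, 184, 33719721, 112, 16942401, 416, 8454921, 440, 8454961, 200, 40144233, 160, 384, 400,
    42009353, 434, 434, 434, 168, 416, 33720233, 160, 8454801, 184, 35783945, 170, 264, 400, 136,
    35783969, 200, 35783969, 160, 67764761, 184, 67668505, 130, 274, 274, 280, 400, 8454945, 320,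
    21103393, 200, 35981729, 288, 104, 16974657, 304, 67174953, 432, 67174953, 296, 8454929, 424,
    8454929, 312, 8454937, 440, 8454937, 176]

def certA4 : List Nat := [
    37946265, 184, 69338281, 160, 35784081, 328, 112, 21168985, 120, 67405353, 50, 112, 120,
    8454769, 82, 82, 304, 120, 16843585, 416, 67174953, 312, 8454961, 440, 8454961, 296, 8454969,
    424, 8454969, 160, 42009529, 168, 69338281, 176, 35784113, 328, 104, 67404841, 112, 21168945,
    34, 104, 112, 16908825, 82, 82, 312, 112, 16942401, 296, 67240969, 424, 67240969, 416,
    8454937, 432, 8454961, 168, 35816857, 160, 69338249, 184, 35784113, 328, 104, 19039577, 120,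
    19040049, 42, 104, 120, 8454761, 82, 82, 296, 440, 67240969, 416, 8454929, 432, 8454969, 184,
    35817401, 176, 69338249, 168, 35784081, 328, 104, 19039505, 112, 67439625, 120, 19040121, 58,
    264, 408, 192, 33917865, 136, 35783969, 160, 67765257, 384, 424, 33720065, 130, 130, 282, 282,
    416, 168, 33751993, 104, 16974657, 432, 67174953, 424, 8454929, 440, 8454937, 192, 58786617,
    176, 112, 44303809, 384, 67306129, 264, 37946273, 328, 37946273, 408, 37946281, 160, 33687433,
    136, 33687473, 34, 328, 330, 112, 120, 8454769, 66, 66, 176, 440, 33719737, 112, 44303809,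
    184, 8454833, 160, 33687433, 168, 35783961, 136, 424, 432, 33686433, 178, 178, 178, 432, 184,
    33620889, 120, 16843585, 440, 8454961, 424, 8454969, 192, 54723353, 168, 384, 408, 35816761,
    434, 434, 434, 160, 424, 33720217, 168, 8454801, 184, 35783993, 162, 264, 408, 136, 35783969,
    168, 67666985, 184, 67667497, 192, 52561185, 130, 282, 282, 104, 112, 16908825, 120, 8454761,
    82, 112, 120, 8454769, 82, 82, 400, 328, 71434849, 200, 37880417, 136, 152, 8454817, 408,
    8454817, 264, 37880737, 208, 19006625, 320, 38046113, 176, 112, 16942273, 168, 33686041, 424,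
    33686041, 160, 8454793, 416, 8454793, 184, 8454833, 440, 8454833, 296, 33719729, 312,
    37880601, 304, 37880713, 192, 104, 33719385, 120, 19039921, 42, 144, 280, 432, 69732377, 384,
    69338785, 272, 288, 33719681, 178, 130, 138, 138, 168, 104, 16974529, 432, 33686041, 160,
    8454801, 416, 8454801, 184, 8454825, 440, 8454825, 304, 33751953, 288, 37880601, 296,
    37880745, 192, 112, 33751641, 120, 19039913, 50, 144, 280, 424, 69732377, 384, 69338785, 272,
    312, 33751937, 170, 130, 138, 138, 184, 120, 16843457, 160, 33620537, 416, 33620537, 424,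
    8454825, 432, 8454833, 288, 33620913, 304, 37880633, 312, 37880745, 192, 104, 19039401, 112,
    21168817, 34, 144, 280, 440, 69731897, 384, 69338785, 272, 296, 33620865, 186, 130, 138, 138,
    160, 440, 33620537, 432, 8454793, 424, 8454801, 312, 33720209, 296, 37880633, 288, 37880713,
    192, 104, 19039377, 112, 21168777, 120, 33719929, 58, 144, 280, 416, 69731897, 384, 69338785,
    272, 304, 33720193, 162, 130, 138, 138, 432, 288, 33719697, 112, 16942273, 416, 8454921, 424,
    35784089, 440, 8454833, 304, 312, 384, 67241633, 434, 434, 434, 296, 440, 33620881, 120,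
    38011841, 312, 8454953, 304, 35784121, 288, 71434929, 336, 144, 69469377, 384, 35783969, 104,
    19039529, 112, 80085681, 34, 112, 192, 33886129, 104, 16908825, 66, 104, 106, 66, 424, 312,
    33751985, 104, 16974529, 440, 8454953, 416, 8454801, 426, 304, 416, 33720241, 288, 8454921,
    312, 71434897, 440, 442, 306, 144, 192, 280, 384, 69338785, 416, 42009401, 440, 35817273, 272,
    336, 112, 33886081, 288, 77857985, 104, 33853313, 312, 69471425, 34, 194, 130, 138, 138, 138,
    264, 280, 8454945, 408, 8454945, 336, 19006753, 192, 38046113, 304, 112, 16942401, 296,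
    67240473, 424, 67240473, 288, 8454921, 416, 8454921, 312, 8454961, 440, 8454961, 168,
    35816881, 184, 71434905, 176, 37880713, 320, 104, 67273817, 120, 19040049, 42, 152, 272, 432,
    67667993, 384, 35784481, 144, 160, 33719681, 306, 258, 266, 266, 296, 104, 16974657, 432,
    67240473, 288, 8454929, 416, 8454929, 312, 8454953, 440, 8454953, 176, 37946257, 160,
    71434905, 168, 37880745, 320, 112, 67306073, 120, 19040041, 50, 152, 272, 424, 67667993, 384,
    35784481, 144, 184, 33751937, 298, 258, 266, 266, 312, 120, 16843585, 288, 67174969, 416,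
    67174969, 424, 8454953, 432, 8454961, 160, 42009521, 176, 71434937, 184, 37880745, 320, 104,
    19039529, 112, 21168945, 34, 152, 272, 440, 67667513, 384, 35784481, 144, 168, 33620865, 314,
    258, 266, 266, 288, 440, 67174969, 432, 8454921, 424, 8454929, 184, 35817361, 168, 71434937,
    160, 37880713, 320, 104, 19039505, 112, 21168905, 120, 67274361, 58, 152, 272, 416, 67667513,
    384, 35784481, 144, 176, 33720193, 290, 258, 266, 266, 432, 160, 33719697, 112, 16942401, 424,
    67240473, 416, 8454921, 440, 8454961, 208, 38208337, 176, 184, 384, 33687329, 434, 434, 434,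
    168, 440, 33620881, 120, 38011841, 184, 8454825, 176, 33686969, 160, 37880625, 208, 272,
    35915073, 384, 69338273, 104, 19039401, 112, 46531377, 34, 112, 320, 35983281, 104, 16908825,
    66, 104, 106, 66, 424, 184, 33751985, 104, 16974657, 416, 8454929, 440, 8454953, 208,
    40176497, 426, 176, 416, 33720241, 160, 8454793, 184, 37880593, 440, 442, 178, 152, 272, 320,
    384, 35784481, 416, 75563705, 440, 69371577, 144, 208, 112, 33886081, 160, 44303681, 104,
    33853313, 184, 35917121, 34, 322, 258, 266, 266, 266, 152, 280, 37880737, 192, 19006625, 336,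
    38046113, 160, 112, 16942273, 168, 33620529, 424, 33620529, 176, 8454793, 432, 8454793, 184,
    8454809, 440, 8454809, 296, 33719705, 312, 37880625, 288, 37880713, 208, 104, 19039449, 120,
    33850929, 42, 104, 120, 8454761, 74, 74, 168, 120, 16843457, 416, 33620529, 184, 8454825, 440,
    8454825, 176, 8454841, 432, 8454841, 288, 33620921, 304, 37880625, 296, 37880745, 208, 104,
    19039401, 112, 33882673, 34, 104, 112, 16908825, 74, 74, 184, 104, 16974529, 176, 33686033,
    432, 33686033, 416, 8454809, 424, 8454825, 304, 33751961, 288, 37880593, 312, 37880745, 208,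
    112, 21168857, 120, 19039913, 50, 112, 120, 8454769, 74, 74, 176, 440, 33686033, 416, 8454793,
    424, 8454841, 312, 33720249, 296, 37880593, 304, 37880713, 208, 104, 33851921, 112, 21168777,
    120, 19039993, 58, 144, 408, 320, 33918385, 272, 71434913, 288, 76022289, 384, 432, 67274369,
    178, 130, 154, 154, 416, 304, 33719737, 112, 16942273, 432, 8454921, 424, 35784625, 440,
    8454809, 320, 92340921, 296, 104, 46400449, 408, 67174961, 384, 67241609, 288, 35784593, 272,
    35784617, 144, 33719713, 208, 33719713, 34, 208, 210, 104, 120, 8454761, 66, 66, 296, 440,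
    33751993, 104, 46400449, 312, 8454953, 288, 35784593, 304, 71434905, 272, 424, 432, 33686945,
    298, 298, 298, 424, 312, 33620889, 120, 16843457, 440, 8454953, 432, 8454841, 304, 408,
    8454969, 426, 426, 288, 432, 33720217, 304, 8454921, 312, 71434937, 290, 144, 208, 408, 272,
    71434913, 304, 71828017, 312, 69731889, 320, 19006753, 210, 154, 154, 154, 280, 320, 19006753,
    208, 38046113, 288, 112, 16942401, 296, 67174961, 424, 67174961, 304, 8454921, 432, 8454921,
    312, 8454937, 440, 8454937, 168, 35816857, 184, 71434929, 160, 37880713, 336, 104, 19039577,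
    120, 67405361, 42, 104, 120, 8454761, 74, 74, 296, 120, 16843585, 416, 67174961, 312, 8454953,
    440, 8454953, 304, 8454969, 432, 8454969, 160]

def certA5 : List Nat := [
    42009529, 176, 71434929, 168, 37880745, 336, 104, 19039529, 112, 67437105, 34, 104, 112,
    16908825, 74, 74, 312, 104, 16974657, 304, 67240465, 432, 67240465, 416, 8454937, 424,
    8454953, 176, 37946265, 160, 71434897, 184, 37880745, 336, 112, 21168985, 120, 19040041, 50,
    112, 120, 8454769, 74, 74, 304, 440, 67240465, 416, 8454921, 424, 8454969, 184, 35817401, 168,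
    71434897, 176, 37880713, 336, 104, 67406353, 112, 21168905, 120, 19040121, 58, 272, 408, 192,
    33918385, 144, 37880609, 160, 67764753, 384, 432, 33720065, 130, 130, 282, 282, 416, 176,
    33719737, 112, 16942401, 424, 67174961, 432, 8454921, 440, 8454937, 192, 58786617, 168, 104,
    46400449, 384, 67273865, 272, 35816865, 336, 35816865, 408, 35816881, 160, 33687441, 144,
    33687465, 34, 336, 338, 104, 120, 8454761, 66, 66, 168, 440, 33751993, 104, 46400449, 184,
    8454825, 160, 33687441, 176, 37880601, 144, 424, 432, 33686945, 170, 170, 170, 424, 184,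
    33620889, 120, 16843585, 440, 8454953, 432, 8454969, 192, 52593945, 176, 384, 408, 37946169,
    426, 426, 426, 160, 432, 33720217, 176, 8454793, 184, 37880633, 162, 272, 408, 144, 37880609,
    176, 67699249, 184, 67667505, 192, 19006625, 130, 282, 282, 104, 112, 16908825, 120, 8454761,
    74, 112, 120, 8454769, 74, 74, 408, 320, 69338721, 192, 35784289, 136, 144, 8454817, 208,
    8454817, 264, 35784609, 328, 35784609, 176, 120, 16843457, 160, 33620521, 416, 33620521, 184,
    8454833, 440, 8454833, 168, 8454841, 424, 8454841, 288, 33620913, 312, 35784489, 304,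
    35784633, 200, 104, 33850409, 112, 21168817, 34, 152, 272, 432, 71828009, 384, 71434913, 280,
    296, 33620865, 178, 130, 138, 138, 160, 104, 16974529, 432, 33620521, 168, 8454801, 424,
    8454801, 184, 8454809, 440, 8454809, 304, 33751953, 296, 35784489, 288, 35784601, 200, 112,
    21168857, 120, 33850921, 50, 152, 272, 416, 71828009, 384, 71434913, 280, 312, 33751937, 162,
    130, 138, 138, 184, 112, 16942273, 168, 33686537, 424, 33686537, 416, 8454809, 432, 8454833,
    296, 33719729, 304, 35784457, 312, 35784601, 200, 104, 19039449, 120, 19039921, 42, 152, 272,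
    440, 71829513, 384, 71434913, 280, 288, 33719681, 186, 130, 138, 138, 168, 440, 33686537, 416,
    8454801, 432, 8454841, 312, 33720209, 288, 35784457, 296, 35784633, 200, 104, 19039377, 112,
    33885193, 120, 19039993, 58, 152, 272, 424, 71829513, 384, 71434913, 280, 304, 33720193, 170,
    130, 138, 138, 432, 296, 33620881, 120, 16843457, 424, 8454969, 416, 35784105, 440, 8454833,
    304, 312, 384, 67240609, 434, 434, 434, 288, 440, 33719697, 112, 38014913, 312, 8454937, 304,
    35784073, 296, 69338801, 336, 152, 77857985, 384, 52561185, 104, 19039577, 120, 77989553, 42,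
    120, 200, 33851313, 104, 8454761, 66, 104, 106, 66, 416, 312, 33751985, 104, 16974529, 440,
    8454937, 424, 8454801, 418, 304, 424, 33720241, 296, 8454969, 312, 69338769, 440, 442, 306,
    152, 200, 272, 384, 71434913, 424, 35816713, 440, 35817225, 280, 336, 112, 33886081, 104,
    33853313, 312, 69471425, 34, 202, 130, 138, 138, 138, 264, 272, 8454945, 336, 8454945, 200,
    35784609, 304, 120, 16843585, 288, 67174953, 416, 67174953, 312, 8454961, 440, 8454961, 296,
    8454969, 424, 8454969, 160, 42009521, 184, 69338793, 176, 35784633, 328, 104, 67404841, 112,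
    21168945, 34, 144, 280, 432, 67699241, 384, 37880609, 152, 168, 33620865, 306, 258, 266, 266,
    288, 104, 16974657, 432, 67174953, 296, 8454929, 424, 8454929, 312, 8454937, 440, 8454937,
    176, 37946257, 168, 69338793, 160, 35784601, 328, 112, 21168985, 120, 67405353, 50, 144, 280,
    416, 67699241, 384, 37880609, 152, 184, 33751937, 290, 258, 266, 266, 312, 112, 16942401, 296,
    67240969, 424, 67240969, 416, 8454937, 432, 8454961, 168, 35816881, 176, 69338761, 184,
    35784601, 328, 104, 19039577, 120, 19040049, 42, 144, 280, 440, 67700745, 384, 37880609, 152,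
    160, 33719681, 314, 258, 266, 266, 296, 440, 67240969, 416, 8454929, 432, 8454969, 184,
    35817361, 160, 69338761, 168, 35784633, 328, 104, 19039505, 112, 67439625, 120, 19040121, 58,
    144, 280, 424, 67700745, 384, 37880609, 152, 176, 33720193, 298, 258, 266, 266, 432, 168,
    33620881, 120, 16843585, 416, 67174953, 440, 8454961, 424, 8454969, 208, 38208337, 176, 184,
    384, 33686305, 434, 434, 434, 160, 440, 33719697, 112, 38014913, 184, 8454809, 176, 33686921,
    168, 35784497, 208, 280, 44303681, 384, 86115489, 104, 19039449, 120, 44435249, 42, 120, 328,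
    44337073, 104, 8454761, 66, 104, 106, 66, 416, 184, 33751985, 104, 16974657, 424, 8454929,
    440, 8454937, 208, 46465905, 418, 176, 424, 33720241, 168, 8454841, 184, 35784465, 440, 442,
    178, 144, 280, 328, 384, 37880609, 424, 69371017, 440, 69371529, 152, 208, 112, 33886081, 104,
    33853313, 184, 35917121, 34, 330, 258, 266, 266, 266, 144, 200, 8454817, 272, 35784609, 336,
    35784609, 168, 120, 16843457, 160, 33620529, 416, 33620529, 184, 8454825, 440, 8454825, 176,
    8454841, 288, 33620905, 312, 35784497, 296, 35784633, 208, 104, 19039401, 112, 33882673, 34,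
    146, 160, 112, 16942273, 424, 33620529, 176, 8454793, 432, 8454793, 184, 8454809, 296,
    33719689, 304, 35784497, 288, 35784601, 208, 104, 19039449, 120, 33850929, 42, 146, 184, 104,
    16974529, 176, 33686033, 432, 33686033, 424, 8454825, 304, 33751977, 296, 35784465, 312,
    35784601, 208, 112, 21168857, 120, 19039913, 50, 146, 176, 440, 33686033, 416, 8454793, 312,
    33720201, 288, 35784465, 304, 35784633, 208, 104, 33851921, 112, 21168777, 120, 19039993, 58,
    146, 424, 304, 33620873, 120, 16843457, 432, 8454969, 440, 8454825, 328, 69633225, 208, 210,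
    146, 288, 104, 35917761, 312, 8454937, 296, 37880721, 304, 69338793, 152, 208, 432, 112,
    33885649, 120, 33885649, 328, 67306169, 384, 75563673, 280, 37946297, 50, 146, 146, 146, 416,
    312, 33719721, 112, 16942273, 440, 8454937, 432, 8454793, 418, 152, 208, 296, 440, 112,
    33885649, 120, 33885649, 328, 35917129, 304, 67274393, 384, 69371065, 280, 35817369, 50, 146,
    146, 146, 146, 272, 328, 8454945, 208, 35784609, 296, 120, 16843585, 288, 67174961, 416,
    67174961, 312, 8454953, 440, 8454953, 304, 8454969, 160, 42009513, 184, 69338801, 168,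
    35784633, 336, 104, 19039529, 112, 67437105, 34, 274, 288, 112, 16942401, 424, 67174961, 304,
    8454921, 432, 8454921, 312, 8454937, 168, 35816841, 176, 69338801, 160, 35784601, 336, 104,
    19039577, 120, 67405361, 42, 274, 312, 104, 16974657, 304, 67240465, 432, 67240465, 424,
    8454953, 176, 37946281, 168, 69338769, 184, 35784601, 336, 112, 21168985, 120, 19040041, 50,
    274, 304, 440, 67240465, 416, 8454921, 184, 35817353, 160, 69338769, 176, 35784633, 336, 104,
    67406353, 112, 21168905, 120, 19040121, 58, 274, 424, 176, 33620873, 120, 16843585, 440,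
    8454953, 432, 8454969, 200, 36078921, 336, 338, 274, 160, 440, 33751945, 104, 35917761, 184,
    8454809, 168, 33686417, 176, 35784489, 152, 416, 432, 33686945, 162, 162, 162, 416, 184,
    33719721, 112, 16942401, 432, 8454921, 440, 8454937, 200, 44336489, 418, 168, 280]

def certA6 : List Nat := [
    336, 440, 112, 33885649, 120, 33885649, 200, 69471433, 176, 33720089, 384, 35816761, 152,
    35817369, 50, 274, 274, 274, 274, 104, 112, 16908825, 120, 8454761, 66, 112, 120, 8454769, 66,
    66, 104, 112, 16908825, 120, 8454761, 432, 320, 16974617, 336, 16974673, 328, 16974697, 192,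
    16974489, 208, 16974545, 200, 16974569, 66, 192, 152, 35784289, 160, 42009169, 416, 42009169,
    176, 16974489, 184, 35817065, 440, 35817065, 320, 280, 69338721, 288, 75563601, 304, 16974617,
    312, 69371497, 50, 328, 272, 71434849, 296, 69370961, 304, 16974697, 312, 69470745, 50, 336,
    264, 69338209, 288, 75760153, 296, 69370985, 304, 16974673, 50, 168, 200, 35816529, 208,
    35816553, 136, 144, 16974529, 82, 74, 106, 328, 272, 71434849, 296, 69370961, 424, 69370961,
    304, 16974697, 312, 69470745, 440, 69470745, 200, 144, 37880417, 168, 35816529, 176, 16974569,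
    184, 35916313, 50, 208, 136, 35783777, 160, 42205721, 168, 35816553, 176, 16974545, 50, 288,
    336, 75760153, 320, 75563601, 264, 280, 16974657, 82, 66, 106, 208, 136, 35783777, 160,
    42205721, 416, 42205721, 168, 35816553, 424, 35816553, 176, 16974545, 336, 264, 69338209, 288,
    75760153, 296, 69370985, 304, 16974673, 50, 320, 280, 69338721, 288, 75563601, 304, 16974617,
    312, 69371497, 50, 144, 200, 37880417, 152, 184, 16974529, 440, 16974529, 106, 74, 66, 320,
    280, 69338721, 288, 75563601, 416, 75563601, 304, 16974617, 312, 69371497, 440, 69371497, 200,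
    144, 37880417, 168, 35816529, 176, 16974569, 184, 35916313, 50, 264, 336, 69338209, 272, 296,
    16974657, 424, 16974657, 106, 82, 74, 200, 136, 152, 160, 16974529, 202, 202, 202, 272, 336,
    264, 19006753, 296, 19039529, 424, 19039529, 288, 75760153, 416, 75760153, 304, 16974673, 280,
    312, 16974657, 440, 16974657, 106, 74, 66, 66, 192, 152, 35784289, 416, 320, 44304281, 168,
    19006609, 264, 42239377, 176, 21103241, 272, 42271625, 312, 44304225, 112, 42009161, 208,
    42009161, 200, 42009169, 120, 16843449, 184, 50397753, 440, 50397753, 280, 58786617, 58, 424,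
    320, 35917753, 160, 19006609, 264, 42370449, 184, 21103273, 272, 35982249, 304, 35917665, 200,
    35816529, 120, 35816553, 208, 35816553, 112, 16942233, 176, 50463257, 432, 50463257, 280,
    52593945, 50, 432, 320, 38014905, 184, 19006641, 264, 38047153, 160, 21103241, 272, 42402697,
    296, 38014817, 208, 37945929, 120, 37945969, 200, 37945969, 168, 50463257, 280, 54723353, 42,
    440, 320, 35915673, 176, 19006641, 264, 38112689, 168, 21103273, 272, 36015017, 288, 35915617,
    208, 35817065, 112, 35817073, 200, 35817073, 160, 50397753, 280, 52594489, 34, 112, 120,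
    8454769, 160, 42009161, 168, 16942233, 184, 35817073, 320, 280, 69338721, 288, 75563593, 296,
    16942361, 312, 69371505, 42, 328, 272, 71434849, 288, 75760153, 296, 16942409, 304, 71500401,
    42, 336, 264, 69338209, 296, 16942449, 304, 71500361, 312, 69470745, 42, 176, 208, 37945929,
    200, 37945969, 136, 144, 16942273, 82, 74, 114, 120, 160, 16843449, 168, 35816553, 176,
    37945969, 320, 280, 69338721, 288, 16843577, 296, 69370985, 304, 71500401, 34, 328, 272,
    71434849, 288, 16843625, 296, 69469241, 312, 69371505, 34, 336, 264, 69338209, 288, 16843633,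
    304, 71565881, 312, 69371497, 34, 184, 208, 35817065, 200, 35817073, 136, 144, 16843457, 82,
    74, 122, 200, 136, 21103265, 144, 37880417, 160, 42009169, 168, 35816529, 176, 37945969, 184,
    35817073, 208, 384, 280, 69338785, 272, 71600289, 264, 69535905, 288, 109314585, 34, 130, 130,
    320, 280, 69338721, 208, 144, 19006625, 136, 35783777, 160, 42009161, 168, 35816553, 176,
    37945929, 184, 35817065, 130, 136, 144, 384, 312, 69469889, 304, 71569089, 296, 69471937, 288,
    77858497, 336, 38045985, 328, 35981601, 264, 272, 176, 38014785, 168, 35917633, 160, 44304193,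
    34, 82, 74, 194, 194, 194, 144, 208, 19006625, 194, 194, 328, 272, 71434849, 200, 432,
    38011849, 440, 38013929, 416, 46400457, 424, 40111081, 144, 37880417, 112, 120, 8454769, 288,
    75760153, 296, 16942409, 304, 71500401, 160, 42205721, 168, 16942281, 176, 37945969, 42, 120,
    288, 16843625, 296, 69469241, 312, 69371505, 160, 16843497, 168, 35914809, 184, 35817073, 34,
    208, 152, 8454817, 136, 35783777, 160, 42205721, 168, 35914809, 176, 38011449, 184, 35916313,
    130, 136, 152, 384, 304, 71566017, 312, 71568065, 288, 79954625, 296, 73665217, 336, 35784481,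
    320, 35981601, 264, 280, 184, 38013761, 160, 46400321, 168, 40110913, 34, 82, 66, 202, 202,
    202, 416, 296, 8454929, 136, 42009489, 312, 21103449, 152, 42271705, 112, 75760153, 336,
    75760153, 320, 75563601, 120, 16843625, 304, 69338217, 432, 69338217, 176, 79954657, 144,
    77890793, 50, 424, 288, 8454929, 136, 35816849, 304, 21103481, 152, 35982329, 120, 69469241,
    336, 69469241, 320, 69370961, 112, 16942409, 312, 69338185, 440, 69338185, 184, 73665249, 144,
    69633225, 58, 432, 312, 8454961, 136, 37946289, 296, 21103481, 152, 42402809, 336, 71565881,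
    112, 71500401, 320, 71500401, 288, 69338217, 160, 71566049, 144, 73698537, 34, 440, 304,
    8454961, 136, 35817393, 288, 21103449, 152, 36015065, 336, 69470745, 120, 69371505, 320,
    69371505, 296, 69338185, 168, 71568097, 144, 69569737, 42, 112, 120, 8454769, 288, 75760153,
    296, 16942409, 304, 71500401, 208, 136, 35783777, 168, 16942321, 176, 37945929, 184, 35916313,
    42, 312, 336, 69470745, 320, 69371505, 264, 280, 16942401, 82, 66, 114, 120, 288, 16843625,
    296, 69469241, 312, 69371505, 208, 136, 35783777, 160, 16843505, 176, 38011449, 184, 35817065,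
    34, 304, 336, 71565881, 320, 71500401, 264, 280, 16843585, 82, 66, 122, 336, 280, 8454945,
    264, 69338209, 330, 208, 210, 82, 208, 136, 35783777, 336, 424, 35915217, 416, 44303825, 440,
    35917297, 432, 40111601, 264, 69338209, 112, 120, 8454769, 296, 16942449, 304, 71500361, 312,
    69470745, 168, 16942321, 176, 37945929, 184, 35916313, 42, 120, 288, 16843633, 304, 71565881,
    312, 69371497, 160, 16843505, 176, 38011449, 184, 35817065, 34, 200, 202, 152, 280, 320,
    69338721, 144, 272, 384, 160, 44303681, 288, 77857985, 184, 35917121, 312, 69471425, 176,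
    40111425, 304, 73665729, 34, 210, 66, 66, 74, 74, 112, 120, 8454769, 168, 16942321, 424,
    16942321, 176, 37945929, 432, 37945929, 184, 35916313, 440, 35916313, 320, 280, 69338721, 288,
    75563593, 296, 16942361, 312, 69371505, 42, 144, 200, 37880417, 152, 160, 16942273, 416,
    16942273, 114, 74, 66, 120, 160, 16843505, 416, 16843505, 176, 38011449, 432, 38011449, 184,
    35817065, 440, 35817065, 320, 280, 69338721, 288, 16843577, 296, 69370985, 304, 71500401, 34,
    144, 200, 37880417, 152, 168, 16843457, 424, 16843457, 122, 74, 66, 320, 322, 66, 320, 280,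
    69338721, 112, 120, 8454769, 288, 75563593, 416, 75563593, 296, 16942361, 424, 16942361, 312,
    69371505, 440, 69371505, 200, 144, 37880417, 160, 42205721, 168, 16942281, 176, 37945969, 42,
    264, 336, 69338209, 272, 304, 16942401, 432, 16942401, 114, 82, 74, 120, 288, 16843577, 416,
    16843577, 296, 69370985, 424, 69370985, 304, 71500401, 432, 71500401, 200, 144, 37880417, 160,
    16843497, 168, 35914809, 184, 35817073, 34, 264, 336, 69338209, 272, 312, 16843585]

def certA7 : List Nat := [
    440, 16843585, 122, 82, 74, 200, 202, 74, 200, 112, 120, 8454769, 136, 152, 184, 16942273,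
    202, 202, 202, 120, 136, 152, 176, 16843457, 202, 202, 202, 202, 336, 264, 69338209, 112, 120,
    8454769, 296, 16942449, 424, 16942449, 304, 71500361, 432, 71500361, 312, 69470745, 440,
    69470745, 272, 280, 288, 16942401, 416, 16942401, 114, 74, 66, 120, 272, 312, 19040041, 440,
    19040041, 288, 16843633, 416, 16843633, 304, 71565881, 432, 71565881, 280, 296, 16843585, 424,
    16843585, 122, 74, 66, 66, 112, 120, 8454769, 66, 66]

def certA : List Nat := certA0 ++ (certA1 ++ (certA2 ++ (certA3 ++ (certA4 ++ (certA5 ++ (certA6 ++ (certA7)))))))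

def certB0 : List Nat := [
    480, 42337249, 496, 42337249, 488, 35949537, 504, 35949537, 464, 38077393, 472, 35948497, 432,
    37946289, 440, 35817393, 400, 46531553, 408, 36016097, 416, 46466001, 424, 35983313, 448,
    54723505, 456, 36015537, 120, 8454769, 248, 8454769, 376, 8454769, 368, 69338225, 240,
    35783793, 176, 184, 8454833, 200, 21168817, 336, 42402785, 344, 40144865, 352, 38208465, 360,
    38047697, 208, 224, 16909553, 232, 16909553, 216, 16843473, 168, 33686041, 104, 19039473, 152,
    33751657, 144, 21168777, 80, 37945929, 88, 16974505, 48, 38076969, 304, 38076969, 56,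
    21103305, 312, 21103305, 26, 216, 224, 16909553, 232, 16909553, 160, 33620521, 96, 25232113,
    144, 33751641, 152, 21168825, 88, 37945977, 80, 16974489, 48, 35948569, 304, 35948569, 56,
    19007225, 312, 19007225, 18, 224, 232, 16909025, 152, 33620521, 88, 19007217, 168, 33751641,
    160, 21168777, 96, 37945929, 104, 16974489, 48, 42336793, 304, 42336793, 56, 25232073, 312,
    25232073, 42, 232, 144, 33686041, 80, 21103345, 160, 33751657, 168, 21168825, 104, 37945977,
    96, 16974505, 48, 35947561, 304, 35947561, 56, 19039481, 312, 19039481, 34, 304, 312, 8454961,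
    392, 37946161, 328, 21168945, 80, 272, 16942401, 144, 16942273, 104, 16908825, 88, 69338209,
    96, 16909641, 82, 152, 280, 33620865, 88, 16843457, 160, 33620521, 144, 69338273, 168,
    33686969, 154, 288, 160, 33687425, 96, 16910145, 280, 67174953, 296, 35783953, 272, 35784073,
    290, 296, 168, 33686401, 104, 16909121, 272, 67240473, 280, 35784121, 298, 48, 56, 132107,
    320, 280, 88, 16843585, 384, 69469889, 272, 35783969, 96, 67175017, 104, 44434873, 74, 272,
    384, 71568065, 266, 266, 272, 280, 1049611, 266, 266, 320, 280, 88, 16843585, 384, 69469889,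
    272, 35783969, 96, 67175017, 104, 44434873, 66, 272, 384, 71568065, 258, 258, 272, 280,
    1049611, 258, 258, 312, 384, 37946161, 320, 21168945, 80, 280, 16942401, 144, 16942273, 104,
    16908825, 96, 8454729, 88, 8454753, 82, 152, 272, 33620865, 88, 16843457, 160, 33620521, 144,
    8454817, 168, 8454841, 154, 288, 168, 33686401, 104, 16909121, 280, 8454937, 272, 67241145,
    296, 35783953, 290, 296, 160, 33687425, 96, 16910145, 272, 8454953, 280, 67241097, 298, 48,
    56, 132107, 328, 272, 88, 16843585, 392, 71566017, 280, 35783969, 96, 25232233, 104, 67503289,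
    74, 280, 392, 71569089, 258, 258, 272, 280, 1049611, 258, 258, 328, 272, 88, 16843585, 392,
    71566017, 280, 35783969, 96, 25232233, 104, 67503289, 66, 280, 392, 71569089, 266, 266, 272,
    280, 1049611, 266, 266, 80, 144, 16942273, 104, 16908825, 96, 16909513, 88, 16974561, 48, 56,
    132107, 114, 114, 88, 152, 16843457, 96, 16843305, 104, 16909561, 48, 56, 132107, 114, 114,
    96, 160, 16910017, 104, 16974545, 48, 56, 132107, 114, 114, 48, 56, 132107, 114, 114, 304,
    312, 8454961, 328, 21168945, 208, 46597089, 216, 35950561, 224, 46597073, 232, 35950545, 336,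
    352, 16909681, 360, 16909681, 344, 16843601, 296, 67240473, 104, 19039601, 280, 67306089, 272,
    21168905, 80, 71500361, 88, 16974633, 48, 71631401, 56, 21103433, 184, 21103433, 26, 344, 352,
    16909681, 360, 16909681, 288, 67174953, 96, 25232241, 272, 67306073, 280, 21168953, 88,
    71500409, 80, 16974617, 48, 69503001, 56, 19007353, 184, 19007353, 18, 352, 360, 16909153,
    280, 67174953, 88, 19007345, 296, 67306073, 288, 21168905, 96, 71500361, 104, 16974617, 48,
    75891225, 56, 25232201, 184, 25232201, 42, 360, 272, 67240473, 80, 21103473, 288, 67306089,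
    296, 21168953, 104, 71500409, 96, 16974633, 48, 69501993, 56, 19039609, 184, 19039609, 34,
    184, 384, 35817265, 192, 21168817, 80, 272, 16942401, 152, 16942273, 104, 16908825, 96,
    8454729, 88, 8454753, 82, 144, 280, 33620865, 88, 16843457, 168, 8454825, 152, 69338273, 160,
    33686841, 146, 288, 168, 33687425, 96, 16910145, 280, 67174953, 272, 8454921, 296, 8454929,
    290, 296, 160, 33686401, 104, 16909121, 272, 67240473, 280, 8454969, 298, 48, 56, 132107, 320,
    280, 88, 16843585, 392, 69469889, 272, 8454945, 96, 67175017, 104, 19039545, 74, 272, 392,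
    71568065, 266, 266, 272, 280, 1049611, 266, 266, 320, 280, 88, 16843585, 392, 69469889, 272,
    8454945, 96, 67503337, 104, 19039545, 66, 272, 392, 71568065, 258, 258, 272, 280, 1049611,
    258, 258, 80, 272, 16942401, 104, 16908825, 96, 16909641, 88, 16974689, 48, 56, 132107, 114,
    114, 88, 280, 16843585, 96, 16843305, 104, 16909689, 48, 56, 132107, 114, 114, 96, 288,
    16910145, 104, 16974673, 48, 56, 132107, 114, 114, 48, 56, 132107, 114, 114, 208, 216,
    16843473, 168, 21168849, 312, 40209377, 352, 38208433, 360, 38112177, 184, 224, 16909553, 232,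
    16909553, 192, 33620553, 96, 25232113, 144, 33882681, 152, 21168857, 80, 35916313, 336,
    35916313, 88, 16942841, 344, 16942841, 56, 37880441, 48, 21103257, 18, 224, 232, 16909025,
    152, 33620553, 56, 16942833, 200, 33882681, 192, 21168777, 96, 38076969, 104, 21103257, 80,
    42336793, 336, 42336793, 88, 25232041, 344, 25232041, 74, 232, 144, 33817113, 48, 16974577,
    192, 33751657, 200, 21168857, 104, 37880441, 96, 21103305, 80, 35816521, 336, 35816521, 88,
    19039481, 344, 19039481, 66, 336, 344, 16843601, 392, 38077265, 296, 21168977, 48, 272,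
    19006753, 144, 19006625, 104, 16908825, 56, 69338209, 96, 16909609, 50, 152, 280, 33620865,
    192, 33620553, 144, 69469377, 200, 33818073, 56, 8454817, 154, 320, 192, 33818497, 96,
    16910113, 280, 67174985, 328, 35915025, 272, 35915145, 322, 328, 200, 33817473, 104, 16909089,
    272, 67371545, 280, 35915225, 330, 80, 88, 263179, 288, 280, 272, 35915073, 56, 8454945, 384,
    69338785, 96, 67175017, 104, 44434905, 42, 272, 384, 71600289, 266, 266, 272, 280, 1049611,
    266, 266, 288, 280, 272, 35915073, 56, 8454945, 384, 69338785, 96, 67175017, 104, 44434905,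
    34, 272, 384, 71600289, 258, 258, 272, 280, 1049611, 258, 258, 344, 384, 38077265, 288,
    21168977, 48, 280, 19006753, 144, 19006625, 104, 16908825, 96, 16843305, 56, 8454753, 50, 152,
    272, 33620865, 192, 33620553, 144, 16843457, 200, 16843481, 56, 8454817, 154, 320, 200,
    33817473, 104, 16909089, 280, 16843545, 272, 67372249, 328, 35915025, 322, 328, 192, 33818497,
    96, 16910113, 272, 16843593, 280, 67372169, 330, 80, 88, 263179, 296, 272, 280, 35915073, 56,
    8454945, 392, 71434913, 96, 25232233, 104, 67503321, 42, 280, 392, 71665825, 258, 258, 272,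
    280, 1049611, 258, 258, 296, 272, 280, 35915073, 56, 8454945, 392, 71434913, 96, 25232233,
    104, 67503321, 34, 280, 392, 71665825, 266, 266, 272, 280, 1049611, 266, 266, 48, 144,
    19006625, 104, 16908825, 96, 16909481, 56, 21103329, 80, 88, 263179, 114, 114, 56, 152,
    8454817, 96, 8454729, 104, 16909561, 80, 88, 263179, 114, 114, 96, 104, 21103281, 80, 88,
    263179, 114, 114, 80, 88, 263179, 114, 114, 336, 344, 16843601, 296, 21168977, 184, 36015073,
    224, 42402737, 232, 36015025, 312, 352, 16909681, 360, 16909681, 320, 67174985, 96, 25232241,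
    272, 67437113, 280, 21168985, 80, 69470745, 88, 16942969, 216, 16942969, 56, 71434873, 48,
    21103385, 18, 352]

def certB1 : List Nat := [
    360, 16909153, 280, 67174985, 56, 16942961, 328, 67437113, 320, 21168905, 96, 71631401, 104,
    21103385, 80, 75891225, 88, 25232169, 216, 25232169, 74, 360, 272, 67371545, 48, 16974705,
    320, 67306089, 328, 21168985, 104, 71434873, 96, 21103433, 80, 69370953, 88, 19039609, 216,
    19039609, 66, 216, 384, 35948369, 160, 21168849, 48, 272, 19006753, 152, 19006625, 104,
    16908825, 96, 16843305, 56, 8454753, 50, 144, 280, 33620865, 200, 16843465, 152, 69469377,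
    192, 33817945, 56, 8454817, 146, 320, 200, 33818497, 96, 16910113, 280, 67174985, 272,
    16843529, 328, 16843537, 322, 328, 192, 33817473, 104, 16909089, 272, 67371545, 280, 16843609,
    330, 80, 88, 263179, 288, 280, 272, 16843585, 56, 8454945, 392, 69338785, 96, 67175017, 104,
    19039577, 42, 272, 392, 71600289, 266, 266, 272, 280, 1049611, 266, 266, 288, 280, 272,
    16843585, 56, 8454945, 392, 69338785, 96, 67503337, 104, 19039577, 34, 272, 392, 71600289,
    258, 258, 272, 280, 1049611, 258, 258, 48, 272, 19006753, 104, 16908825, 96, 16909609, 56,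
    21103457, 80, 88, 263179, 114, 114, 56, 280, 8454945, 96, 8454729, 104, 16909689, 80, 88,
    263179, 114, 114, 96, 104, 21103409, 80, 88, 263179, 114, 114, 80, 88, 263179, 114, 114, 224,
    232, 16909025, 152, 21168865, 312, 44468177, 344, 42370993, 184, 216, 16909553, 192, 33686089,
    80, 21103345, 160, 33882681, 168, 21168873, 96, 35915305, 352, 35915305, 104, 16942841, 360,
    16942841, 56, 42009209, 48, 25232041, 34, 216, 160, 33817129, 48, 16974577, 192, 33751641,
    200, 21168873, 96, 35784265, 352, 35784265, 104, 19007225, 360, 19007225, 88, 42009209, 80,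
    25232073, 66, 352, 360, 16909153, 392, 42337121, 280, 21168993, 48, 288, 19006737, 160,
    19006609, 88, 16843305, 56, 69338193, 80, 16909593, 50, 168, 296, 33686401, 192, 33686089,
    160, 69470401, 200, 33819113, 56, 8454801, 170, 320, 192, 33819521, 296, 67240521, 328,
    35916065, 288, 35916169, 80, 16942353, 322, 328, 200, 33817473, 288, 67371561, 296, 35916265,
    88, 16843537, 330, 96, 104, 264203, 272, 296, 288, 35916097, 56, 8454929, 384, 69371025, 80,
    67240537, 88, 40176105, 26, 288, 384, 75793553, 266, 266, 288, 296, 1050635, 266, 266, 272,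
    296, 288, 35916097, 56, 8454929, 384, 69371025, 80, 67240537, 88, 40176105, 18, 288, 384,
    75793553, 258, 258, 288, 296, 1050635, 258, 258, 360, 384, 42337121, 272, 21168993, 48, 296,
    19006737, 160, 19006609, 80, 16908825, 88, 16843305, 56, 8454737, 50, 168, 288, 33686401, 192,
    33686089, 160, 16908993, 200, 16909033, 56, 8454801, 170, 320, 200, 33817473, 296, 16909097,
    288, 67373289, 328, 35916065, 88, 16843537, 322, 328, 192, 33819521, 288, 16909129, 296,
    67373193, 80, 16942353, 330, 96, 104, 264203, 280, 288, 296, 35916097, 56, 8454929, 392,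
    75563665, 80, 21103449, 88, 67438825, 26, 296, 392, 75924625, 258, 258, 288, 296, 1050635,
    258, 258, 280, 288, 296, 35916097, 56, 8454929, 392, 75563665, 80, 21103449, 88, 67438825, 18,
    296, 392, 75924625, 266, 266, 288, 296, 1050635, 266, 266, 48, 160, 19006609, 88, 16843305,
    80, 16909465, 56, 25232081, 96, 104, 264203, 114, 114, 56, 168, 8454801, 80, 8454729, 88,
    16909561, 96, 104, 264203, 114, 114, 80, 88, 25232049, 96, 104, 264203, 114, 114, 96, 104,
    264203, 114, 114, 352, 360, 16909153, 280, 21168993, 184, 36079569, 216, 36079537, 312, 344,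
    16909681, 320, 67240521, 80, 21103473, 288, 67437113, 296, 21169001, 96, 69469737, 104,
    16942969, 232, 16942969, 56, 75563641, 48, 25232169, 34, 344, 288, 67371561, 48, 16974705,
    320, 67306073, 328, 21169001, 96, 69338697, 104, 19007353, 232, 19007353, 88, 75563641, 80,
    25232201, 66, 232, 384, 35949409, 144, 21168865, 48, 288, 19006737, 168, 19006609, 80,
    16908825, 88, 16843305, 56, 8454737, 50, 160, 296, 33686401, 200, 16909001, 168, 69470401,
    192, 33818985, 56, 8454801, 162, 320, 200, 33819521, 296, 67240521, 288, 16909065, 328,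
    16909089, 80, 16942353, 322, 328, 192, 33817473, 288, 67371561, 296, 16909161, 88, 16843537,
    330, 96, 104, 264203, 272, 296, 288, 16909121, 56, 8454929, 392, 69371025, 80, 67240537, 88,
    19007337, 26, 288, 392, 75793553, 266, 266, 288, 296, 1050635, 266, 266, 272, 296, 288,
    16909121, 56, 8454929, 392, 69371025, 80, 67438809, 88, 19007337, 18, 288, 392, 75793553, 258,
    258, 288, 296, 1050635, 258, 258, 48, 288, 19006737, 88, 16843305, 80, 16909593, 56, 25232209,
    96, 104, 264203, 114, 114, 56, 296, 8454929, 80, 8454729, 88, 16909689, 96, 104, 264203, 114,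
    114, 80, 88, 25232177, 96, 104, 264203, 114, 114, 96, 104, 264203, 114, 114, 184, 192,
    21168817, 344, 42371041, 360, 38112209, 216, 232, 16909553, 160, 8454809, 104, 19039473, 152,
    33885193, 144, 21168873, 88, 35915305, 80, 16942793, 56, 35784265, 312, 35784265, 48,
    19007145, 26, 232, 144, 8454825, 88, 19007217, 168, 33885193, 160, 21168857, 104, 35916313,
    96, 16942793, 56, 35816521, 312, 35816521, 48, 19039385, 42, 312, 392, 35817265, 320,
    21168945, 80, 280, 16942401, 152, 16942273, 96, 8454729, 88, 69338209, 104, 16909593, 82, 144,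
    272, 33620865, 88, 16843457, 160, 33620537, 152, 8454817, 168, 8454825, 146, 288, 160,
    33686401, 104, 16909121, 272, 67174969, 296, 8454929, 280, 8454937, 290, 296, 168, 33687425,
    96, 16910145, 280, 67240969, 272, 8454953, 298, 48, 56, 132107, 328, 272, 88, 16843585, 384,
    71566017, 280, 8454945, 96, 25232233, 104, 67404857, 74, 280, 384, 71569089, 258, 258, 272,
    280, 1049611, 258, 258, 328, 272, 88, 16843585, 384, 71566017, 280, 8454945, 96, 36046313,
    104, 67404857, 66, 280, 384, 71569089, 266, 266, 272, 280, 1049611, 266, 266, 80, 152,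
    16942273, 96, 8454729, 104, 16909465, 88, 16942817, 48, 56, 132107, 114, 114, 88, 144,
    16843457, 104, 8454777, 96, 16909481, 48, 56, 132107, 114, 114, 96, 168, 16910017, 104,
    16942801, 48, 56, 132107, 114, 114, 48, 56, 132107, 114, 114, 312, 320, 21168945, 216,
    44468193, 232, 40209361, 344, 360, 16909681, 288, 8454937, 104, 19039601, 280, 67439625, 272,
    21169001, 88, 69469737, 80, 16942921, 56, 69338697, 48, 19007273, 26, 360, 272, 8454953, 88,
    19007345, 296, 67439625, 288, 21168985, 104, 69470745, 96, 16942921, 56, 69370953, 48,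
    19039513, 42, 80, 280, 16942401, 96, 8454729, 104, 16909593, 88, 16942945, 48, 56, 132107,
    114, 114, 88, 272, 16843585, 104, 8454777, 96, 16909609, 48, 56, 132107, 114, 114, 96, 296,
    16910145, 104, 16942929, 48, 56, 132107, 114, 114, 48, 56, 132107, 114, 114, 216, 160,
    21168849, 360, 38047665, 232, 144, 16843465, 56, 16942833, 200, 33885193, 192, 21168825, 104,
    35948569, 96, 19007145, 88, 35947561, 344, 35947561, 80, 19039385, 74, 344, 392, 35948369,
    288, 21168977, 48, 280, 19006753, 152, 19006625, 96, 16843305, 56, 69338209, 104, 16909593,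
    50, 144, 272, 33620865, 192, 33620569, 152, 16843457, 200, 16843465, 56, 8454817, 146, 320,
    192, 33817473, 104]

def certB2 : List Nat := [
    16909089, 272, 67175001, 328, 16843537, 280, 16843545, 322, 328, 200, 33818497, 96, 16910113,
    280, 67372041, 272, 16843593, 330, 80, 88, 263179, 296, 272, 280, 16843585, 56, 8454945, 384,
    71434913, 96, 25232233, 104, 67273817, 42, 280, 384, 71665825, 258, 258, 272, 280, 1049611,
    258, 258, 296, 272, 280, 16843585, 56, 8454945, 384, 71434913, 96, 36046313, 104, 67273817,
    34, 280, 384, 71665825, 266, 266, 272, 280, 1049611, 266, 266, 48, 152, 19006625, 96,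
    16843305, 104, 16909465, 56, 19007201, 80, 88, 263179, 114, 114, 56, 144, 8454817, 104,
    8454777, 96, 16909513, 80, 88, 263179, 114, 114, 96, 104, 19007153, 80, 88, 263179, 114, 114,
    80, 88, 263179, 114, 114, 344, 288, 21168977, 232, 40144817, 360, 272, 16843593, 56, 16942961,
    328, 67439625, 320, 21168953, 104, 69503001, 96, 19007273, 88, 69501993, 80, 19039513, 74, 48,
    280, 19006753, 96, 16843305, 104, 16909593, 56, 19007329, 80, 88, 263179, 114, 114, 56, 272,
    8454945, 104, 8454777, 96, 16909641, 80, 88, 263179, 114, 114, 96, 104, 19007281, 80, 88,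
    263179, 114, 114, 80, 88, 263179, 114, 114, 232, 144, 21168865, 360, 392, 35949409, 272,
    21168993, 48, 296, 19006737, 168, 19006609, 80, 16908825, 56, 69338193, 88, 16909609, 50, 160,
    288, 33686401, 192, 33686121, 168, 16908993, 200, 16909001, 56, 8454801, 162, 320, 192,
    33817473, 288, 67240553, 328, 16909089, 296, 16909097, 88, 16843537, 322, 328, 200, 33819521,
    296, 67373065, 288, 16909129, 80, 16942353, 330, 96, 104, 264203, 280, 288, 296, 16909121, 56,
    8454929, 384, 75563665, 80, 21103449, 88, 67241577, 26, 296, 384, 75924625, 258, 258, 288,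
    296, 1050635, 258, 258, 280, 288, 296, 16909121, 56, 8454929, 384, 75563665, 80, 35981785, 88,
    67241577, 18, 296, 384, 75924625, 266, 266, 288, 296, 1050635, 266, 266, 48, 168, 19006609,
    80, 16908825, 88, 16909481, 56, 19039441, 96, 104, 264203, 114, 114, 56, 160, 8454801, 88,
    8454777, 80, 16909513, 96, 104, 264203, 114, 114, 80, 88, 19039409, 96, 104, 264203, 114, 114,
    96, 104, 264203, 114, 114, 360, 272, 21168993, 48, 296, 19006737, 80, 16908825, 88, 16909609,
    56, 19039569, 96, 104, 264203, 114, 114, 56, 288, 8454929, 88, 8454777, 80, 16909641, 96, 104,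
    264203, 114, 114, 80, 88, 19039537, 96, 104, 264203, 114, 114, 96, 104, 264203, 114, 114, 48,
    56, 132107, 80, 104, 16908825, 88, 263179, 114, 96, 104, 264203, 114, 114, 56, 80, 96,
    8454729, 88, 263179, 114, 96, 104, 264203, 114, 114, 80, 88, 263179, 114, 114]

def certB : List Nat := certB0 ++ (certB1 ++ (certB2))

def certC0 : List Nat := [
    480, 42337249, 496, 42337249, 488, 35949537, 504, 35949537, 464, 38077393, 472, 35948497, 432,
    37946289, 440, 35817393, 368, 21169009, 376, 19040113, 240, 21168881, 248, 19039985, 48, 56,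
    132107, 80, 88, 263179, 144, 152, 525323, 272, 280, 1049611, 96, 104, 264203, 160, 296,
    73665217, 200, 35947569, 168, 526347, 192, 328, 73697441, 392, 73959521, 508, 320, 392,
    69764209, 288, 328, 69502001, 508, 98, 82, 288, 168, 40110913, 328, 69502001, 320, 200,
    40143137, 296, 69370961, 392, 69830753, 508, 98, 50, 160, 288, 104, 33917825, 392, 69764145,
    192, 320, 200, 44336401, 168, 52593937, 328, 77890705, 296, 86148241, 508, 82, 82, 50, 50,
    280, 96, 104, 264203, 160, 288, 77858497, 200, 35947569, 168, 526347, 192, 320, 86116001, 384,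
    102893153, 268, 328, 384, 100729457, 296, 320, 83952177, 268, 98, 82, 296, 168, 40110913, 320,
    83952177, 328, 200, 40143137, 288, 75563601, 384, 104989281, 268, 98, 50, 160, 296, 104,
    33917825, 384, 100729393, 192, 328, 200, 44336401, 168, 52593937, 288, 77890705, 320,
    86148241, 268, 82, 82, 50, 50, 96, 160, 200, 35947569, 192, 104, 19039377, 168, 35816529, 288,
    328, 77890705, 392, 78152785, 296, 1050635, 508, 296, 320, 86148241, 384, 102925393, 268, 320,
    392, 86541361, 328, 330, 258, 328, 330, 258, 82, 50, 50, 152, 272, 280, 1049611, 96, 104,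
    264203, 168, 296, 73665217, 192, 50397745, 160, 526347, 200, 328, 73697441, 384, 104989281,
    380, 320, 384, 100729457, 288, 328, 69502001, 380, 98, 82, 288, 160, 44304193, 328, 69502001,
    320, 192, 52561697, 296, 69370961, 384, 102893153, 380, 98, 50, 168, 288, 104, 33917825, 384,
    100729393, 200, 320, 160, 44336401, 192, 52593937, 328, 77890705, 296, 86148241, 380, 82, 82,
    50, 50, 280, 96, 104, 264203, 168, 288, 77858497, 192, 50397745, 160, 526347, 200, 320,
    86116001, 392, 69830753, 396, 328, 392, 69764209, 296, 320, 83952177, 396, 98, 82, 296, 160,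
    44304193, 320, 83952177, 328, 192, 52561697, 288, 75563601, 392, 73959521, 396, 98, 50, 168,
    296, 104, 33917825, 392, 69764145, 200, 328, 160, 44336401, 192, 52593937, 288, 77890705, 320,
    86148241, 396, 82, 82, 50, 50, 96, 168, 192, 50397745, 200, 104, 19039377, 160, 42009169, 288,
    328, 77890705, 384, 109118033, 296, 1050635, 380, 296, 320, 86148241, 392, 69895249, 396, 320,
    384, 117506609, 328, 330, 258, 328, 330, 258, 82, 50, 50, 272, 280, 1049611, 96, 288, 328,
    69502001, 320, 104, 19039505, 296, 69370961, 160, 200, 44336401, 392, 69895249, 168, 526347,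
    508, 168, 192, 52593937, 384, 102925393, 380, 192, 392, 70026289, 200, 202, 130, 200, 202,
    130, 82, 50, 50, 280, 96, 296, 320, 83952177, 328, 104, 19039505, 288, 75563601, 160, 200,
    44336401, 384, 109118033, 168, 526347, 268, 168, 192, 52593937, 392, 78152785, 396, 192, 384,
    117506609, 200, 202, 130, 200, 202, 130, 82, 50, 50, 18, 88, 144, 152, 525323, 272, 280,
    1049611, 104, 96, 264203, 160, 296, 73665217, 192, 50397745, 168, 526347, 200, 320, 88212129,
    392, 73959521, 444, 328, 392, 78283889, 288, 320, 83952177, 444, 106, 90, 288, 168, 40110913,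
    320, 83952177, 328, 192, 54657825, 296, 69370961, 392, 69830753, 444, 106, 50, 160, 288, 96,
    33982337, 392, 69764145, 200, 328, 192, 58786577, 168, 36078865, 320, 92340881, 296, 69633169,
    444, 90, 90, 50, 50, 280, 104, 96, 264203, 160, 288, 77858497, 192, 50397745, 168, 526347,
    200, 328, 69568673, 384, 102893153, 332, 320, 384, 100828273, 296, 328, 69502001, 332, 106,
    90, 296, 168, 40110913, 328, 69502001, 320, 192, 54657825, 288, 75563601, 384, 104989281, 332,
    106, 50, 160, 296, 96, 33982337, 384, 100729393, 200, 320, 192, 58786577, 168, 36078865, 288,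
    92340881, 328, 69633169, 332, 90, 90, 50, 50, 104, 160, 192, 50397745, 200, 96, 25232017, 168,
    35816529, 288, 320, 92340881, 392, 78152785, 296, 1050635, 444, 296, 328, 69633169, 384,
    102925393, 332, 320, 384, 117506609, 328, 330, 258, 328, 330, 258, 90, 50, 50, 152, 272, 280,
    1049611, 104, 96, 264203, 168, 296, 73665217, 200, 35947569, 160, 526347, 192, 320, 88212129,
    384, 104989281, 316, 328, 384, 100828273, 288, 320, 83952177, 316, 106, 90, 288, 160,
    44304193, 320, 83952177, 328, 200, 36014369, 296, 69370961, 384, 102893153, 316, 106, 50, 168,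
    288, 96, 33982337, 384, 100729393, 192, 328, 160, 58786577, 200, 36078865, 320, 92340881, 296,
    69633169, 316, 90, 90, 50, 50, 280, 104, 96, 264203, 168, 288, 77858497, 200, 35947569, 160,
    526347, 192, 328, 69568673, 392, 69830753, 460, 320, 392, 78283889, 296, 328, 69502001, 460,
    106, 90, 296, 160, 44304193, 328, 69502001, 320, 200, 36014369, 288, 75563601, 392, 73959521,
    460, 106, 50, 168, 296, 96, 33982337, 392, 69764145, 192, 320, 160, 58786577, 200, 36078865,
    288, 92340881, 328, 69633169, 460, 90, 90, 50, 50, 104, 168, 200, 35947569, 192, 96, 25232017,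
    160, 42009169, 288, 320, 92340881, 384, 109118033, 296, 1050635, 316, 296, 328, 69633169, 392,
    69895249, 460, 320, 392, 86541361, 328, 330, 258, 328, 330, 258, 90, 50, 50, 272, 280,
    1049611, 104, 288, 320, 83952177, 328, 96, 25232145, 296, 69370961, 160, 192, 58786577, 392,
    69895249, 168, 526347, 444, 168, 200, 36078865, 384, 102925393, 316, 192, 384, 117506609, 200,
    202, 130, 200, 202, 130, 90, 50, 50, 280, 104, 296, 328, 69502001, 320, 96, 25232145, 288,
    75563601, 160, 192, 58786577, 384, 109118033, 168, 526347, 332, 168, 200, 36078865, 392,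
    78152785, 460, 192, 392, 70026289, 200, 202, 130, 200, 202, 130, 90, 50, 50, 18, 144, 152,
    525323, 272, 280, 1049611, 160, 288, 392, 69764145, 384, 168, 35816721, 296, 69371025, 96,
    200, 36078865, 328, 69633169, 104, 264203, 508, 104, 192, 52593937, 320, 86148241, 444, 192,
    328, 70026289, 200, 202, 66, 200, 202, 66, 146, 50, 50, 280, 160, 296, 384, 100729393, 392,
    168, 35816721, 288, 75563665, 96, 200, 36078865, 320, 92340881, 104, 264203, 268, 104, 192,
    52593937, 328, 77890705, 332, 192, 320, 117506609, 200, 202, 66, 200, 202, 66, 146, 50, 50,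
    18, 152, 272, 280, 1049611, 168, 288, 384, 100729393, 392, 160, 42009361, 296, 69371025, 96,
    192, 58786577, 328, 69633169, 104, 264203, 380, 104, 200, 44336401, 320, 86148241, 316, 192,
    320, 117506609, 200, 202, 66, 200, 202, 66, 154, 50, 50, 280, 168, 296, 392, 69764145, 384,
    160, 42009361, 288, 75563665, 96, 192, 58786577, 320, 92340881, 104, 264203, 396, 104, 200,
    44336401, 328, 77890705, 460, 192, 328, 70026289, 200, 202, 66, 200, 202, 66, 154, 50, 50, 18,
    272, 280, 1049611, 18, 18, 56, 80, 88, 263179, 144, 152, 525323, 272]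

def certC1 : List Nat := [
    280, 1049611, 104, 96, 264203, 168, 288, 79954625, 200, 35947569, 160, 526347, 192, 328,
    73697441, 392, 73959521, 476, 320, 392, 78283889, 296, 328, 69502001, 476, 106, 82, 296, 160,
    46400321, 328, 69502001, 320, 200, 40143137, 288, 75563601, 392, 69830753, 476, 106, 58, 168,
    296, 96, 34014081, 392, 69764145, 192, 320, 160, 58786577, 200, 36078865, 288, 92340881, 328,
    69633169, 476, 82, 82, 58, 58, 280, 104, 96, 264203, 168, 296, 69471937, 200, 35947569, 160,
    526347, 192, 320, 86116001, 384, 102893153, 300, 328, 384, 100828273, 288, 320, 83952177, 300,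
    106, 82, 288, 160, 46400321, 320, 83952177, 328, 200, 40143137, 296, 69370961, 384, 104989281,
    300, 106, 58, 168, 288, 96, 34014081, 384, 100729393, 192, 328, 160, 58786577, 200, 36078865,
    320, 92340881, 296, 69633169, 300, 82, 82, 58, 58, 104, 168, 200, 35947569, 192, 96, 25232017,
    160, 42009169, 288, 320, 92340881, 384, 109118033, 296, 1050635, 300, 296, 328, 69633169, 392,
    69895249, 476, 320, 392, 86541361, 328, 330, 258, 328, 330, 258, 82, 58, 58, 152, 272, 280,
    1049611, 104, 96, 264203, 160, 288, 79954625, 192, 50397745, 168, 526347, 200, 328, 73697441,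
    384, 104989281, 348, 320, 384, 100828273, 296, 328, 69502001, 348, 106, 82, 296, 168,
    35917633, 328, 69502001, 320, 192, 52561697, 288, 75563601, 384, 102893153, 348, 106, 58, 160,
    296, 96, 34014081, 384, 100729393, 200, 320, 192, 58786577, 168, 36078865, 288, 92340881, 328,
    69633169, 348, 82, 82, 58, 58, 280, 104, 96, 264203, 160, 296, 69471937, 192, 50397745, 168,
    526347, 200, 320, 86116001, 392, 69830753, 428, 328, 392, 78283889, 288, 320, 83952177, 428,
    106, 82, 288, 168, 35917633, 320, 83952177, 328, 192, 52561697, 296, 69370961, 392, 73959521,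
    428, 106, 58, 160, 288, 96, 34014081, 392, 69764145, 200, 328, 192, 58786577, 168, 36078865,
    320, 92340881, 296, 69633169, 428, 82, 82, 58, 58, 104, 160, 192, 50397745, 200, 96, 25232017,
    168, 35816529, 288, 320, 92340881, 392, 78152785, 296, 1050635, 428, 296, 328, 69633169, 384,
    102925393, 348, 320, 384, 117506609, 328, 330, 258, 328, 330, 258, 82, 58, 58, 272, 280,
    1049611, 104, 296, 328, 69502001, 320, 96, 25232145, 288, 75563601, 160, 192, 58786577, 384,
    109118033, 168, 526347, 348, 168, 200, 36078865, 392, 78152785, 476, 192, 392, 70026289, 200,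
    202, 130, 200, 202, 130, 82, 58, 58, 280, 104, 288, 320, 83952177, 328, 96, 25232145, 296,
    69370961, 160, 192, 58786577, 392, 69895249, 168, 526347, 428, 168, 200, 36078865, 384,
    102925393, 300, 192, 384, 117506609, 200, 202, 130, 200, 202, 130, 82, 58, 58, 18, 88, 144,
    152, 525323, 272, 280, 1049611, 96, 104, 264203, 168, 288, 79954625, 192, 50397745, 160,
    526347, 200, 320, 88212129, 392, 73959521, 412, 328, 392, 69764209, 296, 320, 83952177, 412,
    98, 90, 296, 160, 46400321, 320, 83952177, 328, 192, 54657825, 288, 75563601, 392, 69830753,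
    412, 98, 58, 168, 296, 104, 33853313, 392, 69764145, 200, 328, 160, 44336401, 192, 52593937,
    288, 77890705, 320, 86148241, 412, 90, 90, 58, 58, 280, 96, 104, 264203, 168, 296, 69471937,
    192, 50397745, 160, 526347, 200, 328, 69568673, 384, 102893153, 364, 320, 384, 100729457, 288,
    328, 69502001, 364, 98, 90, 288, 160, 46400321, 328, 69502001, 320, 192, 54657825, 296,
    69370961, 384, 104989281, 364, 98, 58, 168, 288, 104, 33853313, 384, 100729393, 200, 320, 160,
    44336401, 192, 52593937, 328, 77890705, 296, 86148241, 364, 90, 90, 58, 58, 96, 168, 192,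
    50397745, 200, 104, 19039377, 160, 42009169, 288, 328, 77890705, 384, 109118033, 296, 1050635,
    364, 296, 320, 86148241, 392, 69895249, 412, 320, 384, 117506609, 328, 330, 258, 328, 330,
    258, 90, 58, 58, 152, 272, 280, 1049611, 96, 104, 264203, 160, 288, 79954625, 200, 35947569,
    168, 526347, 192, 320, 88212129, 384, 104989281, 284, 328, 384, 100729457, 296, 320, 83952177,
    284, 98, 90, 296, 168, 35917633, 320, 83952177, 328, 200, 36014369, 288, 75563601, 384,
    102893153, 284, 98, 58, 160, 296, 104, 33853313, 384, 100729393, 192, 328, 200, 44336401, 168,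
    52593937, 288, 77890705, 320, 86148241, 284, 90, 90, 58, 58, 280, 96, 104, 264203, 160, 296,
    69471937, 200, 35947569, 168, 526347, 192, 328, 69568673, 392, 69830753, 492, 320, 392,
    69764209, 288, 328, 69502001, 492, 98, 90, 288, 168, 35917633, 328, 69502001, 320, 200,
    36014369, 296, 69370961, 392, 73959521, 492, 98, 58, 160, 288, 104, 33853313, 392, 69764145,
    192, 320, 200, 44336401, 168, 52593937, 328, 77890705, 296, 86148241, 492, 90, 90, 58, 58, 96,
    160, 200, 35947569, 192, 104, 19039377, 168, 35816529, 288, 328, 77890705, 392, 78152785, 296,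
    1050635, 492, 296, 320, 86148241, 384, 102925393, 284, 320, 392, 86541361, 328, 330, 258, 328,
    330, 258, 90, 58, 58, 272, 280, 1049611, 96, 296, 320, 83952177, 328, 104, 19039505, 288,
    75563601, 160, 200, 44336401, 384, 109118033, 168, 526347, 284, 168, 192, 52593937, 392,
    78152785, 412, 192, 384, 117506609, 200, 202, 130, 200, 202, 130, 90, 58, 58, 280, 96, 288,
    328, 69502001, 320, 104, 19039505, 296, 69370961, 160, 200, 44336401, 392, 69895249, 168,
    526347, 492, 168, 192, 52593937, 384, 102925393, 364, 192, 392, 70026289, 200, 202, 130, 200,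
    202, 130, 90, 58, 58, 18, 144, 152, 525323, 272, 280, 1049611, 168, 296, 392, 69764145, 384,
    160, 42009361, 288, 75563665, 96, 192, 58786577, 320, 92340881, 104, 264203, 412, 104, 200,
    44336401, 328, 77890705, 476, 192, 328, 70026289, 200, 202, 66, 200, 202, 66, 146, 58, 58,
    280, 168, 288, 384, 100729393, 392, 160, 42009361, 296, 69371025, 96, 192, 58786577, 328,
    69633169, 104, 264203, 364, 104, 200, 44336401, 320, 86148241, 300, 192, 320, 117506609, 200,
    202, 66, 200, 202, 66, 146, 58, 58, 18, 152, 272, 280, 1049611, 160, 296, 384, 100729393, 392,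
    168, 35816721, 288, 75563665, 96, 200, 36078865, 320, 92340881, 104, 264203, 284, 104, 192,
    52593937, 328, 77890705, 348, 192, 320, 117506609, 200, 202, 66, 200, 202, 66, 154, 58, 58,
    280, 160, 288, 392, 69764145, 384, 168, 35816721, 296, 69371025, 96, 200, 36078865, 328,
    69633169, 104, 264203, 492, 104, 192, 52593937, 320, 86148241, 428, 192, 328, 70026289, 200,
    202, 66, 200, 202, 66, 154, 58, 58, 18, 272, 280, 1049611, 18, 18, 80, 88, 263179, 144, 152,
    525323, 272, 280, 1049611, 192, 320, 392, 69764177, 384, 200, 35947793, 328, 69502097, 96,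
    168, 36078865, 296, 69633169, 104, 264203, 508, 104, 160, 44336401, 288, 77890705, 476, 160,
    296, 69895249, 168, 170, 34, 168, 170, 34, 146]

def certC2 : List Nat := [
    82, 82, 280, 192, 328, 384, 100729425, 392, 200, 35947793, 320, 83952273, 96, 168, 36078865,
    288, 92340881, 104, 264203, 268, 104, 160, 44336401, 296, 86148241, 300, 160, 288, 109118033,
    168, 170, 34, 168, 170, 34, 146, 82, 82, 18, 152, 272, 280, 1049611, 200, 320, 384, 100729425,
    392, 192, 50397969, 328, 69502097, 96, 160, 58786577, 296, 69633169, 104, 264203, 380, 104,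
    168, 52593937, 288, 77890705, 348, 160, 288, 109118033, 168, 170, 34, 168, 170, 34, 154, 82,
    82, 280, 200, 328, 392, 69764177, 384, 192, 50397969, 320, 83952273, 96, 160, 58786577, 288,
    92340881, 104, 264203, 396, 104, 168, 52593937, 296, 86148241, 428, 160, 296, 69895249, 168,
    170, 34, 168, 170, 34, 154, 82, 82, 18, 272, 280, 1049611, 18, 18, 88, 144, 152, 525323, 272,
    280, 1049611, 200, 328, 392, 69764177, 384, 192, 50397969, 320, 83952273, 96, 160, 58786577,
    288, 92340881, 104, 264203, 412, 104, 168, 52593937, 296, 86148241, 444, 160, 296, 69895249,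
    168, 170, 34, 168, 170, 34, 146, 90, 90, 280, 200, 320, 384, 100729425, 392, 192, 50397969,
    328, 69502097, 96, 160, 58786577, 296, 69633169, 104, 264203, 364, 104, 168, 52593937, 288,
    77890705, 332, 160, 288, 109118033, 168, 170, 34, 168, 170, 34, 146, 90, 90, 18, 152, 272,
    280, 1049611, 192, 328, 384, 100729425, 392, 200, 35947793, 320, 83952273, 96, 168, 36078865,
    288, 92340881, 104, 264203, 284, 104, 160, 44336401, 296, 86148241, 316, 160, 288, 109118033,
    168, 170, 34, 168, 170, 34, 154, 90, 90, 280, 192, 320, 392, 69764177, 384, 200, 35947793,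
    328, 69502097, 96, 168, 36078865, 296, 69633169, 104, 264203, 492, 104, 160, 44336401, 288,
    77890705, 460, 160, 296, 69895249, 168, 170, 34, 168, 170, 34, 154, 90, 90, 18, 272, 280,
    1049611, 18, 18, 144, 152, 525323, 272, 280, 1049611, 18, 18, 272, 280, 1049611, 18, 18]

def certC : List Nat := certC0 ++ (certC1 ++ (certC2))

/-- Mask of the points on which the functional `f` takes the value one. -/
def fmk (f : Nat) : Nat := (fmTab >>> (64 * f)) % 18446744073709551616

/-- All cells of the partition of `m` given by the masks are nonempty. -/
def hitAll (m : Nat) : List Nat → Bool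
  | [] => Bool.not (Nat.beq m 0)
  | F :: Fs => Bool.and (hitAll (m &&& F) Fs) (hitAll (m ^^^ (m &&& F)) Fs)

/-- Remove from `m` all points in one of the masks. -/
def offAll (m : Nat) : List Nat → Nat
  | [] => m
  | F :: Fs => offAll (m ^^^ (m &&& F)) Fs

/-- Swap the two halves of every block of length `2 * w` of the mask. -/
def swp (O w m : Nat) : Nat := ((O >>> w) &&& m) ||| ((O &&& m) <<< w)

/-- Translate the mask by `z`. -/
def trl (O z : Nat) : Nat :=
  let a := bif Nat.beq (z % 2) 1 then swp O 1 6148914691236517205 else O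
  let b := bif Nat.beq (z / 2 % 2) 1 then swp a 2 3689348814741910323 else a
  let c := bif Nat.beq (z / 4 % 2) 1 then swp b 4 1085102592571150095 else b
  let d := bif Nat.beq (z / 8 % 2) 1 then swp c 8 71777214294589695 else c
  let e := bif Nat.beq (z / 16 % 2) 1 then swp d 16 281470681808895 else d
  bif Nat.beq (z / 32 % 2) 1 then swp e 32 4294967295 else e

/-- Does the mask have at most `k` points? -/
def fewPts (m : Nat) : Nat → Bool
  | 0 => Nat.beq m 0
  | k + 1 => bif Nat.beq m 0 then true else fewPts (m ^^^ (2 ^ Nat.log2 m)) k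

def agLeaf (n I p : Nat) : Bool :=
  let J := I % 2 ^ 2 ^ n
  let f0 := fmk (p % 2 ^ n)
  let fs := [fmk ((p / 64) % 2 ^ n), fmk ((p / 4096) % 2 ^ n), fmk ((p / 262144) % 2 ^ n)]
  let K := offAll J (f0 :: fs)
  Bool.and (hitAll (J &&& f0) fs) (Bool.and (Bool.not (Nat.beq K 0))
    (Bool.or (Nat.beq n 5) (Bool.not (Nat.beq (K ^^^ (2 ^ Nat.log2 K)) 0))))

def lineLeaf (n I O z : Nat) : Bool :=
  Bool.and (Bool.and (Nat.testBit I z) (Nat.blt z (2 ^ n)))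
    (fewPts ((2 ^ 2 ^ n - 1) ^^^ ((2 ^ 2 ^ n - 1) &&& (O ||| trl O z))) 7)

def leafA (n : Nat) (t I O : Nat) : Bool :=
  bif Nat.beq (t % 8) 1 then agLeaf n I (t / 8)
  else bif Nat.beq (t % 8) 2 then lineLeaf n I O (t / 8) else false

def f7Leaf (I p : Nat) : Bool :=
  let a := p % 64
  let b := (p / 64) % 64
  let c := (p / 4096) % 64
  Bool.and (Nat.testBit I a) (Bool.and (Nat.testBit I b) (Bool.and (Nat.testBit I c)
   (Bool.and (Nat.testBit I (a ^^^ b)) (Bool.and (Nat.testBit I (a ^^^ c))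
   (Bool.and (Nat.testBit I (b ^^^ c)) (Nat.testBit I (a ^^^ b ^^^ c)))))))

def gMasks (p : Nat) : List Nat :=
  [fmk 2, fmk 4, fmk 8, fmk 16, fmk 32, fmk (p % 64), fmk ((p % 64) ^^^ 62)]

/-- The points that lie in none, exactly one, exactly two of the masks. -/
def grSplit (z o t : Nat) : List Nat → Nat
  | [] => t
  | F :: Fs => grSplit (z ^^^ (z &&& F)) ((o ^^^ (o &&& F)) ||| (z &&& F))
      ((t ^^^ (t &&& F)) ||| (o &&& F)) Fs

def grLeaf (O p : Nat) : Bool :=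
  Bool.and (Nat.beq ((p % 64) % 2) 1)
    (Nat.beq (O ||| grSplit 18446744073709551615 0 0 (gMasks p)) 18446744073709551615)

def leafB (t I O : Nat) : Bool :=
  bif Nat.beq (t % 8) 3 then f7Leaf I (t / 8)
  else bif Nat.beq (t % 8) 4 then grLeaf O (t / 8) else leafA 6 t I O

def chk (leaf : Nat → Nat → Nat → Bool) : List Nat → List (Nat × Nat) → Bool
  | _, [] => true
  | [], _ :: _ => false
  | t :: ts, (I, O) :: st =>
    bif Nat.beq (t % 8) 0 then
      chk leaf ts ((I ||| 2 ^ (t / 8), O) :: (I, O ||| 2 ^ (t / 8)) :: st)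
    else bif leaf t I O then chk leaf ts st else false


set_option maxRecDepth 100000
theorem chkU : chk (leafA 5) certU [(67582, 1)] = true := by decide +kernel
theorem chkA : chk (leafA 6) certA [(4295034878, 1)] = true := by decide +kernel
theorem chkB : chk leafB certB [(12885115710, 1)] = true := by decide +kernel
theorem chkC : chk leafB certC [(12885099326, 233128077067075585)] = true := by decide +kernel

namespace ML

set_option linter.unusedSectionVars false

open Module Submodule
open scoped Classical

section basic
variable {V : Type} [AddCommGroup V] [Module (ZMod 2) V]

theorem z2 (a : ZMod 2) : a = 0 ∨ a = 1 := by revert a; decide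
theorem z2ne (a : ZMod 2) (h : a ≠ 0) : a = 1 := (z2 a).resolve_left h

theorem ads (v : V) : v + v = 0 := ZModModule.add_self v
theorem adc (v w : V) : v + (v + w) = w := by rw [← add_assoc, ads, zero_add]
theorem adc' (v w : V) : v + w + w = v := by rw [add_assoc, ads, add_zero]
theorem ad_eq_zero {v w : V} : v + w = 0 ↔ v = w := by
  rw [add_eq_zero_iff_eq_neg, ZModModule.neg_eq_self]
theorem ad_eq {u v w : V} : u + v = w ↔ u = v + w := by
  constructor
  · rintro rfl; rw [add_comm u v, adc]
  · rintro rfl; rw [add_comm v w, adc']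

theorem mem_sp {x y : V} : x ∈ span (ZMod 2) {y} ↔ x = 0 ∨ x = y := by
  rw [mem_span_singleton]
  constructor
  · rintro ⟨a, rfl⟩
    rcases z2 a with rfl | rfl <;> simp
  · rintro (rfl | rfl)
    · exact ⟨0, by simp⟩
    · exact ⟨1, by simp⟩

theorem mem_sup_sp {x y : V} {K : Submodule (ZMod 2) V} :
    x ∈ K ⊔ span (ZMod 2) {y} ↔ x ∈ K ∨ x + y ∈ K := by
  rw [mem_sup]
  constructor
  · rintro ⟨k, hk, w, hw, rfl⟩
    rcases mem_sp.1 hw with rfl | rfl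
    · left; simpa using hk
    · right; rwa [adc']
  · rintro (h | h)
    · exact ⟨x, h, 0, zero_mem _, by simp⟩
    · exact ⟨x + y, h, y, mem_span_singleton_self y, adc' x y⟩

/-- No `AG(3,2)`-minor, for a set of vectors. -/
def AGfree (S : Finset V) : Prop :=
  ∀ φ : V →ₗ[ZMod 2] (Fin 4 → ZMod 2),
    LinearMap.ker φ ≤ span (ZMod 2) {s | s ∈ S ∧ φ s = 0} →
    ¬ ∀ y : Fin 4 → ZMod 2, y 0 = 1 → ∃ s ∈ S, φ s = y

/-- The standing hypotheses. -/
structure Cfg (n : ℕ) (S : Finset V) : Prop where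
  fin : Finite V
  dim : finrank (ZMod 2) V = n
  sp : span (ZMod 2) (S : Set V) = ⊤
  z : (0 : V) ∉ S
  ag : AGfree S

/-- the quotient map by a vector -/
abbrev qm (y : V) : V →ₗ[ZMod 2] (V ⧸ span (ZMod 2) {y}) := (span (ZMod 2) {y}).mkQ

/-- contraction -/
noncomputable def con (S : Finset V) (y : V) : Finset (V ⧸ span (ZMod 2) {y}) :=
  (S.image (qm y)).erase 0

/-- elements of lines through `y` other than `y` -/
noncomputable def D2 (S : Finset V) (y : V) : Finset V := S.filter (fun s => s + y ∈ S)

theorem mem_D2 {S : Finset V} {y s : V} : s ∈ D2 S y ↔ s ∈ S ∧ s + y ∈ S := by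
  simp [D2]

theorem D2_add {S : Finset V} {y s : V} (h : s ∈ D2 S y) : s + y ∈ D2 S y := by
  rw [mem_D2] at *; rw [adc']; exact h.symm

theorem qm_zero {y v : V} : qm y v = 0 ↔ v = 0 ∨ v = y := by
  rw [mkQ_apply, Quotient.mk_eq_zero, mem_sp]

theorem qm_eq {y v w : V} : qm y v = qm y w ↔ v = w ∨ v = w + y := by
  rw [← sub_eq_zero, ← map_sub, qm_zero, ZModModule.sub_eq_add, ad_eq_zero, ad_eq]

theorem qm_self (y : V) : qm y y = 0 := qm_zero.2 (Or.inr rfl)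

theorem mem_con {S : Finset V} {y : V} {q} : q ∈ con S y ↔ q ≠ 0 ∧ ∃ s ∈ S, qm y s = q := by
  simp [con]

theorem qm_mem_con {S : Finset V} {y v : V} :
    qm y v ∈ con S y ↔ v ≠ 0 ∧ v ≠ y ∧ (v ∈ S ∨ v + y ∈ S) := by
  rw [mem_con, Ne, qm_zero]
  constructor
  · rintro ⟨h1, s, hs, h2⟩
    refine ⟨fun h => h1 (Or.inl h), fun h => h1 (Or.inr h), ?_⟩
    rcases qm_eq.1 h2 with rfl | rfl
    · exact Or.inl hs
    · exact Or.inr hs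
  · rintro ⟨h1, h2, h3⟩
    refine ⟨fun h => h.elim h1 h2, ?_⟩
    rcases h3 with h | h
    · exact ⟨v, h, rfl⟩
    · exact ⟨_, h, qm_eq.2 (Or.inr rfl)⟩

theorem con_card [Finite V] {S : Finset V} {y : V} (hy : y ∈ S) (h0 : (0 : V) ∉ S) :
    2 * (con S y).card + (D2 S y).card + 2 = 2 * S.card := by
  set A := S.erase y with hA
  set A' := A.image (· + y) with hA'
  have cA : A.card + 1 = S.card := Finset.card_erase_add_one hy
  have cA' : A'.card = A.card := Finset.card_image_of_injective _ (add_left_injective y)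
  have hy0 : y ≠ 0 := fun h => h0 (h ▸ hy)
  have memA' : ∀ v, v ∈ A' ↔ v + y ∈ A := by
    intro v
    simp only [hA', Finset.mem_image]
    constructor
    · rintro ⟨a, ha, rfl⟩; rwa [adc']
    · intro h; exact ⟨_, h, adc' v y⟩
  have h1 : A ∩ A' = D2 S y := by
    ext v
    rw [Finset.mem_inter, memA', mem_D2]
    simp only [hA, Finset.mem_erase]
    constructor
    · rintro ⟨⟨_, h⟩, _, h'⟩; exact ⟨h, h'⟩
    · rintro ⟨h, h'⟩
      refine ⟨⟨?_, h⟩, ?_, h'⟩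
      · rintro rfl; rw [ads] at h'; exact h0 h'
      · intro e; rw [add_eq_right] at e; subst e; exact h0 h
  have h2 : (A ∪ A').card = 2 * (con S y).card := by
    rw [Finset.card_eq_sum_card_fiberwise (f := qm y) (t := con S y)]
    · rw [Finset.sum_const_nat (m := 2)]
      · ring
      · intro q hq
        obtain ⟨hq0, s, hs, rfl⟩ := mem_con.1 hq
        have hsy : s ≠ y := fun h => hq0 (h ▸ qm_self y)
        have : (A ∪ A').filter (fun a => qm y a = qm y s) = {s, s + y} := by
          ext v
          simp only [Finset.mem_filter, Finset.mem_union, Finset.mem_insert,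
            Finset.mem_singleton, qm_eq, and_iff_right_iff_imp, memA']
          have : s ∈ A := Finset.mem_erase.2 ⟨hsy, hs⟩
          rintro (rfl | rfl)
          · exact Or.inl this
          · rw [adc']; exact Or.inr this
        rw [this, Finset.card_pair]
        intro h; exact hy0 (by simpa using h.symm)
    · intro v hv
      rw [Finset.mem_coe, Finset.mem_union, memA'] at hv
      rw [Finset.mem_coe, qm_mem_con]
      simp only [hA, Finset.mem_erase] at hv
      rcases hv with ⟨h, h'⟩ | ⟨h, h'⟩
      · exact ⟨fun e => h0 (e ▸ h'), h, Or.inl h'⟩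
      · refine ⟨?_, ?_, Or.inr h'⟩
        · rintro rfl; simp at h
        · rintro rfl; rw [ads] at h'; exact h0 h'
  have h3 := Finset.card_union_add_card_inter A A'
  rw [h1, h2, cA'] at h3
  omega

theorem con_span {S : Finset V} {y : V} (h : span (ZMod 2) (S : Set V) = ⊤) :
    span (ZMod 2) (con S y : Set (V ⧸ span (ZMod 2) {y})) = ⊤ := by
  rw [eq_top_iff]
  have : (⊤ : Submodule (ZMod 2) (V ⧸ span (ZMod 2) {y})) = map (qm y) ⊤ := by
    rw [Submodule.map_top, range_mkQ]
  rw [this, ← h, map_span, span_le]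
  rintro _ ⟨s, hs, rfl⟩
  by_cases h0 : qm y s = 0
  · rw [SetLike.mem_coe]; erw [h0]; exact zero_mem _
  · exact subset_span (mem_con.2 ⟨h0, s, hs, rfl⟩)

theorem con_ag {S : Finset V} {y : V} (hy : y ∈ S) (h : AGfree S) : AGfree (con S y) := by
  intro φ hk hh
  refine h (φ ∘ₗ qm y) ?_ ?_
  · intro v hv
    have h1 : qm y v ∈ LinearMap.ker φ := hv
    have h2 := hk h1
    have h3 : span (ZMod 2) {s | s ∈ con S y ∧ φ s = 0} ≤
        map (qm y) (span (ZMod 2) {s | s ∈ S ∧ (φ ∘ₗ qm y) s = 0}) := by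
      rw [span_le]
      rintro q ⟨hq, hq'⟩
      obtain ⟨_, s, hs, rfl⟩ := mem_con.1 hq
      exact mem_map_of_mem (subset_span ⟨hs, hq'⟩)
    obtain ⟨w, hw, hw'⟩ := mem_map.1 (h3 h2)
    have hyy : y ∈ span (ZMod 2) {s | s ∈ S ∧ (φ ∘ₗ qm y) s = 0} :=
      subset_span ⟨hy, by rw [LinearMap.comp_apply, qm_self, map_zero]⟩
    rcases qm_eq.1 hw' with rfl | rfl
    · exact hw
    · have := add_mem hw hyy
      rwa [adc'] at this
  · intro t ht
    obtain ⟨q, hq, rfl⟩ := hh t ht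
    obtain ⟨_, s, hs, rfl⟩ := mem_con.1 hq
    exact ⟨s, hs, rfl⟩

theorem finrank_qm [Finite V] {y : V} (hy : y ≠ 0) :
    finrank (ZMod 2) (V ⧸ span (ZMod 2) {y}) + 1 = finrank (ZMod 2) V := by
  rw [← finrank_quotient_add_finrank (span (ZMod 2) {y}), finrank_span_singleton hy]

theorem Cfg.ne {n : ℕ} {S : Finset V} (h : Cfg n S) {y : V} (hy : y ∈ S) : y ≠ 0 :=
  fun e => h.z (e ▸ hy)

theorem Cfg.con {n : ℕ} {S : Finset V} (h : Cfg (n + 1) S) {y : V} (hy : y ∈ S) :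
    Cfg n (con S y) := by
  have := h.fin
  refine ⟨Finite.of_surjective _ (mkQ_surjective _), ?_, con_span h.sp, by simp [ML.con], con_ag hy h.ag⟩
  have h1 := finrank_qm (h.ne hy)
  have := h.dim
  omega

theorem ag_kill {S : Finset V} (hsp : span (ZMod 2) (S : Set V) = ⊤) (hag : AGfree S)
    (K : Submodule (ZMod 2) V) (hK : K ≤ span (ZMod 2) {s | s ∈ S ∧ s ∈ K}) (w : Fin 4 → V)
    (hw : LinearIndependent (ZMod 2) (K.mkQ ∘ w))
    (hit : ∀ a b c : ZMod 2, ∃ s ∈ S, s + (w 0 + a • w 1 + b • w 2 + c • w 3) ∈ K) : False := by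
  set v' := K.mkQ ∘ w with hv'
  have hinj : Function.Injective v' := hw.injective
  have hs : LinearIndepOn (ZMod 2) id (range v') := hw.linearIndepOn_id
  set t : Set (V ⧸ K) := range v' ∪ K.mkQ '' (S : Set V) with ht
  have hst : range v' ⊆ t := subset_union_left
  have htop : ⊤ ≤ span (ZMod 2) t := by
    have h1 : (⊤ : Submodule (ZMod 2) (V ⧸ K)) = map K.mkQ ⊤ := by rw [Submodule.map_top, range_mkQ]
    rw [h1, ← hsp, map_span]
    exact span_mono subset_union_right
  set b := Basis.extendLe hs hst htop with hb
  have hbi : ∀ i, b i = (i : V ⧸ K) := fun i => by rw [hb, Basis.extendLe_apply_self]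
  have hbt : ∀ i : hs.extend hst, (i : V ⧸ K) ∈ t := fun i => hs.extend_subset hst i.2
  have hmem : ∀ k, v' k ∈ hs.extend hst := fun k => hs.subset_extend hst (mem_range_self k)
  set φ' : (V ⧸ K) →ₗ[ZMod 2] (Fin 4 → ZMod 2) := b.constr (ZMod 2)
    (fun i => fun k => if v' k = (i : V ⧸ K) then 1 else 0) with hφ'
  have hφb : ∀ i : hs.extend hst, ∀ k, φ' (i : V ⧸ K) k = if v' k = (i : V ⧸ K) then 1 else 0 := by
    intro i k
    rw [← hbi i, hφ', b.constr_basis, hbi]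
  have hφv : ∀ j k, φ' (v' j) k = if k = j then 1 else 0 := by
    intro j k
    have := hφb ⟨v' j, hmem j⟩ k
    rw [this]
    simp [hinj.eq_iff]
  have hco : ∀ x k, b.repr x ⟨v' k, hmem k⟩ = φ' x k := by
    intro x k
    have h1 : b.coord ⟨v' k, hmem k⟩ = (LinearMap.proj k) ∘ₗ φ' := by
      refine b.ext fun i => ?_
      rw [Basis.coord_apply, b.repr_self, LinearMap.comp_apply, LinearMap.proj_apply, hbi, hφb,
        Finsupp.single_apply]
      congr 1
      rw [eq_iff_iff, Subtype.ext_iff]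
      exact eq_comm
    have := LinearMap.congr_fun h1 x
    rwa [Basis.coord_apply] at this
  refine hag (φ' ∘ₗ K.mkQ) ?_ ?_
  · set R := span (ZMod 2) {s | s ∈ S ∧ (φ' ∘ₗ K.mkQ) s = 0} with hR
    have hKR : K ≤ R := by
      refine hK.trans (span_mono ?_)
      rintro s ⟨h1, h2⟩
      refine ⟨h1, ?_⟩
      rw [LinearMap.comp_apply, mkQ_apply, (Quotient.mk_eq_zero K).2 h2, map_zero]
    intro v hv
    have hv0 : φ' (K.mkQ v) = 0 := hv
    have h1 : K.mkQ v ∈ map K.mkQ R := by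
      rw [← b.linearCombination_repr (K.mkQ v), Finsupp.linearCombination_apply, Finsupp.sum]
      refine sum_mem fun i _ => ?_
      by_cases hi : ∃ k, v' k = (i : V ⧸ K)
      · obtain ⟨k, hk⟩ := hi
        have h2 : i = ⟨v' k, hmem k⟩ := Subtype.ext hk.symm
        rw [h2, hco, hv0]
        simp
      · refine smul_mem _ _ ?_
        have hz : φ' (i : V ⧸ K) = 0 := by
          ext k
          rw [hφb, if_neg (fun h => hi ⟨k, h⟩)]; rfl
        rcases hbt i with h3 | ⟨s, hs, h3⟩
        · exact absurd h3 (fun ⟨k, hk⟩ => hi ⟨k, hk⟩)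
        · rw [hbi, ← h3]
          refine mem_map_of_mem (subset_span ⟨hs, ?_⟩)
          rw [LinearMap.comp_apply, h3, hz]
    obtain ⟨u, hu, hu'⟩ := mem_map.1 h1
    have h2 : u - v ∈ K := (Submodule.Quotient.eq K).1 hu'
    have : v = u - (u - v) := by abel
    rw [this]
    exact sub_mem hu (hKR h2)
  · intro y hy
    obtain ⟨s, hs, hsK⟩ := hit (y 1) (y 2) (y 3)
    refine ⟨s, hs, ?_⟩
    have h1 : K.mkQ s = v' 0 + y 1 • v' 1 + y 2 • v' 2 + y 3 • v' 3 := by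
      have h2 : K.mkQ (s + (w 0 + y 1 • w 1 + y 2 • w 2 + y 3 • w 3)) = 0 := by
        rw [mkQ_apply, Quotient.mk_eq_zero]; exact hsK
      rw [map_add, add_eq_zero_iff_eq_neg, ZModModule.neg_eq_self] at h2
      rw [h2]
      simp [hv']
    rw [LinearMap.comp_apply, h1]
    ext i
    simp only [map_add, map_smul, Pi.add_apply, Pi.smul_apply, hφv, smul_eq_mul]
    fin_cases i <;> simp [hy]

end basic
end ML

namespace ML

set_option linter.unusedSectionVars false
open Module Submodule
open scoped Classical

section basic2
variable {V : Type} [AddCommGroup V] [Module (ZMod 2) V]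

theorem exists_fun {K : Submodule (ZMod 2) V} {v : V} (hv : v ∉ K) :
    ∃ f : V →ₗ[ZMod 2] ZMod 2, f v = 1 ∧ ∀ k ∈ K, f k = 0 := by
  obtain ⟨f, hf, hf'⟩ := Submodule.exists_dual_map_eq_bot_of_notMem hv inferInstance
  refine ⟨f, z2ne _ hf, fun k hk => ?_⟩
  have : f k ∈ map f K := mem_map_of_mem hk
  rw [hf'] at this
  exact this

theorem exists_fun1 {v : V} (hv : v ≠ 0) : ∃ f : V →ₗ[ZMod 2] ZMod 2, f v = 1 := by
  obtain ⟨f, hf, _⟩ := exists_fun (K := ⊥) (v := v) (by simpa using hv)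
  exact ⟨f, hf⟩

theorem kill_f {S : Finset V} [Finite V] (hsp : span (ZMod 2) (S : Set V) = ⊤) (hag : AGfree S)
    (U : Submodule (ZMod 2) V) (hU : finrank (ZMod 2) U = 4) (f : V →ₗ[ZMod 2] ZMod 2)
    (w0 : V) (hw0 : w0 ∈ U) (hf : f w0 = 1) (h : ∀ u ∈ U, f u = 1 → u ∈ S) : False := by
  set g := f.domRestrict U with hg
  have hr : LinearMap.range g = ⊤ := by
    rw [LinearMap.range_eq_top]
    intro a
    rcases z2 a with rfl | rfl
    · exact ⟨0, map_zero _⟩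
    · exact ⟨⟨w0, hw0⟩, hf⟩
  have hk : finrank (ZMod 2) (LinearMap.ker g) = 3 := by
    have := LinearMap.finrank_range_add_finrank_ker g
    rw [hr, finrank_top, finrank_self, hU] at this
    omega
  set b := finBasisOfFinrankEq (ZMod 2) (LinearMap.ker g) hk
  set w' : Fin 3 → V := fun i => ((b i : U) : V) with hw'
  have hli : LinearIndependent (ZMod 2) w' := by
    have := (b.linearIndependent.map' (LinearMap.ker g).subtype (by simp)).map' U.subtype (by simp)
    exact this
  have hfw : ∀ i, f (w' i) = 0 := fun i => (b i).2
  have hUw : ∀ i, w' i ∈ U := fun i => (b i : U).2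
  have hli4 : LinearIndependent (ZMod 2) (Fin.cons w0 w' : Fin 4 → V) := by
    rw [linearIndependent_finCons]
    refine ⟨hli, fun hm => ?_⟩
    have : span (ZMod 2) (range w') ≤ LinearMap.ker f := by
      rw [span_le]; rintro _ ⟨i, rfl⟩; exact hfw i
    have := this hm
    rw [LinearMap.mem_ker, hf] at this
    exact one_ne_zero this
  refine ag_kill hsp hag ⊥ bot_le (Fin.cons w0 w') ?_ ?_
  · exact hli4.map' _ (by simp)
  · intro a b c
    refine ⟨w0 + a • w' 0 + b • w' 1 + c • w' 2, h _ ?_ ?_, ?_⟩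
    · exact add_mem (add_mem (add_mem hw0 (smul_mem _ _ (hUw 0))) (smul_mem _ _ (hUw 1)))
        (smul_mem _ _ (hUw 2))
    · simp [hf, hfw]
    · have : (Fin.cons w0 w' : Fin 4 → V) 0 + a • (Fin.cons w0 w' : Fin 4 → V) 1 +
        b • (Fin.cons w0 w' : Fin 4 → V) 2 + c • (Fin.cons w0 w' : Fin 4 → V) 3 =
        w0 + a • w' 0 + b • w' 1 + c • w' 2 := rfl
      rw [this, ads]
      exact zero_mem _

theorem kill2 {S : Finset V} [Finite V] (hsp : span (ZMod 2) (S : Set V) = ⊤) (hag : AGfree S)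
    (U : Submodule (ZMod 2) V) (hU : finrank (ZMod 2) U = 4) (C : Finset V) (hC : C.card ≤ 3)
    (h : ∀ u ∈ U, u ≠ 0 → u ∈ S ∨ u ∈ C) : False := by
  have h1 : ¬ U ≤ span (ZMod 2) (C : Set V) := by
    intro hle
    have h2 := Submodule.finrank_mono hle
    have h3 := finrank_span_finset_le_card (R := ZMod 2) C
    rw [hU] at h2
    have : (Set.finrank (ZMod 2) (C : Set V)) = finrank (ZMod 2) (span (ZMod 2) (C : Set V)) := rfl
    omega
  obtain ⟨w0, hw, hw'⟩ := SetLike.not_le_iff_exists.1 h1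
  obtain ⟨f, hf, hf'⟩ := exists_fun hw'
  refine kill_f hsp hag U hU f w0 hw hf fun u hu hfu => ?_
  refine (h u hu ?_).resolve_right fun hc => ?_
  · rintro rfl; simp at hfu
  · rw [hf' u (subset_span hc)] at hfu; exact zero_ne_one hfu

/-- A Fano plane inside `S`. -/
def IsF7 (S : Finset V) (P : Submodule (ZMod 2) V) : Prop :=
  finrank (ZMod 2) P = 3 ∧ ∀ v ∈ P, v ≠ 0 → v ∈ S

theorem two_planes {S : Finset V} [Finite V] (hsp : span (ZMod 2) (S : Set V) = ⊤)
    (hag : AGfree S) {P Q : Submodule (ZMod 2) V} (hP : IsF7 S P) (hQ : IsF7 S Q)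
    (h4 : finrank (ZMod 2) (P ⊔ Q : Submodule (ZMod 2) V) = 4) : False := by
  have hPQ : ¬ P ≤ Q := fun h => by
    rw [sup_eq_right.2 h, hQ.1] at h4; omega
  have hQP : ¬ Q ≤ P := fun h => by
    rw [sup_eq_left.2 h, hP.1] at h4; omega
  obtain ⟨a, ha, ha'⟩ := SetLike.not_le_iff_exists.1 hPQ
  obtain ⟨c, hc, hc'⟩ := SetLike.not_le_iff_exists.1 hQP
  have key : ∀ (P : Submodule (ZMod 2) V) (c : V), c ∉ P → finrank (ZMod 2) P = 3 →
      ∀ W : Submodule (ZMod 2) V, finrank (ZMod 2) W = 4 → P ≤ W → c ∈ W →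
      ∀ u ∈ W, u ∉ P → u + c ∈ P := by
    intro P c hc h3 W hW hPW hcW u hu huP
    have h1 : P ⊔ span (ZMod 2) {c} = W := by
      apply Submodule.eq_of_le_of_finrank_le
      · exact sup_le hPW ((span_singleton_le_iff_mem _ _).2 hcW)
      · rw [hW]
        have : P < P ⊔ span (ZMod 2) {c} := by
          refine lt_of_le_of_ne le_sup_left fun h => hc ?_
          rw [h]; exact mem_sup_right (mem_span_singleton_self c)
        have := Submodule.finrank_lt_finrank_of_lt this
        omega
    rw [← h1, mem_sup_sp] at hu
    exact hu.resolve_left huP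
  have hf : a ∉ (P ⊓ Q) ⊔ span (ZMod 2) {a + c} := by
    rw [mem_sup_sp, adc]
    rintro (h | h)
    · exact ha' h.2
    · exact hc' h.1
  obtain ⟨f, hfa, hf0⟩ := exists_fun hf
  refine kill_f hsp hag (P ⊔ Q) h4 f a (mem_sup_left ha) hfa fun u hu hfu => ?_
  have hu0 : u ≠ 0 := by rintro rfl; simp at hfu
  by_contra huS
  have huP : u ∉ P := fun h => huS (hP.2 u h hu0)
  have huQ : u ∉ Q := fun h => huS (hQ.2 u h hu0)
  have h1 := key P c hc' hP.1 _ h4 le_sup_left (mem_sup_right hc) u hu huP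
  have h2 := key Q a ha' hQ.1 _ h4 le_sup_right (mem_sup_left ha) u hu huQ
  have h3 : u ∈ (P ⊓ Q) ⊔ span (ZMod 2) {a + c} := by
    rw [mem_sup_sp]
    right
    refine ⟨?_, ?_⟩
    · have := add_mem h1 ha
      rwa [add_assoc, add_comm c a] at this
    · have := add_mem h2 hc
      rwa [add_assoc] at this
  rw [hf0 u h3] at hfu
  exact zero_ne_one hfu

theorem dual_of_LI {B : Set V} (hB : LinearIndepOn (ZMod 2) id B) {b : V} (hb : b ∈ B) :
    ∃ f : V →ₗ[ZMod 2] ZMod 2, f b = 1 ∧ ∀ c ∈ B, c ≠ b → f c = 0 := by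
  have h := (linearIndepOn_iff_notMem_span.1 hB) b hb
  simp only [id, image_id'] at h
  obtain ⟨f, hf, hf'⟩ := exists_fun h
  exact ⟨f, hf, fun c hc hcb => hf' c (subset_span ⟨hc, by simpa using hcb⟩)⟩

theorem mem_span_fs {B : Finset V} {x : V} (h : x ∈ span (ZMod 2) (B : Set V)) :
    ∃ T ⊆ B, x = ∑ t ∈ T, t := by
  obtain ⟨f, _, hf⟩ := mem_span_finset.1 h
  refine ⟨B.filter (fun b => f b = 1), Finset.filter_subset _ _, ?_⟩
  rw [← hf, Finset.sum_filter]
  refine Finset.sum_congr rfl fun b _ => ?_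
  rcases z2 (f b) with h | h <;> simp [h]

/-- the doubled elements in a hyperplane avoiding `z` -/
noncomputable def Dh (S : Finset V) (z : V) (h : V →ₗ[ZMod 2] ZMod 2) : Finset V :=
  (D2 S z).filter (fun s => h s = 0)

theorem mem_Dh {S : Finset V} {z : V} {h : V →ₗ[ZMod 2] ZMod 2} {s : V} :
    s ∈ Dh S z h ↔ s ∈ S ∧ s + z ∈ S ∧ h s = 0 := by
  simp [Dh, mem_D2, and_assoc]

theorem card_Dh {S : Finset V} {z : V} {h : V →ₗ[ZMod 2] ZMod 2} (hz : h z = 1) :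
    (D2 S z).card = 2 * (Dh S z h).card := by
  have h1 := Finset.card_filter_add_card_filter_not (s := D2 S z) (fun s => h s = 0)
  have h2 : ((D2 S z).filter (fun s => ¬ h s = 0)).card = (Dh S z h).card := by
    have : (D2 S z).filter (fun s => ¬ h s = 0) = (Dh S z h).image (· + z) := by
      ext v
      simp only [Finset.mem_filter, Finset.mem_image]
      constructor
      · rintro ⟨hv, hv'⟩
        refine ⟨v + z, ?_, adc' v z⟩
        have h3 := D2_add hv
        rw [mem_D2] at h3
        rw [mem_Dh]
        refine ⟨h3.1, h3.2, ?_⟩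
        rw [map_add, z2ne _ hv', hz]; decide
      · rintro ⟨s, hs, rfl⟩
        rw [mem_Dh] at hs
        refine ⟨D2_add (mem_D2.2 ⟨hs.1, hs.2.1⟩), ?_⟩
        rw [map_add, hs.2.2, hz]; decide
    rw [this, Finset.card_image_of_injective _ (add_left_injective z)]
  rw [h2] at h1
  change (Dh S z h).card + _ = _ at h1
  omega

theorem D0 {S : Finset V} (hsp : span (ZMod 2) (S : Set V) = ⊤) (hag : AGfree S) {z : V}
    {h : V →ₗ[ZMod 2] ZMod 2} (hz : h z = 1) {t0 t1 t2 s : V} (ht0 : t0 ∈ Dh S z h)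
    (ht1 : t1 ∈ Dh S z h) (ht2 : t2 ∈ Dh S z h) (hs : s ∈ Dh S z h)
    (K : Submodule (ZMod 2) V) (hK : K ≤ span (ZMod 2) {s | s ∈ S ∧ s ∈ K})
    (hKh : ∀ k ∈ K, h k = 0) (hsK : s + (t0 + t1 + t2) ∈ K)
    (hli : ∀ a b c : ZMod 2, a • t0 + b • t1 + c • t2 ∈ K → a = 0 ∧ b = 0 ∧ c = 0) : False := by
  refine ag_kill hsp hag K hK ![t0, z, t0 + t1, t0 + t2] ?_ ?_
  · rw [Fintype.linearIndependent_iff]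
    intro g hg
    simp only [Fin.sum_univ_four, Function.comp, Matrix.cons_val, ← map_smul, ← map_add] at hg
    rw [mkQ_apply, Quotient.mk_eq_zero] at hg
    have h1 : g 1 = 0 := by
      have := hKh _ hg
      simpa [map_add, map_smul, (mem_Dh.1 ht0).2.2, (mem_Dh.1 ht1).2.2, (mem_Dh.1 ht2).2.2, hz]
        using this
    have h2 : (g 0 + g 2 + g 3) • t0 + g 2 • t1 + g 3 • t2 ∈ K := by
      convert hg using 1
      rw [h1]
      module
    obtain ⟨e0, e2, e3⟩ := hli _ _ _ h2
    rw [e2, e3] at e0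
    intro i
    fin_cases i
    · simpa using e0
    · exact h1
    · exact e2
    · exact e3
  · rw [mem_Dh] at *
    have fin : ∀ t, t ∈ S → t + z ∈ S → ∀ a : ZMod 2, t + a • z ∈ S := by
      intro t h1 h2 a
      rcases z2 a with rfl | rfl <;> simpa
    intro a b c
    simp only [Matrix.cons_val]
    have e2 : ∀ v : V, (2 : ZMod 2) • v = 0 := fun v => by
      have : (2 : ZMod 2) = 0 := rfl
      rw [this, zero_smul]
    rcases z2 b with rfl | rfl <;> rcases z2 c with rfl | rfl
    · refine ⟨t0 + a • z, fin _ ht0.1 ht0.2.1 a, ?_⟩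
      simp [ads]
    · refine ⟨t2 + a • z, fin _ ht2.1 ht2.2.1 a, ?_⟩
      convert zero_mem K
      have : t2 + a • z + (t0 + a • z + (0 : ZMod 2) • (t0 + t1) + (1 : ZMod 2) • (t0 + t2)) =
        (2 : ZMod 2) • (t2 + a • z + t0) := by module
      rw [this, e2]
    · refine ⟨t1 + a • z, fin _ ht1.1 ht1.2.1 a, ?_⟩
      convert zero_mem K
      have : t1 + a • z + (t0 + a • z + (1 : ZMod 2) • (t0 + t1) + (0 : ZMod 2) • (t0 + t2)) =
        (2 : ZMod 2) • (t1 + a • z + t0) := by module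
      rw [this, e2]
    · refine ⟨s + a • z, fin _ hs.1 hs.2.1 a, ?_⟩
      convert hsK using 1
      have : s + a • z + (t0 + a • z + (1 : ZMod 2) • (t0 + t1) + (1 : ZMod 2) • (t0 + t2)) =
        (2 : ZMod 2) • (a • z + t0) + (s + (t0 + t1 + t2)) := by module
      rw [this, e2, zero_add]

end basic2
end ML

namespace ML

set_option linter.unusedSectionVars false
open Module Submodule
open scoped Classical

section basic3
variable {V : Type} [AddCommGroup V] [Module (ZMod 2) V]

theorem f7_of {S : Finset V} {a b c : V}
    (hli : ∀ x y z : ZMod 2, x • a + y • b + z • c = 0 → x = 0 ∧ y = 0 ∧ z = 0)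
    (hS : ∀ x y z : ZMod 2, x • a + y • b + z • c ≠ 0 → x • a + y • b + z • c ∈ S) :
    IsF7 S (span (ZMod 2) {a, b, c}) := by
  have h1 : LinearIndependent (ZMod 2) ![a, b, c] := by
    rw [Fintype.linearIndependent_iff]
    intro g hg
    simp only [Fin.sum_univ_three, Matrix.cons_val] at hg
    obtain ⟨h0, h1, h2⟩ := hli _ _ _ hg
    intro i; fin_cases i <;> assumption
  have h2 : range ![a, b, c] = {a, b, c} := by
    ext x
    simp only [Matrix.range_cons, Matrix.range_empty, Set.mem_union, Set.mem_singleton_iff,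
      Set.mem_insert_iff, Set.union_empty]
  refine ⟨?_, ?_⟩
  · rw [← h2, finrank_span_eq_card h1]; simp
  · intro v hv hv0
    obtain ⟨x, y, z, rfl⟩ := mem_span_triple.1 hv
    exact hS x y z hv0

theorem f7_of' {S : Finset V} (h0 : (0 : V) ∉ S) {a b c : V} (ha : a ∈ S) (hb : b ∈ S) (hc : c ∈ S)
    (hab : a + b ∈ S) (hac : a + c ∈ S) (hbc : b + c ∈ S) (habc : a + b + c ∈ S) :
    IsF7 S (span (ZMod 2) {a, b, c}) := by
  have key : ∀ x y z : ZMod 2, (x = 0 ∧ y = 0 ∧ z = 0) ∨ x • a + y • b + z • c ∈ S := by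
    intro x y z
    rcases z2 x with rfl | rfl <;> rcases z2 y with rfl | rfl <;> rcases z2 z with rfl | rfl <;>
      simp [*]
  refine f7_of ?_ ?_
  · intro x y z h
    rcases key x y z with h1 | h1
    · exact h1
    · rw [h] at h1; exact absurd h1 h0
  · intro x y z h
    rcases key x y z with ⟨rfl, rfl, rfl⟩ | h1
    · simp at h
    · exact h1

/-- Structure of the doubled elements in a contraction. -/
structure DS (S : Finset V) (z : V) (h : V →ₗ[ZMod 2] ZMod 2) (B E : Finset V)
    (T : V → Finset V) : Prop where
  hz : h z = 1
  BE : B ∪ E = Dh S z h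
  dj : Disjoint B E
  li : LinearIndepOn (ZMod 2) id (B : Set V)
  sp : span (ZMod 2) (B : Set V) = span (ZMod 2) (Dh S z h : Set V)
  T1 : ∀ d ∈ E, T d ⊆ B
  T2 : ∀ d ∈ E, (T d).card = 2
  T3 : ∀ d ∈ E, d = ∑ t ∈ T d, t
  T4 : ∀ d ∈ E, ∀ d' ∈ E, d ≠ d' → Disjoint (T d) (T d')

theorem exists_DS {n : ℕ} {S : Finset V} (hc : Cfg n S) {z : V} (hzS : z ∈ S) :
    ∃ h B E T, DS S z h B E T := by
  have := hc.fin
  obtain ⟨h, hz⟩ := exists_fun1 (hc.ne hzS)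
  set D := Dh S z h with hD
  obtain ⟨b, hbD, hbsp, hbli⟩ := exists_linearIndependent (ZMod 2) (D : Set V)
  set B : Finset V := (Set.toFinite b).toFinset with hB
  have hBb : (B : Set V) = b := by simp [hB]
  rw [← hBb] at hbsp hbli hbD
  have hBD : B ⊆ D := by exact_mod_cast hbD
  have hli : LinearIndepOn (ZMod 2) id (B : Set V) := hbli
  have hd : ∀ d ∈ D \ B, ∃ T ⊆ B, T.card = 2 ∧ d = ∑ t ∈ T, t := by
    intro d hd
    rw [Finset.mem_sdiff] at hd
    have h1 : d ∈ span (ZMod 2) (B : Set V) := by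
      rw [hbsp]; exact subset_span hd.1
    obtain ⟨T, hTB, hdT⟩ := mem_span_fs h1
    refine ⟨T, hTB, ?_, hdT⟩
    by_contra h2
    have h3 : 3 ≤ T.card := by
      by_contra h3
      have : T.card = 0 ∨ T.card = 1 := by omega
      rcases this with h4 | h4
      · rw [Finset.card_eq_zero] at h4
        rw [h4, Finset.sum_empty] at hdT
        exact hc.ne (mem_Dh.1 hd.1).1 hdT
      · obtain ⟨t, rfl⟩ := Finset.card_eq_one.1 h4
        rw [Finset.sum_singleton] at hdT
        exact hd.2 (hdT ▸ hTB (Finset.mem_singleton_self t))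
    obtain ⟨U, hUT, hU⟩ := Finset.exists_subset_card_eq h3
    obtain ⟨t0, t1, t2, h01, h02, h12, rfl⟩ := Finset.card_eq_three.1 hU
    have m0 : t0 ∈ T := hUT (by simp)
    have m1 : t1 ∈ T := hUT (by simp)
    have m2 : t2 ∈ T := hUT (by simp)
    set T' := T \ {t0, t1, t2} with hT'
    have hT'D : ∀ t ∈ T', t ∈ D := fun t ht =>
      hBD (hTB (Finset.mem_sdiff.1 ht).1)
    have hsum : d = ∑ t ∈ T', t + (t0 + t1 + t2) := by
      rw [hdT, ← Finset.sum_sdiff hUT]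
      congr 1
      rw [Finset.sum_insert (by simp [h01, h02]), Finset.sum_insert (by simp [h12]),
        Finset.sum_singleton, add_assoc]
    refine D0 hc.sp hc.ag hz (hBD (hTB m0)) (hBD (hTB m1)) (hBD (hTB m2)) hd.1
      (span (ZMod 2) (T' : Set V)) ?_ ?_ ?_ ?_
    · exact span_mono fun t ht => ⟨(mem_Dh.1 (hT'D t ht)).1, subset_span ht⟩
    · have : span (ZMod 2) (T' : Set V) ≤ LinearMap.ker h := by
        rw [span_le]; intro t ht; exact (mem_Dh.1 (hT'D t ht)).2.2
      exact fun k hk => this hk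
    · rw [hsum, adc']
      exact sum_mem fun t ht => subset_span ht
    · intro x y w hx
      have key : ∀ t ∈ T, t ∉ T' → ∃ f : V →ₗ[ZMod 2] ZMod 2, f t = 1 ∧
          (∀ c ∈ T, c ≠ t → f c = 0) ∧ ∀ k ∈ span (ZMod 2) (T' : Set V), f k = 0 := by
        intro t ht htT
        obtain ⟨f, hf, hf'⟩ := dual_of_LI hli (hTB ht)
        refine ⟨f, hf, fun c hc => hf' c (hTB hc), ?_⟩
        have : span (ZMod 2) (T' : Set V) ≤ LinearMap.ker f := by
          rw [span_le]; intro t1 ht1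
          exact hf' t1 (hTB (Finset.mem_sdiff.1 ht1).1) (fun e => htT (e ▸ ht1))
        exact fun k hk => this hk
      obtain ⟨f0, g0, k0, l0⟩ := key t0 m0 (by simp [hT'])
      obtain ⟨f1, g1, k1, l1⟩ := key t1 m1 (by simp [hT'])
      obtain ⟨f2, g2, k2, l2⟩ := key t2 m2 (by simp [hT'])
      have e0 := l0 _ hx
      have e1 := l1 _ hx
      have e2 := l2 _ hx
      simp only [map_add, map_smul, g0, k0 t1 m1 h01.symm, k0 t2 m2 h02.symm] at e0
      simp only [map_add, map_smul, g1, k1 t0 m0 h01, k1 t2 m2 h12.symm] at e1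
      simp only [map_add, map_smul, g2, k2 t1 m1 h12, k2 t0 m0 h02] at e2
      simp at e0 e1 e2
      exact ⟨e0, e1, e2⟩
  choose! T hT using hd
  refine ⟨h, B, D \ B, T, hz, ?_, ?_, hli, hbsp, fun d hd => (hT d hd).1,
    fun d hd => (hT d hd).2.1, fun d hd => (hT d hd).2.2, ?_⟩
  · exact Finset.union_sdiff_of_subset hBD
  · exact Finset.disjoint_sdiff
  · intro d hd d' hd' hne
    by_contra hdj
    obtain ⟨b1, hb1, hb1'⟩ := Finset.not_disjoint_iff.1 hdj
    obtain ⟨hs, hcard, hsum⟩ := hT d hd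
    obtain ⟨hs', hcard', hsum'⟩ := hT d' hd'
    have pair : ∀ U : Finset V, U.card = 2 → b1 ∈ U → ∃ b2, b2 ≠ b1 ∧ U = {b1, b2} := by
      intro U hU hb
      obtain ⟨x, y, hxy, rfl⟩ := Finset.card_eq_two.1 hU
      rcases Finset.mem_insert.1 hb with rfl | h
      · exact ⟨y, hxy.symm, rfl⟩
      · rw [Finset.mem_singleton] at h; subst h
        exact ⟨x, hxy, Finset.pair_comm _ _⟩
    obtain ⟨b2, h21, e⟩ := pair _ hcard hb1
    obtain ⟨b3, h31, e'⟩ := pair _ hcard' hb1'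
    rw [e, Finset.sum_pair h21.symm] at hsum
    rw [e', Finset.sum_pair h31.symm] at hsum'
    have h23 : b2 ≠ b3 := by rintro rfl; exact hne (hsum.trans hsum'.symm)
    have m1 : b1 ∈ B := hs hb1
    have m2 : b2 ∈ B := hs (by rw [e]; simp)
    have m3 : b3 ∈ B := hs' (by rw [e']; simp)
    refine D0 hc.sp hc.ag hz (Finset.mem_sdiff.1 hd).1 (hBD m2) (hBD m3)
      (Finset.mem_sdiff.1 hd').1 ⊥ bot_le (by simp) ?_ ?_
    · rw [hsum, hsum', mem_bot]
      have : b1 + b3 + (b1 + b2 + b2 + b3) = (b1 + b1) + (b2 + b2) + (b3 + b3) := by abel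
      rw [this]; simp [ads]
    · intro x y w hx
      rw [mem_bot, hsum] at hx
      obtain ⟨f1, g1, k1⟩ := dual_of_LI hli m1
      obtain ⟨f2, g2, k2⟩ := dual_of_LI hli m2
      obtain ⟨f3, g3, k3⟩ := dual_of_LI hli m3
      have e1 := congrArg f1 hx
      have e2 := congrArg f2 hx
      have e3 := congrArg f3 hx
      simp only [map_add, map_smul, g1, k1 _ m2 h21, k1 _ m3 h31] at e1
      simp only [map_add, map_smul, g2, k2 _ m1 h21.symm, k2 _ m3 h23.symm] at e2
      simp only [map_add, map_smul, g3, k3 _ m1 h31.symm, k3 _ m2 h23] at e3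
      simp at e1 e2 e3
      subst e1
      simp at e2
      exact ⟨rfl, e2, e3⟩

/-- span of all lines through `z` -/
noncomputable def Vz (S : Finset V) (z : V) : Submodule (ZMod 2) V :=
  span (ZMod 2) (insert z (D2 S z : Set V))

variable {S : Finset V} {z : V} {h : V →ₗ[ZMod 2] ZMod 2} {B E : Finset V} {T : V → Finset V}

theorem DS.cardD (d : DS S z h B E T) : (D2 S z).card = 2 * (B.card + E.card) := by
  rw [card_Dh d.hz, ← d.BE, Finset.card_union_of_disjoint d.dj]

theorem DS.cardE (d : DS S z h B E T) : 2 * E.card ≤ B.card := by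
  have h1 : (E.biUnion T).card = ∑ e ∈ E, (T e).card := Finset.card_biUnion d.T4
  rw [Finset.sum_congr rfl d.T2, Finset.sum_const, smul_eq_mul] at h1
  have h2 : E.biUnion T ⊆ B := Finset.biUnion_subset.2 d.T1
  have := Finset.card_le_card h2
  omega

theorem DS.memB (d : DS S z h B E T) {b : V} (hb : b ∈ B) : b ∈ S ∧ b + z ∈ S ∧ h b = 0 := by
  rw [← mem_Dh, ← d.BE]; exact Finset.mem_union_left _ hb

theorem DS.memE (d : DS S z h B E T) {b : V} (hb : b ∈ E) : b ∈ S ∧ b + z ∈ S ∧ h b = 0 := by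
  rw [← mem_Dh, ← d.BE]; exact Finset.mem_union_right _ hb

theorem DS.Vz (d : DS S z h B E T) : Vz S z = span (ZMod 2) (B : Set V) ⊔ span (ZMod 2) {z} := by
  apply le_antisymm
  · rw [ML.Vz, span_le]
    rintro v (rfl | hv)
    · exact mem_sup_right (mem_span_singleton_self _)
    · rw [SetLike.mem_coe, mem_sup_sp, d.sp]
      have hv' := D2_add (Finset.mem_coe.1 hv)
      rw [Finset.mem_coe, mem_D2] at hv
      rcases z2 (h v) with h0 | h1
      · left; exact subset_span (mem_Dh.2 ⟨hv.1, hv.2, h0⟩)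
      · right
        refine subset_span (mem_Dh.2 ⟨hv.2, by rw [adc']; exact hv.1, ?_⟩)
        rw [map_add, h1, d.hz]; decide
  · refine sup_le (span_le.2 ?_) (span_mono (by simp))
    intro b hb
    have := d.memB hb
    exact subset_span (Or.inr (mem_D2.2 ⟨this.1, this.2.1⟩))

theorem DS.zB (d : DS S z h B E T) : z ∉ span (ZMod 2) (B : Set V) := by
  intro hm
  have : span (ZMod 2) (B : Set V) ≤ LinearMap.ker h := by
    rw [span_le]; intro b hb; exact (d.memB hb).2.2
  have := this hm
  rw [LinearMap.mem_ker, d.hz] at this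
  exact one_ne_zero this

theorem finrank_sup_sp [Finite V] {K : Submodule (ZMod 2) V} {z : V} (h : z ∉ K) :
    finrank (ZMod 2) (K ⊔ span (ZMod 2) {z} : Submodule (ZMod 2) V) = finrank (ZMod 2) K + 1 := by
  have h1 := Submodule.finrank_sup_add_finrank_inf_eq K (span (ZMod 2) {z})
  have h2 : K ⊓ span (ZMod 2) {z} = ⊥ := by
    rw [eq_bot_iff]
    rintro x ⟨hx, hx'⟩
    rcases mem_sp.1 hx' with rfl | rfl
    · exact zero_mem _
    · exact absurd hx h
  have h3 : z ≠ 0 := by rintro rfl; exact h (zero_mem _)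
  rw [h2, finrank_bot, finrank_span_singleton h3] at h1
  omega

theorem DS.rkV [Finite V] (d : DS S z h B E T) :
    finrank (ZMod 2) (ML.Vz S z) = B.card + 1 := by
  rw [d.Vz, finrank_sup_sp d.zB]
  congr 1
  have := finrank_span_set_eq_card (R := ZMod 2) (s := (B : Set V)) d.li
  simpa using this

theorem pairT (d : DS S z h B E T) {e : V} (he : e ∈ E) :
    ∃ b ∈ B, ∃ b' ∈ B, b ≠ b' ∧ T e = {b, b'} ∧ e = b + b' := by
  obtain ⟨b, b', hne, hT⟩ := Finset.card_eq_two.1 (d.T2 e he)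
  have hs := d.T3 e he
  have hsub := d.T1 e he
  rw [hT] at hs hsub
  rw [Finset.sum_pair hne] at hs
  exact ⟨b, hsub (by simp), b', hsub (by simp), hne, hT, hs⟩

theorem DS.f7 (d : DS S z h B E T) (h0 : (0 : V) ∉ S) (hz : z ∈ S) {b b' : V} (hb : b ∈ B)
    (hb' : b' ∈ B) (he : b + b' ∈ E) : IsF7 S (span (ZMod 2) {z, b, b'}) := by
  have h1 := d.memB hb
  have h2 := d.memB hb'
  have h3 := d.memE he
  refine f7_of' h0 hz h1.1 h2.1 ?_ ?_ h3.1 ?_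
  · rw [add_comm]; exact h1.2.1
  · rw [add_comm]; exact h2.2.1
  · rw [add_assoc, add_comm]; exact h3.2.1

end basic3
end ML

namespace ML

set_option linter.unusedSectionVars false
open Module Submodule

section sound

def Cons (P : ℕ → Prop) (s : ℕ × ℕ) : Prop :=
  (∀ x, s.1.testBit x = true → P x) ∧ (∀ x, s.2.testBit x = true → ¬ P x)

theorem Cons.in_ {P : ℕ → Prop} {I O v : ℕ} (h : Cons P (I, O)) (hv : P v) :
    Cons P (I ||| 2 ^ v, O) := by
  refine ⟨fun x hx => ?_, h.2⟩
  rw [Nat.testBit_or, Bool.or_eq_true, Nat.testBit_two_pow] at hx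
  rcases hx with hx | hx
  · exact h.1 x hx
  · simp at hx; subst hx; exact hv

theorem Cons.out_ {P : ℕ → Prop} {I O v : ℕ} (h : Cons P (I, O)) (hv : ¬ P v) :
    Cons P (I, O ||| 2 ^ v) := by
  refine ⟨h.1, fun x hx => ?_⟩
  rw [Nat.testBit_or, Bool.or_eq_true, Nat.testBit_two_pow] at hx
  rcases hx with hx | hx
  · exact h.2 x hx
  · simp at hx; subst hx; exact hv

theorem chk_sound {G : Prop} {P : ℕ → Prop} {leaf : ℕ → ℕ → ℕ → Bool}
    (hleaf : ∀ t I O, leaf t I O = true → Cons P (I, O) → G) :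
    ∀ (ts : List ℕ) (st : List (ℕ × ℕ)), chk leaf ts st = true → ∀ s ∈ st, Cons P s → G := by
  intro ts
  induction ts with
  | nil =>
    intro st h s hs
    cases st with
    | nil => simp at hs
    | cons a st => simp [chk] at h
  | cons t ts ih =>
    intro st h s hs hc
    cases st with
    | nil => simp at hs
    | cons a st =>
      obtain ⟨I, O⟩ := a
      rw [chk] at h
      cases h1 : Nat.beq (t % 8) 0 with
      | true =>
        rw [h1, cond_true] at h
        have := ih _ h
        rcases List.mem_cons.1 hs with rfl | hs
        · by_cases hv : P (t / 8)
          · exact this _ (by simp) (hc.in_ hv)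
          · exact this _ (by simp) (hc.out_ hv)
        · exact this s (by simp [hs]) hc
      | false =>
        rw [h1, cond_false] at h
        cases h2 : leaf t I O with
        | false => rw [h2] at h; simp at h
        | true =>
          rw [h2, cond_true] at h
          rcases List.mem_cons.1 hs with rfl | hs
          · exact hleaf t I O h2 hc
          · exact ih _ h s hs hc

theorem nz_bit {m : ℕ} (h : m ≠ 0) : ∃ x, m.testBit x = true := by
  by_contra hn
  push Not at hn
  exact h (Nat.eq_of_testBit_eq (fun i => by simp [hn i]))

theorem log2_bit {m : ℕ} (h : m ≠ 0) : m.testBit (Nat.log2 m) = true := by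
  exact Nat.testBit_log2 h

theorem hit_sound : ∀ (Fs : List ℕ) (m : ℕ), hitAll m Fs = true → ∀ c : List Bool,
    c.length = Fs.length → ∃ x, m.testBit x = true ∧ Fs.map (fun F => F.testBit x) = c := by
  intro Fs
  induction Fs with
  | nil =>
    intro m h c hc
    simp [hitAll] at h
    obtain ⟨x, hx⟩ := nz_bit (m := m) (by rintro rfl; simp at h)
    simp at hc
    exact ⟨x, hx, by simp [hc]⟩
  | cons F Fs ih =>
    intro m h c hc
    cases c with
    | nil => simp at hc
    | cons b c =>
      simp at hc
      simp only [hitAll, Bool.and_eq_true] at h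
      cases b with
      | true =>
        obtain ⟨x, hx, hx'⟩ := ih _ h.1 c hc
        simp at hx
        exact ⟨x, hx.1, by simp [hx.2]; simpa using hx'⟩
      | false =>
        obtain ⟨x, hx, hx'⟩ := ih _ h.2 c hc
        have hx2 : m.testBit x = true ∧ F.testBit x = false := by
          revert hx; simp only [Nat.testBit_xor, Nat.testBit_and]
          cases m.testBit x <;> cases F.testBit x <;> simp
        exact ⟨x, hx2.1, by simp [hx2.2]; simpa using hx'⟩

theorem off_sound : ∀ (Fs : List ℕ) (m x : ℕ), (offAll m Fs).testBit x = true →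
    m.testBit x = true ∧ ∀ F ∈ Fs, F.testBit x = false := by
  intro Fs
  induction Fs with
  | nil => intro m x h; exact ⟨h, by simp⟩
  | cons F Fs ih =>
    intro m x h
    obtain ⟨h1, h2⟩ := ih _ _ h
    have hx2 : m.testBit x = true ∧ F.testBit x = false := by
      revert h1; simp only [Nat.testBit_xor, Nat.testBit_and]
      cases m.testBit x <;> cases F.testBit x <;> simp
    refine ⟨hx2.1, ?_⟩
    intro G hG
    rcases List.mem_cons.1 hG with rfl | hG
    · exact hx2.2
    · exact h2 G hG

theorem few_sound : ∀ (k m : ℕ), fewPts m k = true →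
    ∀ A : Finset ℕ, (∀ x ∈ A, m.testBit x = true) → A.card ≤ k := by
  intro k
  induction k with
  | zero =>
    intro m h A hA
    have h0 : m = 0 := by simpa [fewPts] using h
    subst h0
    rw [Nat.le_zero, Finset.card_eq_zero, Finset.eq_empty_iff_forall_notMem]
    intro x hx
    have := hA x hx
    simp at this
  | succ k ih =>
    intro m h A hA
    rw [fewPts] at h
    by_cases h0 : m = 0
    · subst h0
      have : A = ∅ := by
        rw [Finset.eq_empty_iff_forall_notMem]
        intro x hx
        have := hA x hx
        simp at this
      simp [this]
    · have hb : Nat.beq m 0 = false := by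
        cases hq : Nat.beq m 0 with
        | false => rfl
        | true => exact absurd (Nat.eq_of_beq_eq_true hq) h0
      rw [hb, cond_false] at h
      have := ih _ h (A.erase (Nat.log2 m)) (by
        intro x hx
        rw [Finset.mem_erase] at hx
        rw [Nat.testBit_xor, Nat.testBit_two_pow, hA x hx.2]
        simp [Ne.symm hx.1])
      have h2 := Finset.pred_card_le_card_erase (s := A) (a := Nat.log2 m)
      omega

def swOK (w m x : ℕ) : Bool :=
  if m.testBit x then w + x == x ^^^ w && (x < w || !m.testBit (x - w))
  else decide (w ≤ x) && (m.testBit (x - w) && x - w == x ^^^ w)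

theorem swOK_of {w m x : ℕ} (h : swOK w m x = true) :
    ((m.testBit x = true ∧ w + x = x ^^^ w ∧ (w ≤ x → m.testBit (x - w) = false)) ∨
       (m.testBit x = false ∧ w ≤ x ∧ m.testBit (x - w) = true ∧ x - w = x ^^^ w)) := by
  rw [swOK] at h
  split_ifs at h with h1
  · simp at h
    left; refine ⟨h1, h.1, fun hw => ?_⟩
    rcases h.2 with h2 | h2
    · omega
    · exact h2
  · simp at h
    right; exact ⟨by simpa using h1, h⟩

set_option maxRecDepth 100000 in
theorem swp_sound (O x : ℕ) (hx : x < 64) :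
    (swp O 1 6148914691236517205).testBit x = O.testBit (x ^^^ 1) ∧
    (swp O 2 3689348814741910323).testBit x = O.testBit (x ^^^ 2) ∧
    (swp O 4 1085102592571150095).testBit x = O.testBit (x ^^^ 4) ∧
    (swp O 8 71777214294589695).testBit x = O.testBit (x ^^^ 8) ∧
    (swp O 16 281470681808895).testBit x = O.testBit (x ^^^ 16) ∧
    (swp O 32 4294967295).testBit x = O.testBit (x ^^^ 32) := by
  have gen : ∀ (w m : ℕ),
      ((m.testBit x = true ∧ w + x = x ^^^ w ∧ (w ≤ x → m.testBit (x - w) = false)) ∨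
       (m.testBit x = false ∧ w ≤ x ∧ m.testBit (x - w) = true ∧ x - w = x ^^^ w)) →
      (swp O w m).testBit x = O.testBit (x ^^^ w) := by
    intro w m h
    rw [swp, Nat.testBit_or, Nat.testBit_and, Nat.testBit_shiftRight, Nat.testBit_shiftLeft,
      Nat.testBit_and]
    rcases h with ⟨a, b, c⟩ | ⟨a, b, c, d⟩
    · rw [a, b]
      by_cases hw : w ≤ x
      · simp [c hw]
      · simp [hw]
    · rw [a, c, d]; simp [b]
  refine ⟨gen _ _ ?_, gen _ _ ?_, gen _ _ ?_, gen _ _ ?_, gen _ _ ?_, gen _ _ ?_⟩ <;> clear gen <;> revert x <;>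
    clear O <;> refine fun x hx => swOK_of ?_ <;> revert x <;> decide +kernel

theorem trl_sound (O z x : ℕ) (hz : z < 64) (hx : x < 64) :
    (trl O z).testBit x = O.testBit (x ^^^ z) := by
  have step : ∀ (A B C : ℕ) (q w : ℕ), w < 64 → Nat.beq q 1 = true ∨ q = 0 →
      (∀ x < 64, B.testBit x = A.testBit (x ^^^ w)) →
      ∀ x < 64, (bif Nat.beq q 1 then B else A).testBit x = A.testBit (x ^^^ (q * w)) := by
    intro A B C q w _ hq h x hx
    rcases hq with hq | rfl
    · rw [hq, cond_true, h x hx, Nat.eq_of_beq_eq_true hq, one_mul]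
    · rw [zero_mul, Nat.xor_zero]; rfl
  have m2 : ∀ k, Nat.beq (k % 2) 1 = true ∨ k % 2 = 0 := by
    intro k
    rcases Nat.mod_two_eq_zero_or_one k with h | h
    · exact Or.inr h
    · left; rw [h]; rfl
  have x64 : ∀ {x y : ℕ}, x < 64 → y < 64 → x ^^^ y < 64 := fun {x y} h1 h2 =>
    Nat.xor_lt_two_pow (n := 6) h1 h2
  have hz' : z % 2 * 1 ^^^ (z / 2 % 2 * 2 ^^^ (z / 4 % 2 * 4 ^^^ (z / 8 % 2 * 8 ^^^ (z / 16 % 2 * 16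
      ^^^ z / 32 % 2 * 32)))) = z := by
    have : ∀ z < 64, z % 2 * 1 ^^^ (z / 2 % 2 * 2 ^^^ (z / 4 % 2 * 4 ^^^ (z / 8 % 2 * 8 ^^^ (z / 16 % 2 * 16
      ^^^ z / 32 % 2 * 32)))) = z := by decide +kernel
    exact this z hz
  have s1 := step O _ 0 (z % 2) 1 (by norm_num) (m2 _) (fun x hx => (swp_sound O x hx).1)
  set a := bif Nat.beq (z % 2) 1 then swp O 1 6148914691236517205 else O with ha
  have s2 := step a _ 0 (z / 2 % 2) 2 (by norm_num) (m2 _) (fun x hx => (swp_sound a x hx).2.1)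
  set b := bif Nat.beq (z / 2 % 2) 1 then swp a 2 3689348814741910323 else a with hb
  have s3 := step b _ 0 (z / 4 % 2) 4 (by norm_num) (m2 _) (fun x hx => (swp_sound b x hx).2.2.1)
  set c := bif Nat.beq (z / 4 % 2) 1 then swp b 4 1085102592571150095 else b with hc
  have s4 := step c _ 0 (z / 8 % 2) 8 (by norm_num) (m2 _) (fun x hx => (swp_sound c x hx).2.2.2.1)
  set d := bif Nat.beq (z / 8 % 2) 1 then swp c 8 71777214294589695 else c with hd
  have s5 := step d _ 0 (z / 16 % 2) 16 (by norm_num) (m2 _)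
    (fun x hx => (swp_sound d x hx).2.2.2.2.1)
  set e := bif Nat.beq (z / 16 % 2) 1 then swp d 16 281470681808895 else d with he
  have s6 := step e _ 0 (z / 32 % 2) 32 (by norm_num) (m2 _)
    (fun x hx => (swp_sound e x hx).2.2.2.2.2)
  have ht : trl O z = bif Nat.beq (z / 32 % 2) 1 then swp e 32 4294967295 else e := rfl
  have b1 : z % 2 * 1 < 64 := by omega
  have b2 : z / 2 % 2 * 2 < 64 := by omega
  have b3 : z / 4 % 2 * 4 < 64 := by omega
  have b4 : z / 8 % 2 * 8 < 64 := by omega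
  have b5 : z / 16 % 2 * 16 < 64 := by omega
  have b6 : z / 32 % 2 * 32 < 64 := by omega
  rw [ht, s6 x hx, s5 _ (x64 hx b6), s4 _ (x64 (x64 hx b6) b5), s3 _ (x64 (x64 (x64 hx b6) b5) b4),
    s2 _ (x64 (x64 (x64 (x64 hx b6) b5) b4) b3), s1 _ (x64 (x64 (x64 (x64 (x64 hx b6) b5) b4) b3) b2)]
  congr 1
  conv_rhs => rw [← hz']
  simp only [Nat.xor_assoc]
  congr 1
  ac_rfl

end sound
end ML

namespace ML

set_option linter.unusedSectionVars false
open Module Submodule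

section gr
variable {V : Type} [AddCommGroup V] [Module (ZMod 2) V]

/-- `S` is (represented by) the edge set of a graph. -/
def Graphic (S : Finset V) : Prop :=
  ∃ (ι : Type) (_ : Fintype ι) (g : ι → V →ₗ[ZMod 2] ZMod 2),
    Fintype.card ι = finrank (ZMod 2) V + 1 ∧ (∀ v, (∀ i, g i v = 0) → v = 0) ∧
    ∀ s ∈ S, (Finset.univ.filter (fun i => g i s = 1)).card = 2

variable {n : ℕ} (b : Basis (Fin n) (ZMod 2) V)

noncomputable def pt (x : ℕ) : V := ∑ i : Fin n, if x.testBit i then b i else 0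
noncomputable def fn (f : ℕ) : V →ₗ[ZMod 2] ZMod 2 := ∑ i : Fin n, if f.testBit i then b.coord i else 0

theorem coord_pt (x : ℕ) (j : Fin n) : b.coord j (pt b x) = if x.testBit j then 1 else 0 := by
  rw [pt, map_sum, Finset.sum_eq_single j]
  · split_ifs <;> simp
  · intro i _ hij
    split_ifs <;> simp [hij]
  · simp

theorem pt_xor (x y : ℕ) : pt b (x ^^^ y) = pt b x + pt b y := by
  rw [pt, pt, pt, ← Finset.sum_add_distrib]
  refine Finset.sum_congr rfl fun i _ => ?_
  rw [Nat.testBit_xor]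
  cases x.testBit i <;> cases y.testBit i <;> simp [ads]

theorem pt_surj (v : V) : ∃ x < 2 ^ n, pt b x = v := by
  refine ⟨Nat.ofBits (fun i : Fin n => decide (b.coord i v = 1)), Nat.ofBits_lt_two_pow _, ?_⟩
  apply b.ext_elem
  intro i
  have := coord_pt b (Nat.ofBits (fun i : Fin n => decide (b.coord i v = 1))) i
  rw [Nat.testBit_ofBits_lt _ _ i.2] at this
  rw [← Basis.coord_apply, this]
  rcases z2 (b.coord i v) with h | h
  · simp only [h]; simpa using h.symm
  · simp only [h]; simpa using h.symm

theorem pt_inj {x y : ℕ} (hx : x < 2 ^ n) (hy : y < 2 ^ n) (h : pt b x = pt b y) : x = y := by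
  apply Nat.eq_of_testBit_eq
  intro i
  by_cases hi : i < n
  · have h1 := coord_pt b x ⟨i, hi⟩
    have h2 := coord_pt b y ⟨i, hi⟩
    rw [h, h2] at h1
    simp only at h1
    revert h1
    cases x.testBit i <;> cases y.testBit i <;> simp
  · push Not at hi
    rw [Nat.testBit_lt_two_pow (lt_of_lt_of_le hx (Nat.pow_le_pow_right (by norm_num) hi)),
      Nat.testBit_lt_two_pow (lt_of_lt_of_le hy (Nat.pow_le_pow_right (by norm_num) hi))]

def fmOK (f x : ℕ) : Bool :=
  (fmk f).testBit x == ((f.testBit 0 && x.testBit 0) ^^ ((f.testBit 1 && x.testBit 1) ^^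
    ((f.testBit 2 && x.testBit 2) ^^ ((f.testBit 3 && x.testBit 3) ^^ ((f.testBit 4 && x.testBit 4) ^^
    (f.testBit 5 && x.testBit 5))))))

theorem fmOK_all : ∀ f < 64, ∀ x < 64, fmOK f x = true := by decide +kernel

theorem fn_pt (hn : n = 5 ∨ n = 6) {f x : ℕ} (hf : f < 2 ^ n) (hx : x < 2 ^ n) :
    fn b f (pt b x) = 1 ↔ (fmk f).testBit x = true := by
  have h64 : 2 ^ n ≤ 64 := by rcases hn with rfl | rfl <;> norm_num
  have h1 := fmOK_all f (by omega) x (by omega)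
  simp only [fmOK, beq_iff_eq] at h1
  have h2 : fn b f (pt b x) = ∑ i : Fin n, cond (f.testBit i && x.testBit i) (1 : ZMod 2) 0 := by
    rw [fn, LinearMap.sum_apply]
    refine Finset.sum_congr rfl fun i _ => ?_
    cases h : f.testBit i with
    | true => simpa [Bool.cond_eq_ite] using coord_pt b x i
    | false => simp
  rw [h2, h1]
  rcases hn with rfl | rfl
  · have h5 : f.testBit 5 = false := Nat.testBit_lt_two_pow hf
    rw [Fin.sum_univ_five, h5]
    simp only [Fin.val_zero, Fin.val_one, Fin.val_two, Bool.false_and]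
    have e3 : ((3 : Fin 5) : ℕ) = 3 := rfl
    have e4 : ((4 : Fin 5) : ℕ) = 4 := rfl
    rw [e3, e4]
    generalize (f.testBit 0 && x.testBit 0) = a0
    generalize (f.testBit 1 && x.testBit 1) = a1
    generalize (f.testBit 2 && x.testBit 2) = a2
    generalize (f.testBit 3 && x.testBit 3) = a3
    generalize (f.testBit 4 && x.testBit 4) = a4
    clear h2 h1 h5
    revert a0 a1 a2 a3 a4
    decide
  · rw [Fin.sum_univ_six]
    simp only [Fin.val_zero, Fin.val_one, Fin.val_two]
    have e3 : ((3 : Fin 6) : ℕ) = 3 := rfl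
    have e4 : ((4 : Fin 6) : ℕ) = 4 := rfl
    have e5 : ((5 : Fin 6) : ℕ) = 5 := rfl
    rw [e3, e4, e5]
    generalize (f.testBit 0 && x.testBit 0) = a0
    generalize (f.testBit 1 && x.testBit 1) = a1
    generalize (f.testBit 2 && x.testBit 2) = a2
    generalize (f.testBit 3 && x.testBit 3) = a3
    generalize (f.testBit 4 && x.testBit 4) = a4
    generalize (f.testBit 5 && x.testBit 5) = a5
    clear h2 h1
    revert a0 a1 a2 a3 a4 a5
    decide

theorem ag_leaf {S : Finset V} (hc : Cfg n S) (hn : n = 5 ∨ n = 6) {I O p : ℕ}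
    (hP : Cons (fun x => pt b x ∈ S) (I, O)) (h : agLeaf n I p = true) : False := by
  have := hc.fin
  have := Fintype.ofFinite V
  have hpos : 0 < 2 ^ n := by positivity
  rw [agLeaf] at h
  set J := I % 2 ^ 2 ^ n with hJ
  have hJS : ∀ x, J.testBit x = true → x < 2 ^ n ∧ pt b x ∈ S := by
    intro x hx
    rw [hJ, Nat.testBit_mod_two_pow] at hx
    simp only [Bool.and_eq_true, decide_eq_true_eq] at hx
    exact ⟨hx.1, hP.1 x hx.2⟩
  set f0 := p % 2 ^ n with hf0
  set f1 := p / 64 % 2 ^ n with hf1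
  set f2 := p / 4096 % 2 ^ n with hf2
  set f3 := p / 262144 % 2 ^ n with hf3
  have l0 : f0 < 2 ^ n := Nat.mod_lt _ hpos
  have l1 : f1 < 2 ^ n := Nat.mod_lt _ hpos
  have l2 : f2 < 2 ^ n := Nat.mod_lt _ hpos
  have l3 : f3 < 2 ^ n := Nat.mod_lt _ hpos
  simp only [Bool.and_eq_true, Bool.or_eq_true, Bool.not_eq_true'] at h
  obtain ⟨hh, hK, hK2⟩ := h
  set K := offAll J [fmk f0, fmk f1, fmk f2, fmk f3] with hKd
  have hK0 : K ≠ 0 := by intro e; rw [e] at hK; simp at hK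
  set φ : V →ₗ[ZMod 2] (Fin 4 → ZMod 2) := LinearMap.pi ![fn b f0, fn b f1, fn b f2, fn b f3] with hφ
  have p0 : ∀ v, φ v 0 = fn b f0 v := fun v => rfl
  have p1 : ∀ v, φ v 1 = fn b f1 v := fun v => rfl
  have p2 : ∀ v, φ v 2 = fn b f2 v := fun v => rfl
  have p3 : ∀ v, φ v 3 = fn b f3 v := fun v => rfl
  have bitv : ∀ {f x : ℕ} {c : ZMod 2}, f < 2 ^ n → x < 2 ^ n →
      (fmk f).testBit x = decide (c = 1) → fn b f (pt b x) = c := by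
    intro f x c hf hx h
    have h1 := fn_pt b hn hf hx
    rw [h] at h1
    rcases z2 c with rfl | rfl
    · rcases z2 (fn b f (pt b x)) with h2 | h2
      · exact h2
      · rw [h2] at h1; simp at h1
    · simpa using h1
  have hits : ∀ y : Fin 4 → ZMod 2, y 0 = 1 → ∃ s ∈ S, φ s = y := by
    intro y hy
    obtain ⟨x, hx, hx'⟩ := hit_sound _ _ hh [decide (y 1 = 1), decide (y 2 = 1), decide (y 3 = 1)] rfl
    rw [Nat.testBit_and, Bool.and_eq_true] at hx
    obtain ⟨hxn, hxS⟩ := hJS x hx.1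
    simp only [List.map_cons, List.map_nil, List.cons.injEq, and_true] at hx'
    refine ⟨_, hxS, ?_⟩
    funext i
    fin_cases i
    · exact bitv l0 hxn (by rw [hx.2]; simp [hy])
    · exact bitv l1 hxn hx'.1
    · exact bitv l2 hxn hx'.2.1
    · exact bitv l3 hxn hx'.2.2
  refine hc.ag φ ?_ hits
  have hsurj : LinearMap.range φ = ⊤ := by
    rw [eq_top_iff]
    intro y _
    have key : ∀ y : Fin 4 → ZMod 2, y 0 = 1 → y ∈ LinearMap.range φ := by
      intro y hy
      obtain ⟨s, _, hs⟩ := hits y hy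
      exact ⟨s, hs⟩
    rcases z2 (y 0) with h0 | h0
    · have e : y = (y + Pi.single 0 1) + Pi.single 0 1 := (adc' _ _).symm
      rw [e]
      exact add_mem (key _ (by simp [h0])) (key _ (by simp))
    · exact key y h0
  have hker : finrank (ZMod 2) (LinearMap.ker φ) + 4 = n := by
    have h1 := LinearMap.finrank_range_add_finrank_ker φ
    rw [hsurj, finrank_top, hc.dim] at h1
    simp at h1
    omega
  have hKS : ∀ x, K.testBit x = true → x < 2 ^ n ∧ pt b x ∈ S ∧ φ (pt b x) = 0 := by
    intro x hx
    obtain ⟨h1, h2⟩ := off_sound _ _ _ hx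
    obtain ⟨h3, h4⟩ := hJS x h1
    simp only [List.mem_cons, List.not_mem_nil, or_false, forall_eq_or_imp, forall_eq] at h2
    refine ⟨h3, h4, ?_⟩
    funext i
    fin_cases i
    · exact bitv l0 h3 (by rw [h2.1]; rfl)
    · exact bitv l1 h3 (by rw [h2.2.1]; rfl)
    · exact bitv l2 h3 (by rw [h2.2.2.1]; rfl)
    · exact bitv l3 h3 (by rw [h2.2.2.2]; rfl)
  have hle : span (ZMod 2) {s | s ∈ S ∧ φ s = 0} ≤ LinearMap.ker φ := by
    rw [span_le]; intro s hs; exact hs.2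
  refine (eq_of_le_of_finrank_le hle ?_).ge
  obtain ⟨k1, k2, k3⟩ := hKS _ (log2_bit hK0)
  rcases hn with rfl | rfl
  · have : finrank (ZMod 2) (span (ZMod 2) {pt b K.log2}) = 1 := finrank_span_singleton (hc.ne k2)
    have h2 := finrank_mono (s := span (ZMod 2) {pt b K.log2}) (t := span (ZMod 2) {s | s ∈ S ∧ φ s = 0})
      (span_mono (by intro s hs; rw [mem_singleton_iff] at hs; subst hs; exact ⟨k2, k3⟩))
    omega
  · have hK3 : K ^^^ 2 ^ K.log2 ≠ 0 := by
      rcases hK2 with h | h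
      · simp at h
      · intro e; rw [e] at h; simp at h
    obtain ⟨x, hx⟩ := nz_bit hK3
    rw [Nat.testBit_xor, Nat.testBit_two_pow] at hx
    have hxne : x ≠ K.log2 := by
      rintro rfl
      rw [log2_bit hK0] at hx
      simp at hx
    have hxK : K.testBit x = true := by
      simpa [hxne.symm] using hx
    obtain ⟨m1, m2, m3⟩ := hKS x hxK
    have hnot : pt b x ∉ span (ZMod 2) {pt b K.log2} := by
      rw [mem_sp]
      rintro (h | h)
      · exact hc.ne m2 h
      · exact hxne (pt_inj b m1 k1 h)
    have h1 := finrank_sup_sp hnot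
    have : finrank (ZMod 2) (span (ZMod 2) {pt b K.log2}) = 1 := finrank_span_singleton (hc.ne k2)
    have h2 := finrank_mono (s := span (ZMod 2) {pt b K.log2} ⊔ span (ZMod 2) {pt b x})
      (t := span (ZMod 2) {s | s ∈ S ∧ φ s = 0})
      (sup_le (span_mono (by intro s hs; rw [mem_singleton_iff] at hs; subst hs; exact ⟨k2, k3⟩))
        (span_mono (by intro s hs; rw [mem_singleton_iff] at hs; subst hs; exact ⟨m2, m3⟩)))
    omega

theorem line_leaf {S : Finset V} (hn : n = 5 ∨ n = 6) {I O z : ℕ}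
    (hL : ∀ z ∈ S, 8 ≤ (D2 S z).card)
    (hP : Cons (fun x => pt b x ∈ S) (I, O)) (h : lineLeaf n I O z = true) : False := by
  classical
  have h64 : 2 ^ n ≤ 64 := by rcases hn with rfl | rfl <;> norm_num
  simp only [lineLeaf, Bool.and_eq_true] at h
  obtain ⟨⟨h1, h2⟩, h3⟩ := h
  have hz : z < 2 ^ n := by
    rw [Nat.blt_eq] at h2; exact h2
  have hzS := hP.1 z h1
  set m := (2 ^ 2 ^ n - 1) ^^^ ((2 ^ 2 ^ n - 1) &&& (O ||| trl O z)) with hm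
  set A := (Finset.range (2 ^ n)).filter (fun x => m.testBit x = true) with hA
  have hc := few_sound 7 m h3 A (fun x hx => (Finset.mem_filter.1 hx).2)
  have hsub : D2 S (pt b z) ⊆ A.image (pt b) := by
    intro s hs
    obtain ⟨x, hx, rfl⟩ := pt_surj b s
    rw [mem_D2, ← pt_xor] at hs
    refine Finset.mem_image_of_mem _ (Finset.mem_filter.2 ⟨Finset.mem_range.2 hx, ?_⟩)
    have o1 : O.testBit x = false := by
      by_contra hh; exact hP.2 x (by simpa using hh) hs.1
    have o2 : O.testBit (x ^^^ z) = false := by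
      by_contra hh; exact hP.2 _ (by simpa using hh) hs.2
    rw [hm, Nat.testBit_xor, Nat.testBit_and, Nat.testBit_or, trl_sound O z x (by omega) (by omega),
      o1, o2, Nat.testBit_two_pow_sub_one]
    simp [hx]
  have := Finset.card_le_card hsub
  have h8 := hL _ hzS
  have := Finset.card_image_le (s := A) (f := pt b)
  omega

theorem leafA_sound {S : Finset V} (hc : Cfg n S) (hn : n = 5 ∨ n = 6)
    (hL : ∀ z ∈ S, 8 ≤ (D2 S z).card) {t I O : ℕ} (h : leafA n t I O = true)
    (hP : Cons (fun x => pt b x ∈ S) (I, O)) : False := by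
  rw [leafA] at h
  cases h1 : Nat.beq (t % 8) 1 with
  | true => rw [h1] at h; exact ag_leaf b hc hn hP h
  | false =>
    rw [h1, cond_false] at h
    cases h2 : Nat.beq (t % 8) 2 with
    | true => rw [h2] at h; exact line_leaf b hn hL hP h
    | false => rw [h2] at h; simp at h

theorem f7_leaf {S : Finset V} (h0 : (0 : V) ∉ S) {I O p : ℕ}
    (hP : Cons (fun x => pt b x ∈ S) (I, O)) (h : f7Leaf I p = true) : ∃ P, IsF7 S P := by
  simp only [f7Leaf, Bool.and_eq_true] at h
  obtain ⟨h1, h2, h3, h4, h5, h6, h7⟩ := h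
  have q4 := hP.1 _ h4
  have q5 := hP.1 _ h5
  have q6 := hP.1 _ h6
  have q7 := hP.1 _ h7
  simp only [pt_xor] at q4 q5 q6 q7
  exact ⟨_, f7_of' h0 (hP.1 _ h1) (hP.1 _ h2) (hP.1 _ h3) q4 q5 q6 q7⟩

theorem gr_sound (x : ℕ) : ∀ (Fs : List ℕ) (z o t : ℕ), (grSplit z o t Fs).testBit x = true →
    (z.testBit x = true ∧ Fs.countP (fun F => F.testBit x) = 2) ∨
    (o.testBit x = true ∧ Fs.countP (fun F => F.testBit x) = 1) ∨
    (t.testBit x = true ∧ Fs.countP (fun F => F.testBit x) = 0) := by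
  intro Fs
  induction Fs with
  | nil => intro z o t h; right; right; exact ⟨h, rfl⟩
  | cons F Fs ih =>
    intro z o t h
    have := ih _ _ _ h
    simp only [Nat.testBit_or, Nat.testBit_xor, Nat.testBit_and] at this
    rw [List.countP_cons]
    revert this
    cases z.testBit x <;> cases o.testBit x <;> cases t.testBit x <;> cases F.testBit x <;> simp

theorem gr_leaf {S : Finset V} (b : Basis (Fin 6) (ZMod 2) V) {I O p : ℕ}
    (hP : Cons (fun x => pt b x ∈ S) (I, O)) (h : grLeaf O p = true) : Graphic S := by
  simp only [grLeaf, Bool.and_eq_true] at h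
  obtain ⟨h1, h2⟩ := h
  have h1 := Nat.eq_of_beq_eq_true h1
  have h2 := Nat.eq_of_beq_eq_true h2
  set q := p % 64 with hq
  have hq64 : q < 64 := Nat.mod_lt _ (by norm_num)
  refine ⟨Fin 7, inferInstance, ![fn b 2, fn b 4, fn b 8, fn b 16, fn b 32, fn b q, fn b (q ^^^ 62)],
    ?_, ?_, ?_⟩
  · rw [finrank_eq_card_basis b]; simp
  · intro v hv
    obtain ⟨x, hx, rfl⟩ := pt_surj b v
    have hv' : ∀ f < 64, fn b f (pt b x) = 0 → (fmk f).testBit x = false := by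
      intro f hf h0
      have := fn_pt b (Or.inr rfl) (f := f) hf hx
      rw [h0] at this
      simpa using this
    have a0 := hv' 2 (by norm_num) (hv 0)
    have a1 := hv' 4 (by norm_num) (hv 1)
    have a2 := hv' 8 (by norm_num) (hv 2)
    have a3 := hv' 16 (by norm_num) (hv 3)
    have a4 := hv' 32 (by norm_num) (hv 4)
    have a5 := hv' q hq64 (hv 5)
    have key : ∀ q < 64, ∀ x < 64, (q % 2 == 1 && !(fmk 2).testBit x && !(fmk 4).testBit x &&
      !(fmk 8).testBit x && !(fmk 16).testBit x && !(fmk 32).testBit x && !(fmk q).testBit x)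
      = true → x = 0 := by decide +kernel
    have := key q hq64 x hx (by simp [h1, a0, a1, a2, a3, a4, a5])
    subst this
    simp [pt]
  · intro s hs
    obtain ⟨x, hx, rfl⟩ := pt_surj b s
    have o1 : O.testBit x = false := by
      by_contra hh; exact hP.2 x (by simpa using hh) hs
    have h3 := congrArg (fun m => m.testBit x) h2
    simp only [Nat.testBit_or, o1, Bool.false_or] at h3
    have h4 : Nat.testBit 18446744073709551615 x = true := by
      have : ∀ x < 64, Nat.testBit 18446744073709551615 x = true := by decide +kernel
      exact this x hx
    rw [h4] at h3
    have h5 := gr_sound x _ _ _ _ h3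
    simp only [Nat.zero_testBit, Bool.false_eq_true, false_and, or_false] at h5
    have h6 := h5.2
    have e : ∀ f < 64, (fn b f (pt b x) = 1) = ((fmk f).testBit x = true) := by
      intro f hf
      exact propext (fn_pt b (Or.inr rfl) hf hx)
    rw [Finset.card_filter]
    rw [Fin.sum_univ_seven]
    rw [gMasks] at h6
    have hq62 : q ^^^ 62 < 64 := Nat.xor_lt_two_pow (n := 6) hq64 (by norm_num)
    simp only [List.countP_cons, List.countP_nil] at h6
    have g0 : ∀ i, (![fn b 2, fn b 4, fn b 8, fn b 16, fn b 32, fn b q, fn b (q ^^^ 62)] i (pt b x) = 1) =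
      ((![fmk 2, fmk 4, fmk 8, fmk 16, fmk 32, fmk q, fmk (q ^^^ 62)] i).testBit x = true) := by
      intro i
      fin_cases i
      · exact e 2 (by norm_num)
      · exact e 4 (by norm_num)
      · exact e 8 (by norm_num)
      · exact e 16 (by norm_num)
      · exact e 32 (by norm_num)
      · exact e q hq64
      · exact e (q ^^^ 62) hq62
    simp only [g0]
    simp only [Matrix.cons_val]
    simp only [← hq] at h6
    refine Eq.trans ?_ h6
    ac_rfl

theorem leafB_sound {S : Finset V} (b : Basis (Fin 6) (ZMod 2) V) (hc : Cfg 6 S)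
    (hF : ¬ ∃ P, IsF7 S P)
    (hL : ∀ z ∈ S, 8 ≤ (D2 S z).card) {t I O : ℕ} (h : leafB t I O = true)
    (hP : Cons (fun x => pt b x ∈ S) (I, O)) : Graphic S := by
  rw [leafB] at h
  cases h1 : Nat.beq (t % 8) 3 with
  | true => rw [h1] at h; exact absurd (f7_leaf b hc.z hP h) hF
  | false =>
    rw [h1, cond_false] at h
    cases h2 : Nat.beq (t % 8) 4 with
    | true => rw [h2] at h; exact gr_leaf b hP h
    | false => rw [h2] at h; exact (leafA_sound b hc (Or.inr rfl) hL h hP).elim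

end gr
end ML

namespace ML

set_option linter.unusedSectionVars false
open Module Submodule

section cc
variable {V : Type} [AddCommGroup V] [Module (ZMod 2) V]

theorem pt_pow {n : ℕ} (b : Basis (Fin n) (ZMod 2) V) (i : Fin n) : pt b (2 ^ (i : ℕ)) = b i := by
  rw [pt, Finset.sum_eq_single i]
  · simp
  · intro j _ hj
    rw [Nat.testBit_two_pow]
    have : (i : ℕ) ≠ j := fun e => hj (Fin.ext e.symm)
    simp [this]
  · simp

theorem exists_notMem_span {n k : ℕ} {S : Finset V} (hc : Cfg n S) (v : Fin k → V) (hk : k < n) :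
    ∃ s ∈ S, s ∉ span (ZMod 2) (range v) := by
  have := hc.fin
  by_contra hcon
  push Not at hcon
  have h1 : span (ZMod 2) (S : Set V) ≤ span (ZMod 2) (range v) := span_le.2 hcon
  rw [hc.sp] at h1
  have h2 := finrank_mono h1
  rw [finrank_top, hc.dim] at h2
  have h3 := finrank_range_le_card (R := ZMod 2) v
  rw [Set.finrank, Fintype.card_fin] at h3
  omega

theorem LI3 [Finite V] {P : Submodule (ZMod 2) V} (hP : finrank (ZMod 2) P = 3) {p1 p2 : V}
    (h1 : p1 ∈ P) (h2 : p2 ∈ P) (h10 : p1 ≠ 0) (h20 : p2 ≠ 0) (h12 : p1 ≠ p2) :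
    ∃ p3 ∈ P, LinearIndependent (ZMod 2) ![p1, p2, p3] ∧ span (ZMod 2) (range ![p1, p2, p3]) = P := by
  have hli : LinearIndependent (ZMod 2) ![p1, p2] := by
    rw [LinearIndependent.pair_iff]
    intro s t h
    rcases z2 s with rfl | rfl <;> rcases z2 t with rfl | rfl
    · simp
    · simp at h; exact absurd h h20
    · simp at h; exact absurd h h10
    · simp at h; exact absurd (ad_eq_zero.1 h) h12
  have : ∃ p3 ∈ P, p3 ∉ span (ZMod 2) (range ![p1, p2]) := by
    by_contra hcon
    push Not at hcon
    have h2 := finrank_mono (s := P) (t := span (ZMod 2) (range ![p1, p2])) hcon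
    have h3 := finrank_range_le_card (R := ZMod 2) ![p1, p2]
    rw [Set.finrank, Fintype.card_fin] at h3
    omega
  obtain ⟨p3, hp3, hn⟩ := this
  have h3 := hli.finSnoc hn
  have e : Fin.snoc ![p1, p2] p3 = ![p1, p2, p3] := by
    funext i; fin_cases i <;> rfl
  rw [e] at h3
  refine ⟨p3, hp3, h3, ?_⟩
  apply eq_of_le_of_finrank_eq
  · rw [span_le]
    rintro _ ⟨i, rfl⟩
    fin_cases i <;> assumption
  · rw [finrank_span_eq_card h3, hP]; rfl

theorem C1 {n : ℕ} (hn : n = 5 ∨ n = 6) {S : Finset V} (hc : Cfg n S)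
    (hL : ∀ z ∈ S, 8 ≤ (D2 S z).card) {P : Submodule (ZMod 2) V} (hP : IsF7 S P) {w p1 p2 : V}
    (hw : w ∈ S) (hwP : w ∉ P) (h1 : p1 ∈ P) (h2 : p2 ∈ P) (h10 : p1 ≠ 0) (h20 : p2 ≠ 0)
    (h12 : p1 ≠ p2) (hw1 : w + p1 ∈ S) (hw2 : w + p2 ∈ S) : False := by
  have := hc.fin
  obtain ⟨p3, hp3, hli, hsp⟩ := LI3 hP.1 h1 h2 h10 h20 h12
  have hli4 := hli.finSnoc (x := w) (by rw [hsp]; exact hwP)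
  obtain ⟨s5, hs5, hs5'⟩ := exists_notMem_span (k := 4) hc (Fin.snoc (α := fun _ => V) ![p1, p2, p3] w) (show 4 < n by omega)
  have hli5 := hli4.finSnoc hs5'
  have main : ∀ b : Basis (Fin n) (ZMod 2) V, (∀ i : Fin n, (i : ℕ) < 3 → b i ∈ P) →
      (∀ i : Fin n, 3 ≤ (i : ℕ) → b i ∈ S) → (∀ i : Fin n, (i : ℕ) = 0 → b i = p1) →
      (∀ i : Fin n, (i : ℕ) = 1 → b i = p2) → (∀ i : Fin n, (i : ℕ) = 3 → b i = w) →
      ∀ x < 2 ^ n, (x ∈ [1,2,3,4,5,6,7] ∨ x ∈ [8, 9, 10] ∨ x ∈ [16, 32]) → pt b x ∈ S := by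
    intro b hb3 hbS hb0 hb1 hbw x hx h
    have e0 : pt b 1 = p1 := by
      rw [← hb0 ⟨0, by omega⟩ rfl, ← pt_pow]; rfl
    have e1 : pt b 2 = p2 := by
      rw [← hb1 ⟨1, by omega⟩ rfl, ← pt_pow]; rfl
    have e3 : pt b 8 = w := by
      rw [← hbw ⟨3, by omega⟩ rfl, ← pt_pow]; rfl
    rcases h with h | h | h
    · have hx8 : x < 2 ^ 3 := by
        simp only [List.mem_cons, List.not_mem_nil, or_false] at h; omega
      refine hP.2 _ ?_ ?_
      · rw [pt]
        refine sum_mem fun i _ => ?_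
        by_cases hi : (i : ℕ) < 3
        · split_ifs
          · exact hb3 i hi
          · exact zero_mem _
        · rw [Nat.testBit_lt_two_pow (lt_of_lt_of_le hx8 (Nat.pow_le_pow_right (by norm_num) (by omega)))]
          simp
      · intro h0
        have h00 : pt b 0 = 0 := by simp [pt]
        rw [← h00] at h0
        have := pt_inj b hx (by positivity) h0
        subst this
        simp at h
    · simp only [List.mem_cons, List.not_mem_nil, or_false] at h
      rcases h with rfl | rfl | rfl
      · rw [e3]; exact hw
      · rw [show (9 : ℕ) = 8 ^^^ 1 by rfl, pt_xor, e3, e0]; exact hw1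
      · rw [show (10 : ℕ) = 8 ^^^ 2 by rfl, pt_xor, e3, e1]; exact hw2
    · simp only [List.mem_cons, List.not_mem_nil, or_false] at h
      rcases h with rfl | rfl
      · have := pt_pow b ⟨4, by omega⟩
        simp only at this
        rw [show (16 : ℕ) = 2 ^ 4 by rfl, this]
        exact hbS _ (by simp)
      · have h5 : 5 < n := by
          rcases hn with rfl | rfl
          · norm_num at hx
          · norm_num
        have := pt_pow b ⟨5, h5⟩
        simp only at this
        rw [show (32 : ℕ) = 2 ^ 5 by rfl, this]
        exact hbS _ (by simp)
  have out : ∀ b : Basis (Fin n) (ZMod 2) V, ∀ x, Nat.testBit 1 x = true → ¬ pt b x ∈ S := by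
    intro b x hx
    have : x = 0 := by simpa using Nat.testBit_one_eq_true_iff_self_eq_zero.1 hx
    subst this
    have h00 : pt b 0 = 0 := by simp [pt]
    rw [h00]; exact hc.z
  rcases hn with rfl | rfl
  · set b := basisOfLinearIndependentOfCardEqFinrank hli5 (by rw [hc.dim]; rfl) with hb
    have hbe : ⇑b = Fin.snoc (Fin.snoc ![p1, p2, p3] w) s5 :=
      coe_basisOfLinearIndependentOfCardEqFinrank _ _
    refine chk_sound (P := fun x => pt b x ∈ S) (fun t I O h hP => leafA_sound b hc (Or.inl rfl) hL h hP) _ _ chkU _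
      (List.mem_singleton_self _) ⟨?_, out b⟩
    intro x hx
    have hx32 : x < 32 := by
      by_contra h
      push Not at h
      rw [Nat.testBit_lt_two_pow (lt_of_lt_of_le (show 67582 < 2 ^ 32 by norm_num)
        (Nat.pow_le_pow_right (by norm_num) h))] at hx
      simp at hx
    refine main b ?_ ?_ ?_ ?_ ?_ x hx32 ?_
    · intro i hi; rw [hbe]; fin_cases i <;> first | assumption | simp at hi
    · intro i hi; rw [hbe]; fin_cases i <;> first | assumption | simp at hi
    · intro i hi; rw [hbe]; fin_cases i <;> first | rfl | simp at hi
    · intro i hi; rw [hbe]; fin_cases i <;> first | rfl | simp at hi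
    · intro i hi; rw [hbe]; fin_cases i <;> first | rfl | simp at hi
    · revert x hx; intro x hx hx32; revert hx; revert x; decide +kernel
  · obtain ⟨s6, hs6, hs6'⟩ := exists_notMem_span (k := 5) hc
      (Fin.snoc (α := fun _ => V) (Fin.snoc (α := fun _ => V) ![p1, p2, p3] w) s5) (by omega)
    have hli6 := hli5.finSnoc hs6'
    set b := basisOfLinearIndependentOfCardEqFinrank hli6 (by rw [hc.dim]; rfl) with hb
    have hbe : ⇑b = Fin.snoc (Fin.snoc (Fin.snoc ![p1, p2, p3] w) s5) s6 :=
      coe_basisOfLinearIndependentOfCardEqFinrank _ _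
    refine chk_sound (P := fun x => pt b x ∈ S) (fun t I O h hP => leafA_sound b hc (Or.inr rfl) hL h hP) _ _ chkA _
      (List.mem_singleton_self _) ⟨?_, out b⟩
    intro x hx
    have hx32 : x < 64 := by
      by_contra h
      push Not at h
      rw [Nat.testBit_lt_two_pow (lt_of_lt_of_le (show 4295034878 < 2 ^ 64 by norm_num)
        (Nat.pow_le_pow_right (by norm_num) h))] at hx
      simp at hx
    refine main b ?_ ?_ ?_ ?_ ?_ x hx32 ?_
    · intro i hi; rw [hbe]; fin_cases i <;> first | assumption | simp at hi
    · intro i hi; rw [hbe]; fin_cases i <;> first | assumption | simp at hi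
    · intro i hi; rw [hbe]; fin_cases i <;> first | rfl | simp at hi
    · intro i hi; rw [hbe]; fin_cases i <;> first | rfl | simp at hi
    · intro i hi; rw [hbe]; fin_cases i <;> first | rfl | simp at hi
    · revert x hx; intro x hx hx32; revert hx; revert x; decide +kernel

theorem C2a {S : Finset V} (hc : Cfg 6 S) (hF : ¬ ∃ P, IsF7 S P) (hG : ¬ Graphic S)
    (hL : ∀ z ∈ S, 8 ≤ (D2 S z).card) (b : Basis (Fin 6) (ZMod 2) V) (hz : b 0 ∈ S)
    (hb : ∀ i, i ≠ 0 → b i ∈ S ∧ b i + b 0 ∈ S) : b 1 + b 2 + b 3 ∉ S := by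
  intro h14
  have e0 : pt b 1 = b 0 := pt_pow b 0
  have e1 : pt b 2 = b 1 := pt_pow b 1
  have e2 : pt b 4 = b 2 := pt_pow b 2
  have e3 : pt b 8 = b 3 := pt_pow b 3
  have e4 : pt b 16 = b 4 := pt_pow b 4
  have e5 : pt b 32 = b 5 := pt_pow b 5
  refine hG (chk_sound (P := fun x => pt b x ∈ S) (fun t I O h hP => leafB_sound b hc hF hL h hP) _ _ chkB _
      (List.mem_singleton_self _) ⟨?_, ?_⟩)
  · intro x hx
    have hx64 : x < 64 := by
      by_contra h
      push Not at h
      rw [Nat.testBit_lt_two_pow (lt_of_lt_of_le (show 12885115710 < 2 ^ 64 by norm_num)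
        (Nat.pow_le_pow_right (by norm_num) h))] at hx
      simp at hx
    have key : ∀ x < 64, Nat.testBit 12885115710 x = true → x ∈ [1, 2, 3, 4, 5, 8, 9, 16, 17, 32, 33, 14] := by
      decide +kernel
    have := key x hx64 hx
    simp only [List.mem_cons, List.not_mem_nil, or_false] at this
    rcases this with rfl | rfl | rfl | rfl | rfl | rfl | rfl | rfl | rfl | rfl | rfl | rfl
    · rw [e0]; exact hz
    · rw [e1]; exact (hb 1 (by decide)).1
    · rw [show (3 : ℕ) = 2 ^^^ 1 by rfl, pt_xor, e0, e1]; exact (hb 1 (by decide)).2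
    · rw [e2]; exact (hb 2 (by decide)).1
    · rw [show (5 : ℕ) = 4 ^^^ 1 by rfl, pt_xor, e0, e2]; exact (hb 2 (by decide)).2
    · rw [e3]; exact (hb 3 (by decide)).1
    · rw [show (9 : ℕ) = 8 ^^^ 1 by rfl, pt_xor, e0, e3]; exact (hb 3 (by decide)).2
    · rw [e4]; exact (hb 4 (by decide)).1
    · rw [show (17 : ℕ) = 16 ^^^ 1 by rfl, pt_xor, e0, e4]; exact (hb 4 (by decide)).2
    · rw [e5]; exact (hb 5 (by decide)).1
    · rw [show (33 : ℕ) = 32 ^^^ 1 by rfl, pt_xor, e0, e5]; exact (hb 5 (by decide)).2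
    · rw [show (14 : ℕ) = 2 ^^^ 4 ^^^ 8 by rfl, pt_xor, pt_xor, e1, e2, e3]; exact h14
  · intro x hx
    have : x = 0 := by simpa using Nat.testBit_one_eq_true_iff_self_eq_zero.1 hx
    subst this
    have h00 : pt b 0 = 0 := by simp [pt]
    show ¬ pt b 0 ∈ S
    rw [h00]; exact hc.z

theorem C2b {S : Finset V} (hc : Cfg 6 S) (hF : ¬ ∃ P, IsF7 S P) (hG : ¬ Graphic S)
    (hL : ∀ z ∈ S, 8 ≤ (D2 S z).card) (b : Basis (Fin 6) (ZMod 2) V) (hz : b 0 ∈ S)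
    (hb : ∀ i, i ≠ 0 → b i ∈ S ∧ b i + b 0 ∈ S) (i j k : Fin 6) (hi : 0 < i) (hij : i < j)
    (hjk : j < k) : b i + b j + b k ∉ S ∧ b i + b j + b k + b 0 ∉ S := by
  have key : ∀ b : Basis (Fin 6) (ZMod 2) V, b 0 ∈ S → (∀ i, i ≠ 0 → b i ∈ S ∧ b i + b 0 ∈ S) →
      b i + b j + b k ∉ S := by
    intro b hz hb
    set σ : Equiv.Perm (Fin 6) := Equiv.swap 1 i * Equiv.swap 2 j * Equiv.swap 3 k with hσ
    have s0 : σ 0 = 0 := by rw [hσ]; clear hz hb; revert i j k; decide +kernel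
    have s1 : σ 1 = i := by rw [hσ]; clear hz hb; revert i j k; decide +kernel
    have s2 : σ 2 = j := by rw [hσ]; clear hz hb; revert i j k; decide +kernel
    have s3 : σ 3 = k := by rw [hσ]; clear hz hb; revert i j k; decide +kernel
    have h := C2a hc hF hG hL (b.reindex σ.symm) (by simpa [s0] using hz) (by
      intro m hm
      have : σ m ≠ 0 := fun e => hm (σ.injective (e.trans s0.symm))
      simpa [s0] using hb (σ m) this)
    simpa [s1, s2, s3] using h
  refine ⟨key b hz hb, ?_⟩
  set T : V →ₗ[ZMod 2] V := LinearMap.id + (b.coord i).smulRight (b 0) with hT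
  have hTi : T (b i) = b i + b 0 := by simp [hT]
  have hTj : ∀ j, j ≠ i → T (b j) = b j := by
    intro j hj; simp [hT, hj]
  have hinv : Function.Involutive T := by
    have : T ∘ₗ T = LinearMap.id := by
      apply b.ext
      intro m
      by_cases hm : m = i
      · subst hm
        rw [LinearMap.comp_apply, hTi, map_add, hTi, hTj 0 (by omega), adc']; rfl
      · rw [LinearMap.comp_apply, hTj m hm, hTj m hm]; rfl
    exact fun v => LinearMap.congr_fun this v
  have := key (b.map (LinearEquiv.ofInvolutive T hinv)) (by simpa [hTj 0 (by omega)] using hz) (by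
    intro m hm
    have h0 : T (b 0) = b 0 := hTj 0 (by omega)
    by_cases hmi : m = i
    · subst hmi
      simp only [Basis.map_apply, LinearEquiv.coe_ofInvolutive, hTi, h0, adc']
      exact (hb m hm).symm
    · simp only [Basis.map_apply, LinearEquiv.coe_ofInvolutive, hTj m hmi, h0]
      exact hb m hm)
  simp only [Basis.map_apply, LinearEquiv.coe_ofInvolutive, hTi, hTj j (by omega), hTj k (by omega)] at this
  have e : b i + b j + b k + b 0 = b i + b 0 + b j + b k := by abel
  rwa [e]

theorem C2 {S : Finset V} (hc : Cfg 6 S) (hF : ¬ ∃ P, IsF7 S P)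
    (hL : ∀ z ∈ S, 8 ≤ (D2 S z).card) (b : Basis (Fin 6) (ZMod 2) V) (hz : b 0 ∈ S)
    (hb : ∀ i, i ≠ 0 → b i ∈ S ∧ b i + b 0 ∈ S) : Graphic S := by
  by_contra hG
  have e0 : pt b 1 = b 0 := pt_pow b 0
  refine hG (chk_sound (P := fun x => pt b x ∈ S) (fun t I O h hP => leafB_sound b hc hF hL h hP) _ _ chkC _
      (List.mem_singleton_self _) ⟨?_, ?_⟩)
  · intro x hx
    have hx64 : x < 64 := by
      by_contra h
      push Not at h
      rw [Nat.testBit_lt_two_pow (lt_of_lt_of_le (show 12885099326 < 2 ^ 64 by norm_num)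
        (Nat.pow_le_pow_right (by norm_num) h))] at hx
      simp at hx
    have key : ∀ x < 64, Nat.testBit 12885099326 x = true → x = 1 ∨ ∃ i : Fin 6, i ≠ 0 ∧
      (x = 2 ^ (i : ℕ) ∨ x = 2 ^ (i : ℕ) ^^^ 1) := by
      decide +kernel
    rcases key x hx64 hx with rfl | ⟨i, hi, rfl | rfl⟩
    · rw [e0]; exact hz
    · rw [pt_pow]; exact (hb i hi).1
    · rw [pt_xor, pt_pow, e0]; exact (hb i hi).2
  · intro x hx
    have hx64 : x < 64 := by
      by_contra h
      push Not at h
      have hx : Nat.testBit 233128077067075585 x = true := hx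
      rw [Nat.testBit_lt_two_pow (lt_of_lt_of_le (show 233128077067075585 < 2 ^ 64 by norm_num)
        (Nat.pow_le_pow_right (by norm_num) h))] at hx
      simp at hx
    have key : ∀ x < 64, Nat.testBit 233128077067075585 x = true → x = 0 ∨ ∃ i j k : Fin 6,
      (0 < i ∧ i < j ∧ j < k) ∧ (x = 2 ^ (i : ℕ) ^^^ 2 ^ (j : ℕ) ^^^ 2 ^ (k : ℕ) ∨
        x = 2 ^ (i : ℕ) ^^^ 2 ^ (j : ℕ) ^^^ 2 ^ (k : ℕ) ^^^ 1) := by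
      decide +kernel
    rcases key x hx64 hx with rfl | ⟨i, j, k, ⟨h1, h2, h3⟩, rfl | rfl⟩
    · have h00 : pt b 0 = 0 := by simp [pt]
      show ¬ pt b 0 ∈ S
      rw [h00]; exact hc.z
    · simp only [pt_xor, pt_pow]; exact (C2b hc hF hG hL b hz hb i j k h1 h2 h3).1
    · simp only [pt_xor, pt_pow, e0]; exact (C2b hc hF hG hL b hz hb i j k h1 h2 h3).2

end cc
end ML

namespace ML

set_option linter.unusedSectionVars false
open Module Submodule

section cd
variable {V : Type} [AddCommGroup V] [Module (ZMod 2) V]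
open scoped Classical

theorem three_dvd {S : Finset V} (h0 : (0 : V) ∉ S) : 3 ∣ ∑ z ∈ S, (D2 S z).card := by
  set A := S.sigma (fun z => D2 S z) with hA
  have hcard : A.card = ∑ z ∈ S, (D2 S z).card := Finset.card_sigma _ _
  rw [← hcard]
  have hmem : ∀ t : (_ : V) × V, t ∈ A ↔ t.1 ∈ S ∧ t.2 ∈ S ∧ t.2 + t.1 ∈ S := by
    intro t; rw [hA, Finset.mem_sigma, mem_D2]
  let f : A → A := fun t => ⟨⟨t.1.2, t.1.2 + t.1.1⟩, by
    have := (hmem _).1 t.2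
    rw [hmem]
    refine ⟨this.2.1, this.2.2, ?_⟩
    simp only
    rw [add_comm, adc]; exact this.1⟩
  have f3 : f^[3] = id := by
    funext t
    apply Subtype.ext
    show (⟨_, _⟩ : (_ : V) × V) = _
    obtain ⟨⟨a, b⟩, h⟩ := t
    simp only [Sigma.mk.injEq, id, f]
    have e : b + a + b = a := by rw [add_comm, adc]
    refine ⟨e, ?_⟩
    rw [e, add_comm b a, adc]
  have f3' : ∀ t, f (f (f t)) = t := fun t => congrFun f3 t
  let σ : Function.End A := f
  have h3 : σ ^ 3 ^ 1 = 1 := by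
    rw [pow_one, pow_succ, pow_two]
    funext t
    exact f3' t
  have : Fact (Nat.Prime 3) := ⟨by norm_num⟩
  have := Equiv.Perm.card_fixedPoints_modEq (f := σ) (p := 3) (n := 1) h3
  have he : Fintype.card (Function.fixedPoints σ) = 0 := by
    rw [Fintype.card_eq_zero_iff]
    constructor
    rintro ⟨t, ht⟩
    have ht : f t = t := ht
    have h1 := congrArg (fun x : A => x.1.1) ht
    have h2 := congrArg (fun x : A => x.1.2) ht
    simp only [f] at h1 h2
    have : t.1.1 = 0 := by simpa using h2
    exact h0 (this ▸ ((hmem _).1 t.2).1)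
  rw [he] at this
  have h' : Fintype.card A = A.card := Fintype.card_coe _
  rw [h'] at this
  exact (Nat.modEq_zero_iff_dvd.1 this)

theorem card_V {n : ℕ} [Finite V] (h : finrank (ZMod 2) V = n) : Nat.card V = 2 ^ n := by
  rw [Module.natCard_eq_pow_finrank (K := ZMod 2), h, Nat.card_zmod]

theorem bound4 {S : Finset V} (hc : Cfg 4 S) : S.card ≤ 11 := by
  have := hc.fin
  have := Fintype.ofFinite V
  by_contra h
  push Not at h
  refine kill2 hc.sp hc.ag ⊤ (by rw [finrank_top, hc.dim]) ((Finset.univ \ S).erase 0) ?_ ?_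
  · have h1 := card_V hc.dim
    rw [Nat.card_eq_fintype_card] at h1
    rw [Finset.card_erase_of_mem (by simp [hc.z]), Finset.card_sdiff_of_subset (Finset.subset_univ _),
      Finset.card_univ, h1]
    omega
  · intro u _ hu
    by_cases h : u ∈ S
    · exact Or.inl h
    · right; simp [h, hu]

theorem f7free_card {n : ℕ} {S : Finset V} (hc : Cfg n S) (hF : ¬ ∃ P, IsF7 S P) {z : V} (hz : z ∈ S) :
    (D2 S z).card + 2 = 2 * finrank (ZMod 2) (Vz S z) := by
  have := hc.fin
  obtain ⟨h, B, E, T, d⟩ := exists_DS hc hz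
  have hE : E = ∅ := by
    rw [Finset.eq_empty_iff_forall_notMem]
    intro e he
    obtain ⟨b, hb, b', hb', _, _, hee⟩ := pairT d he
    rw [hee] at he
    exact hF ⟨_, d.f7 hc.z hz hb hb' he⟩
  rw [d.cardD, d.rkV, hE]; simp; ring

theorem rkV_le {n : ℕ} {S : Finset V} (hc : Cfg n S) (z : V) : finrank (ZMod 2) (Vz S z) ≤ n := by
  have := hc.fin
  rw [← hc.dim]; exact finrank_le _

/-- Counting over a Fano plane when every coset has at most two points. -/
theorem coset_count {n : ℕ} (hn : n = 5 ∨ n = 6) {S : Finset V} (hc : Cfg n S)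
    (hL : ∀ z ∈ S, 8 ≤ (D2 S z).card) {P : Submodule (ZMod 2) V} (hP : IsF7 S P) :
    S.card ≤ 5 + 2 ^ (n - 2) ∧ ∀ k, (∀ p ∈ P, p ≠ 0 → 6 + k ≤ (D2 S p).card) → 7 * k + 7 ≤ S.card := by
  have := hc.fin
  have := Fintype.ofFinite V
  have hPc : Nat.card P = 8 := by
    have := card_V hP.1; simpa using this
  set Pf : Finset V := Finset.univ.filter (fun v => v ∈ P ∧ v ≠ 0) with hPf
  have hPfc : Pf.card = 7 := by
    have e : insert 0 Pf = Finset.univ.filter (fun v => v ∈ P) := by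
      ext v; simp only [hPf, Finset.mem_insert, Finset.mem_filter, Finset.mem_univ, true_and]
      by_cases h : v = 0
      · simp [h]
      · simp [h]
    have : (insert 0 Pf).card = 8 := by
      rw [e, ← hPc, Nat.card_eq_fintype_card, Fintype.card_subtype]
    rw [Finset.card_insert_of_notMem (by simp [hPf])] at this
    omega
  set X := S.filter (fun s => s ∉ P) with hX
  have hSX : S.card = X.card + 7 := by
    have e : S.filter (fun s => s ∈ P) = Pf := by
      ext v
      simp only [hPf, Finset.mem_filter, Finset.mem_univ, true_and]
      constructor
      · rintro ⟨h1, h2⟩; exact ⟨h2, fun h => hc.z (h ▸ h1)⟩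
      · rintro ⟨h1, h2⟩; exact ⟨hP.2 _ h1 h2, h1⟩
    have := Finset.card_filter_add_card_filter_not (s := S) (fun s => s ∈ P)
    rw [e, hPfc] at this
    rw [← this, hX]; ring
  have huniq : ∀ w ∈ X, ∀ p1 ∈ Pf, ∀ p2 ∈ Pf, w + p1 ∈ S → w + p2 ∈ S → p1 = p2 := by
    intro w hw p1 h1 p2 h2 hw1 hw2
    simp only [hX, hPf, Finset.mem_filter, Finset.mem_univ, true_and] at hw h1 h2
    by_contra hne
    exact C1 hn hc hL hP hw.1 hw.2 h1.1 h2.1 h1.2 h2.2 hne hw1 hw2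
  constructor
  · have h1 : X.card ≤ 2 * ((Finset.univ : Finset V).image P.mkQ |>.erase 0).card := by
      apply Finset.card_le_mul_card_image_of_maps_to (f := P.mkQ)
      · intro x hx
        simp only [hX, Finset.mem_filter] at hx
        simp only [Finset.mem_erase, Finset.mem_image, Finset.mem_univ, true_and]
        exact ⟨by simpa using hx.2, x, rfl⟩
      · intro q _
        by_contra hcon
        push Not at hcon
        obtain ⟨a, b, c, ha, hb, hc', hab, hac, hbc⟩ := Finset.two_lt_card_iff.1 hcon
        simp only [Finset.mem_filter] at ha hb hc'
        have key : ∀ u v, P.mkQ u = q → P.mkQ v = q → u ≠ v → u + v ∈ Pf := by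
          intro u v hu hv huv
          simp only [hPf, Finset.mem_filter, Finset.mem_univ, true_and]
          refine ⟨?_, fun h => huv (ad_eq_zero.1 h)⟩
          have : P.mkQ (u + v) = 0 := by rw [map_add, hu, hv, ads]
          exact (Submodule.Quotient.mk_eq_zero P).1 this
        have hSS : ∀ u, u ∈ X → u ∈ S := fun u hu => (Finset.mem_filter.1 hu).1
        have := huniq a ha.1 (a + b) (key _ _ ha.2 hb.2 hab) (a + c) (key _ _ ha.2 hc'.2 hac)
          (by rw [adc]; exact hSS _ hb.1) (by rw [adc]; exact hSS _ hc'.1)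
        exact hbc (add_left_cancel this)
    have h2 : ((Finset.univ : Finset V).image P.mkQ |>.erase 0).card + 1 ≤ 2 ^ (n - 3) := by
      rw [Finset.card_erase_add_one (by simp only [Finset.mem_image, Finset.mem_univ, true_and]; exact ⟨0, map_zero _⟩)]
      have := Fintype.ofFinite (V ⧸ P)
      refine (Finset.card_le_univ _).trans ?_
      rw [← Nat.card_eq_fintype_card]
      apply le_of_eq
      apply card_V
      have := P.finrank_quotient_add_finrank
      rw [hP.1, hc.dim] at this
      omega
    rw [hSX]
    rcases hn with rfl | rfl <;> norm_num at h2 ⊢ <;> omega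
  · intro k hk
    set Q : V → Finset V := fun p => X.filter (fun s => s + p ∈ S) with hQ
    have hQc : ∀ p ∈ Pf, k ≤ (Q p).card := by
      intro p hp
      have hp' := hp
      simp only [hPf, Finset.mem_filter, Finset.mem_univ, true_and] at hp
      have h6 := hk p hp.1 hp.2
      have hsub : D2 S p ⊆ Q p ∪ Pf.erase p := by
        intro s hs
        rw [mem_D2] at hs
        by_cases hsP : s ∈ P
        · apply Finset.mem_union_right
          simp only [hPf, Finset.mem_erase, Finset.mem_filter, Finset.mem_univ, true_and]
          refine ⟨?_, hsP, fun h => hc.z (h ▸ hs.1)⟩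
          rintro rfl
          rw [ads] at hs
          exact hc.z hs.2
        · apply Finset.mem_union_left
          simp only [hQ, hX, Finset.mem_filter]
          exact ⟨⟨hs.1, hsP⟩, hs.2⟩
      have h7 := (Finset.card_le_card hsub).trans (Finset.card_union_le _ _)
      rw [Finset.card_erase_of_mem hp', hPfc] at h7
      omega
    have hdis : (Pf : Set V).PairwiseDisjoint Q := by
      intro p1 h1 p2 h2 hne
      rw [Function.onFun, Finset.disjoint_left]
      intro s hs1 hs2
      simp only [hQ, Finset.mem_filter] at hs1 hs2
      exact hne (huniq s hs1.1 p1 h1 p2 h2 hs1.2 hs2.2)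
    have h8 : (Pf.biUnion Q).card ≤ X.card := by
      apply Finset.card_le_card
      intro s hs
      simp only [Finset.mem_biUnion, hQ, Finset.mem_filter] at hs
      obtain ⟨_, _, h, _⟩ := hs
      exact h
    rw [Finset.card_biUnion hdis] at h8
    have h9 := Finset.card_nsmul_le_sum Pf (fun p => (Q p).card) k hQc
    rw [hPfc, smul_eq_mul] at h9
    omega

theorem bound5 {S : Finset V} (hc : Cfg 5 S) : S.card ≤ 15 := by
  have := hc.fin
  by_contra h
  push Not at h
  have hL : ∀ z ∈ S, 2 * S.card ≤ (D2 S z).card + 24 := by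
    intro z hz
    have h1 := con_card hz hc.z
    have h2 := bound4 (hc.con hz)
    omega
  have hL8 : ∀ z ∈ S, 8 ≤ (D2 S z).card := fun z hz => by have := hL z hz; omega
  by_cases hF : ∃ P, IsF7 S P
  · obtain ⟨P, hP⟩ := hF
    have := (coset_count (Or.inl rfl) hc hL8 hP).1
    norm_num at this
    omega
  · have h8 : ∀ z ∈ S, (D2 S z).card = 8 := by
      intro z hz
      have h1 := f7free_card hc hF hz
      have h2 := rkV_le hc z
      have := hL8 z hz
      omega
    have hne : S.Nonempty := Finset.card_pos.1 (by omega)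
    obtain ⟨z, hz⟩ := hne
    have h16 : S.card = 16 := by
      have h1 := h8 z hz
      have h2 := hL z hz
      omega
    have h3 := three_dvd hc.z
    rw [Finset.sum_congr rfl h8, Finset.sum_const, h16] at h3
    norm_num at h3

theorem graphic_of_full6 {S : Finset V} (hc : Cfg 6 S) (hF : ¬ ∃ P, IsF7 S P)
    (hL : ∀ z ∈ S, 8 ≤ (D2 S z).card) {z : V} (hz : z ∈ S) (hz9 : 9 ≤ (D2 S z).card) : Graphic S := by
  have := hc.fin
  obtain ⟨h, B, E, T, d⟩ := exists_DS hc hz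
  have h1 := f7free_card hc hF hz
  have h2 := rkV_le hc z
  have h3 := d.rkV
  have hB : B.card = 5 := by omega
  set e : Fin 5 ≃ B := (B.equivFinOfCardEq hB).symm with he
  have hli : LinearIndependent (ZMod 2) (Fin.cons z (fun i => (e i : V)) : Fin 6 → V) := by
    rw [linearIndependent_finCons]
    constructor
    · have := d.li
      exact LinearIndependent.comp this e e.injective
    · intro hcon
      apply d.zB
      refine span_mono ?_ hcon
      rintro _ ⟨i, rfl⟩
      exact (e i).2
  set b := basisOfLinearIndependentOfCardEqFinrank hli (by rw [hc.dim]; rfl) with hb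
  have hbe : ⇑b = (Fin.cons z (fun i => (e i : V)) : Fin 6 → V) :=
    coe_basisOfLinearIndependentOfCardEqFinrank _ _
  refine C2 hc hF hL b ?_ ?_
  · rw [hbe]; exact hz
  · intro i hi
    obtain ⟨j, rfl⟩ := Fin.exists_succ_eq.2 hi
    rw [hbe]
    have := d.memB (e j).2
    exact ⟨this.1, this.2.1⟩

theorem T6 {S : Finset V} (hc : Cfg 6 S) (hS : 20 ≤ S.card) : Graphic S := by
  have := hc.fin
  have hL : ∀ z ∈ S, 2 * S.card ≤ (D2 S z).card + 32 := by
    intro z hz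
    have h1 := con_card hz hc.z
    have h2 := bound5 (hc.con hz)
    omega
  have hL8 : ∀ z ∈ S, 8 ≤ (D2 S z).card := fun z hz => by have := hL z hz; omega
  by_cases hF : ∃ P, IsF7 S P
  · exfalso
    obtain ⟨P, hP⟩ := hF
    obtain ⟨h1, h2⟩ := coset_count (Or.inr rfl) hc hL8 hP
    norm_num at h1
    have h3 := h2 2 (fun p hp h0 => hL8 p (hP.2 p hp h0))
    have h4 := h2 4 (fun p hp h0 => by have := hL p (hP.2 p hp h0); omega)
    omega
  · by_cases h9 : ∃ z ∈ S, 9 ≤ (D2 S z).card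
    · obtain ⟨z, hz, h9⟩ := h9
      exact graphic_of_full6 hc hF hL8 hz h9
    · exfalso
      push Not at h9
      have h8 : ∀ z ∈ S, (D2 S z).card = 8 := by
        intro z hz
        have := hL8 z hz
        have := h9 z hz
        omega
      obtain ⟨z, hz⟩ : S.Nonempty := Finset.card_pos.1 (by omega)
      have h20 : S.card = 20 := by
        have h1 := h8 z hz
        have h2 := hL z hz
        omega
      have h3 := three_dvd hc.z
      rw [Finset.sum_congr rfl h8, Finset.sum_const, h20] at h3
      norm_num at h3

end cd
end ML

namespace ML

set_option linter.unusedSectionVars false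
open Module Submodule

section ce
variable {V : Type} [AddCommGroup V] [Module (ZMod 2) V]
open scoped Classical

theorem fr_map_notMem [Finite V] {y : V} {K : Submodule (ZMod 2) V} (hy : y ∉ K) :
    finrank (ZMod 2) (K.map (qm y)) = finrank (ZMod 2) K := by
  have h := ((qm y).domRestrict K).finrank_range_add_finrank_ker
  rw [LinearMap.range_domRestrict] at h
  have hk : LinearMap.ker ((qm y).domRestrict K) = ⊥ := by
    rw [eq_bot_iff]
    intro k hk
    rw [LinearMap.mem_ker, LinearMap.domRestrict_apply, qm_zero] at hk
    rcases hk with hk | hk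
    · exact (mem_bot _).2 (Subtype.ext hk)
    · exact absurd (hk ▸ k.2) hy
  rw [hk, finrank_bot] at h
  exact h

theorem fr_map_mem [Finite V] {y : V} {K : Submodule (ZMod 2) V} (hy : y ∈ K) (h0 : y ≠ 0) :
    finrank (ZMod 2) (K.map (qm y)) + 1 = finrank (ZMod 2) K := by
  have h := ((qm y).domRestrict K).finrank_range_add_finrank_ker
  rw [LinearMap.range_domRestrict] at h
  have hk : LinearMap.ker ((qm y).domRestrict K) = span (ZMod 2) {(⟨y, hy⟩ : K)} := by
    ext k
    rw [LinearMap.mem_ker, LinearMap.domRestrict_apply, qm_zero, mem_sp, Subtype.ext_iff, Subtype.ext_iff]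
    rfl
  rw [hk, finrank_span_singleton (fun h => h0 (congrArg Subtype.val h))] at h
  exact h

theorem fr_map_le [Finite V] {y : V} (K : Submodule (ZMod 2) V) (h0 : y ≠ 0) :
    finrank (ZMod 2) K ≤ finrank (ZMod 2) (K.map (qm y)) + 1 := by
  by_cases hy : y ∈ K
  · rw [fr_map_mem hy h0]
  · rw [fr_map_notMem hy]; omega

theorem Vz_con {S : Finset V} (h0 : (0 : V) ∉ S) {y z : V} (hz : z ∈ S) (hyz : z ≠ y) :
    (Vz S z).map (qm y) ≤ Vz (con S y) (qm y z) := by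
  rw [Vz, Vz, map_span, span_le]
  rintro _ ⟨d, hd, rfl⟩
  rcases hd with rfl | hd
  · exact subset_span (Or.inl rfl)
  · have hd' := mem_D2.1 hd
    by_cases h1 : d = y
    · rw [h1, qm_self]; exact zero_mem _
    by_cases h2 : d + z = y
    · have : qm y d = qm y z := by
        rw [qm_eq]; right; rw [← h2, add_comm d z, adc]
      rw [this]; exact subset_span (Or.inl rfl)
    · apply subset_span; right
      rw [Finset.mem_coe, mem_D2, ← map_add, qm_mem_con, qm_mem_con]
      exact ⟨⟨fun h => h0 (h ▸ hd'.1), h1, Or.inl hd'.1⟩, fun h => h0 (h ▸ hd'.2), h2, Or.inl hd'.2⟩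

theorem rkV_con [Finite V] {S : Finset V} (h0 : (0 : V) ∉ S) {y z : V} (hy : y ∈ S) (hz : z ∈ S) (hyz : z ≠ y) :
    finrank (ZMod 2) (Vz S z) ≤ finrank (ZMod 2) (Vz (con S y) (qm y z)) + 1 :=
  (fr_map_le _ (fun h => h0 (h ▸ hy))).trans (Nat.add_le_add_right (finrank_mono (Vz_con h0 hz hyz)) 1)

theorem f7_con [Finite V] {S : Finset V} {y : V} {P : Submodule (ZMod 2) V} (hP : IsF7 S P) (hy : y ∉ P) :
    IsF7 (con S y) (P.map (qm y)) := by
  refine ⟨by rw [fr_map_notMem hy, hP.1], ?_⟩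
  rintro _ ⟨v, hv, rfl⟩ h
  have hv0 : v ≠ 0 := fun e => h (by rw [e, map_zero])
  rw [qm_mem_con]
  exact ⟨hv0, fun e => hy (e ▸ hv), Or.inl (hP.2 v hv hv0)⟩

theorem exists_notMem {n : ℕ} {S : Finset V} (hc : Cfg n S) {K : Submodule (ZMod 2) V}
    (hK : finrank (ZMod 2) K < n) : ∃ s ∈ S, s ∉ K := by
  by_contra h
  push Not at h
  have h1 : span (ZMod 2) (S : Set V) ≤ K := span_le.2 h
  rw [hc.sp, top_le_iff] at h1
  rw [h1, finrank_top, hc.dim] at hK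
  omega

/-- at a point of a Fano plane, `E` is nonempty -/
theorem E_ne {n : ℕ} {S : Finset V} (hc : Cfg n S) {P : Submodule (ZMod 2) V} (hP : IsF7 S P) {p : V}
    (hp : p ∈ P) (hp0 : p ≠ 0) {h : V →ₗ[ZMod 2] ZMod 2} {B E : Finset V} {T : V → Finset V}
    (d : DS S p h B E T) : 1 ≤ E.card := by
  have := hc.fin
  rw [Nat.one_le_iff_ne_zero]
  intro h0
  rw [Finset.card_eq_zero] at h0
  have hB : B = Dh S p h := by rw [← d.BE, h0, Finset.union_empty]
  have hsub : ∀ v ∈ P, h v = 0 → v ≠ 0 → v ∈ B := by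
    intro v hv hv0 hvn
    rw [hB, mem_Dh]
    refine ⟨hP.2 v hv hvn, hP.2 _ (add_mem hv hp) ?_, hv0⟩
    intro e
    rw [ad_eq_zero] at e
    rw [e, d.hz] at hv0
    exact one_ne_zero hv0
  -- find two independent elements of ker h in P
  have hex : ∀ K : Submodule (ZMod 2) V, finrank (ZMod 2) K ≤ 2 → p ∈ K → ∃ a ∈ P, h a = 0 ∧ a ∉ K := by
    intro K hK hpK
    have : ¬ P ≤ K := by
      intro hle
      have := finrank_mono hle
      rw [hP.1] at this; omega
    obtain ⟨a, ha, haK⟩ := Set.not_subset.1 this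
    by_cases hh : h a = 0
    · exact ⟨a, ha, hh, haK⟩
    · refine ⟨a + p, add_mem ha hp, ?_, ?_⟩
      · rw [map_add, d.hz, z2ne _ hh]; rfl
      · intro h'
        exact haK ((add_mem_cancel_right hpK).1 h')
  have hr1 : finrank (ZMod 2) (span (ZMod 2) {p}) = 1 := finrank_span_singleton hp0
  obtain ⟨a, haP, ha, haK⟩ := hex (span (ZMod 2) {p}) (by omega) (mem_span_singleton_self p)
  obtain ⟨b, hbP, hb, hbK⟩ := hex (span (ZMod 2) {p} ⊔ span (ZMod 2) {a}) (by rw [finrank_sup_sp haK, hr1])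
    (mem_sup_left (mem_span_singleton_self p))
  rw [mem_sup_sp] at hbK
  push Not at hbK
  have ha0 : a ≠ 0 := fun e => haK (e ▸ zero_mem _)
  have hb0 : b ≠ 0 := fun e => hbK.1 (e ▸ zero_mem _)
  have hba : b ≠ a := fun e => hbK.2 (by rw [e, ads]; exact zero_mem _)
  have haB := hsub a haP ha ha0
  have hbB := hsub b hbP hb hb0
  have hcB := hsub (a + b) (add_mem haP hbP) (by rw [map_add, ha, hb, add_zero])
    (fun e => hba (ad_eq_zero.1 e).symm)
  have hli := d.li
  refine hli.notMem_span hcB ?_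
  rw [image_id, id]
  refine add_mem (subset_span ⟨haB, ?_⟩) (subset_span ⟨hbB, ?_⟩)
  · intro e; exact hb0 (by simpa using (show a = a + b from e))
  · intro e; exact ha0 (by simpa using (show b = a + b from e))

theorem E1F : ∀ (m : ℕ) {V : Type} [AddCommGroup V] [Module (ZMod 2) V] {S : Finset V}, Cfg (m + 6) S →
    (∀ z ∈ S, m + 5 ≤ finrank (ZMod 2) (Vz S z)) → ∀ {P : Submodule (ZMod 2) V}, IsF7 S P → False := by
  intro m
  induction m with
  | zero =>
    intro V _ _ S hc hV P hP
    have := hc.fin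
    have key : ∀ z ∈ S, ∃ h B E T, DS S z h B E T ∧ 4 ≤ B.card := by
      intro z hz
      obtain ⟨h, B, E, T, d⟩ := exists_DS hc hz
      refine ⟨h, B, E, T, d, ?_⟩
      have := d.rkV
      have := hV z hz
      omega
    have hL : ∀ z ∈ S, 8 ≤ (D2 S z).card := by
      intro z hz
      obtain ⟨h, B, E, T, d, h4⟩ := key z hz
      rw [d.cardD]; omega
    obtain ⟨h1, h2⟩ := coset_count (Or.inr rfl) hc hL hP
    have := h2 4 (by
      intro p hp h0
      obtain ⟨h, B, E, T, d, h4⟩ := key p (hP.2 p hp h0)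
      have := E_ne hc hP hp h0 d
      rw [d.cardD]; omega)
    norm_num at h1
    omega
  | succ m ih =>
    intro V _ _ S hc hV P hP
    have := hc.fin
    obtain ⟨y, hy, hyP⟩ := exists_notMem hc (K := P) (by rw [hP.1]; omega)
    refine ih (S := con S y) (Cfg.con (n := m + 6) (by convert hc using 1) hy) ?_ (f7_con hP hyP)
    intro q hq
    obtain ⟨h0, z, hz, rfl⟩ := mem_con.1 hq
    have hzy : z ≠ y := fun e => h0 (by rw [e, qm_self])
    have h1 := rkV_con hc.z hy hz hzy
    have h2 := hV z hz
    omega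

theorem sup_map (y : V) (P Q : Submodule (ZMod 2) V) :
    P.map (qm y) ⊔ Q.map (qm y) = (P ⊔ Q).map (qm y) := (Submodule.map_sup _ _ _).symm

/-- Contracting a point of the span of two Fano planes. -/
theorem link_aux {n : ℕ} {S : Finset V} (hc : Cfg (n + 1) S) {P Q : Submodule (ZMod 2) V} (hP : IsF7 S P)
    (hQ : IsF7 S Q) {z e g : V} (hPQ : finrank (ZMod 2) (P ⊔ Q : Submodule (ZMod 2) V) = 5)
    (hz : z ∈ P) (heP : e ∈ P)
    (hez : e ∉ span (ZMod 2) {z}) (hinf : P ⊓ Q = span (ZMod 2) {z})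
    (hg : g ∈ S) (hg' : g + e ∈ S) (hgP : g ∉ P) (hgPQ : g ∈ P ⊔ Q) : False := by
  have := hc.fin
  have main : ∀ g a b : V, g ∈ S → a ∈ P → b ∈ Q → a + b = g → a ∉ span (ZMod 2) {z} →
      b ∉ span (ZMod 2) {z} → False := by
    intro g a b hg ha hb hab ha' hb'
    have hgP : g ∉ P := by
      rw [← hab]
      intro h
      have hbP : b ∈ P := (add_mem_cancel_left ha).1 h
      exact hb' (hinf ▸ ⟨hbP, hb⟩)
    have hgQ : g ∉ Q := by
      rw [← hab]
      intro h
      have haQ : a ∈ Q := (add_mem_cancel_right hb).1 h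
      exact ha' (hinf ▸ ⟨ha, haQ⟩)
    have hc' := hc.con hg
    have hfin := hc'.fin
    refine two_planes hc'.sp hc'.ag (f7_con hP hgP) (f7_con hQ hgQ) ?_
    rw [sup_map]
    have h1 := fr_map_mem (y := g) (K := P ⊔ Q) (hab ▸ add_mem (mem_sup_left ha) (mem_sup_right hb))
      (fun h => hc.z (h ▸ hg))
    omega
  obtain ⟨a, ha, b, hb, hab⟩ := mem_sup.1 hgPQ
  have hb' : b ∉ span (ZMod 2) {z} := by
    intro h
    have hbP : b ∈ P := (span_singleton_le_iff_mem z P).2 hz h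
    exact hgP (hab ▸ add_mem ha hbP)
  by_cases ha' : a ∈ span (ZMod 2) {z}
  · refine main (g + e) (a + e) b hg' (add_mem ha heP) hb (by rw [← hab]; abel) ?_ hb'
    intro h
    exact hez ((add_mem_cancel_left ha').1 h)
  · exact main g a b hg ha hb hab ha' hb'

theorem inf_eq [Finite V] {P Q : Submodule (ZMod 2) V} {z : V} (hP : finrank (ZMod 2) P = 3) (hQ : finrank (ZMod 2) Q = 3)
    (hPQ : finrank (ZMod 2) (P ⊔ Q : Submodule (ZMod 2) V) = 5) (hz : z ∈ P) (hz' : z ∈ Q) (hz0 : z ≠ 0) :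
    P ⊓ Q = span (ZMod 2) {z} := by
  symm
  apply eq_of_le_of_finrank_eq
  · rw [span_singleton_le_iff_mem]; exact ⟨hz, hz'⟩
  · rw [finrank_span_singleton hz0]
    have := finrank_sup_add_finrank_inf_eq P Q
    omega

theorem link : ∀ (n : ℕ) {V : Type} [AddCommGroup V] [Module (ZMod 2) V] {S : Finset V}, Cfg n S →
    ∀ {P Q : Submodule (ZMod 2) V} {z e f u : V}, IsF7 S P → IsF7 S Q →
    finrank (ZMod 2) (P ⊔ Q : Submodule (ZMod 2) V) = 5 → z ∈ P → z ∈ Q → z ≠ 0 →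
    e ∈ P → e ∉ span (ZMod 2) {z} → f ∈ Q → f ∉ span (ZMod 2) {z} → u ∈ Vz S e → u ∈ Vz S f →
    u ∈ span (ZMod 2) {z} := by
  intro n
  induction n with
  | zero =>
    intro V _ _ S hc P Q z e f u hP hQ hPQ
    have := hc.fin
    have := finrank_le (P ⊔ Q)
    have := hc.dim
    omega
  | succ n ih =>
    intro V _ _ S hc
    have := hc.fin
    have step : ∀ {P Q : Submodule (ZMod 2) V} {z e f u : V}, IsF7 S P → IsF7 S Q →
      finrank (ZMod 2) (P ⊔ Q : Submodule (ZMod 2) V) = 5 → z ∈ P → z ∈ Q → z ≠ 0 →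
      e ∈ P → e ∉ span (ZMod 2) {z} → f ∈ Q → f ∉ span (ZMod 2) {z} → u ∈ Vz S e → u ∈ Vz S f →
      ¬ Vz S e ≤ P → u ∈ span (ZMod 2) {z} := by
      intro P Q z e f u hP hQ hPQ hzP hzQ hz0 heP hez hfQ hfz hue huf hnle
      have he0 : e ≠ 0 := fun h => hez (h ▸ zero_mem _)
      have hf0 : f ≠ 0 := fun h => hfz (h ▸ zero_mem _)
      have heS := hP.2 e heP he0
      have hfS := hQ.2 f hfQ hf0
      have hinf := inf_eq hP.1 hQ.1 hPQ hzP hzQ hz0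
      obtain ⟨g, hg, hgP⟩ : ∃ g ∈ D2 S e, g ∉ P := by
        by_contra hcon
        push Not at hcon
        apply hnle
        rw [Vz, span_le]
        rintro x (rfl | hx)
        · exact heP
        · exact hcon x hx
      rw [mem_D2] at hg
      by_cases hgPQ : g ∈ P ⊔ Q
      · exact (link_aux hc hP hQ hPQ hzP heP hez hinf hg.1 hg.2 hgP hgPQ).elim
      by_contra huz
      have main : ∀ g ∈ S, g ∉ P ⊔ Q → u + g ∈ span (ZMod 2) {z} := by
        intro g hg hgPQ
        have hgP : g ∉ P := fun h => hgPQ (mem_sup_left h)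
        have hgQ : g ∉ Q := fun h => hgPQ (mem_sup_right h)
        have hinj : ∀ v, v ∈ P ⊔ Q → (qm g) v ∈ span (ZMod 2) {(qm g) z} → v ∈ span (ZMod 2) {z} := by
          intro v hv h
          rw [mem_sp, qm_zero, qm_eq] at h
          rw [mem_sp]
          rcases h with (h | h) | (h | h)
          · exact Or.inl h
          · exact absurd (h ▸ hv) hgPQ
          · exact Or.inr h
          · exfalso; apply hgPQ
            rw [h] at hv
            exact (add_mem_cancel_left (mem_sup_left hzP)).1 hv
        have h1 := ih (S := con S g) (hc.con hg) (z := qm g z) (e := qm g e) (f := qm g f) (u := qm g u) (f7_con hP hgP) (f7_con hQ hgQ)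
          (by rw [sup_map, fr_map_notMem hgPQ, hPQ]) (mem_map_of_mem hzP) (mem_map_of_mem hzQ)
          (by rw [Ne, qm_zero]; rintro (h | h)
              · exact hz0 h
              · exact hgP (h ▸ hzP))
          (mem_map_of_mem heP) (fun h => hez (hinj e (mem_sup_left heP) h))
          (mem_map_of_mem hfQ) (fun h => hfz (hinj f (mem_sup_right hfQ) h))
          (Vz_con hc.z heS (y := g) (fun h => hgP (h ▸ heP)) (mem_map_of_mem hue))
          (Vz_con hc.z hfS (y := g) (fun h => hgQ (h ▸ hfQ)) (mem_map_of_mem huf))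
        rw [mem_sp, qm_zero, qm_eq] at h1
        rcases h1 with (h | h) | (h | h)
        · exact absurd (h ▸ zero_mem _) huz
        · rw [h, ads]; exact zero_mem _
        · exact absurd (h ▸ mem_span_singleton_self _) huz
        · rw [h, adc']; exact mem_span_singleton_self _
      have h1 := main g hg.1 hgPQ
      have h2 := main (g + e) hg.2 (fun h => hgPQ ((add_mem_cancel_right (mem_sup_left heP)).1 h))
      apply hez
      rw [← add_assoc] at h2
      exact (add_mem_cancel_left h1).1 h2
    intro P Q z e f u hP hQ hPQ hzP hzQ hz0 heP hez hfQ hfz hue huf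
    by_cases h1 : Vz S e ≤ P
    · by_cases h2 : Vz S f ≤ Q
      · rw [← inf_eq hP.1 hQ.1 hPQ hzP hzQ hz0]
        exact ⟨h1 hue, h2 huf⟩
      · exact step hQ hP (by rw [sup_comm]; exact hPQ) hzQ hzP hz0 hfQ hfz heP hez huf hue h2
    · exact step hP hQ hPQ hzP hzQ hz0 heP hez hfQ hfz hue huf h1

end ce
end ML

namespace ML

set_option linter.unusedSectionVars false
open Module Submodule

section cf
variable {V : Type} [AddCommGroup V] [Module (ZMod 2) V]
open scoped Classical

theorem dimV {r : ℕ} {S : Finset V} (hr : 2 ≤ r) (hc : Cfg r S) (hL : ∀ z ∈ S, 2 * (r - 1) ≤ (D2 S z).card) :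
    ∀ z ∈ S, r - 1 ≤ finrank (ZMod 2) (Vz S z) := by
  have := hc.fin
  intro z hz
  by_contra hcon
  push Not at hcon
  obtain ⟨h, B, E, T, d⟩ := exists_DS hc hz
  have h1 := d.rkV
  have h2 := hL z hz
  rw [d.cardD] at h2
  have hE : 1 < E.card := by omega
  obtain ⟨e1, he1, e2, he2, hne⟩ := Finset.one_lt_card.1 hE
  obtain ⟨a, ha, a', ha', haa, hT1, hea⟩ := pairT d he1
  obtain ⟨b, hb, b', hb', hbb, hT2, heb⟩ := pairT d he2
  have hdis := d.T4 e1 he1 e2 he2 hne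
  rw [hT1, hT2] at hdis
  simp only [Finset.disjoint_insert_left, Finset.disjoint_singleton_left, Finset.mem_insert,
    Finset.mem_singleton, not_or] at hdis
  obtain ⟨⟨hab, hab'⟩, ha'b, ha'b'⟩ := hdis
  have hP := d.f7 hc.z hz ha ha' (hea ▸ he1)
  have hQ := d.f7 hc.z hz hb hb' (heb ▸ he2)
  set P := span (ZMod 2) {z, a, a'}
  set Q := span (ZMod 2) {z, b, b'}
  have hz0 : z ≠ 0 := fun e => hc.z (e ▸ hz)
  have hPQ : finrank (ZMod 2) (P ⊔ Q : Submodule (ZMod 2) V) = 5 := by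
    set F : Finset V := {a, a', b, b'} with hF
    have hFB : (F : Set V) ⊆ B := by
      intro x hx
      simp only [hF, Finset.coe_insert, Finset.coe_singleton, mem_insert_iff, mem_singleton_iff] at hx
      rcases hx with rfl | rfl | rfl | rfl <;> assumption
    have hFc : F.card = 4 := by
      rw [hF]
      rw [Finset.card_insert_of_notMem (by simp [haa, hab, hab']), Finset.card_insert_of_notMem (by simp [ha'b, ha'b']),
        Finset.card_insert_of_notMem (by simp [hbb]), Finset.card_singleton]
    have e : P ⊔ Q = span (ZMod 2) (F : Set V) ⊔ span (ZMod 2) {z} := by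
      rw [← span_union, ← span_union]
      congr 1
      ext x
      simp [hF]
      tauto
    have hzF : z ∉ span (ZMod 2) (F : Set V) := fun hh => d.zB (span_mono hFB hh)
    rw [e, finrank_sup_sp hzF]
    have hli : LinearIndepOn (ZMod 2) id (F : Set V) := d.li.mono hFB
    have := finrank_span_finset_eq_card hli
    omega
  have hnz : ∀ x ∈ B, x ∉ span (ZMod 2) {z} := by
    intro x hx hxz
    rw [mem_sp] at hxz
    rcases hxz with e | e
    · exact hc.z (e ▸ (d.memB hx).1)
    · exact d.zB (subset_span (e ▸ hx))
  have hle : Vz S a ⊓ Vz S b ≤ span (ZMod 2) {z} := by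
    rintro u ⟨hu1, hu2⟩
    exact link r hc hP hQ hPQ (subset_span (by simp)) (subset_span (by simp)) hz0 (subset_span (by simp)) (hnz a ha)
      (subset_span (by simp)) (hnz b hb) hu1 hu2
  have hle' := finrank_mono hle
  rw [finrank_span_singleton hz0] at hle'
  have hdim : ∀ x ∈ S, 2 * (r - 1) + 3 ≤ 3 * finrank (ZMod 2) (Vz S x) := by
    intro x hx
    obtain ⟨h, B, E, T, d⟩ := exists_DS hc hx
    have h1 := d.rkV
    have h2 := hL x hx
    rw [d.cardD] at h2
    have h3 := d.cardE
    omega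
  have h4 := hdim a (d.memB ha).1
  have h5 := hdim b (d.memB hb).1
  have h6 := finrank_sup_add_finrank_inf_eq (Vz S a) (Vz S b)
  have h7 := finrank_le (Vz S a ⊔ Vz S b)
  rw [hc.dim] at h7
  omega

theorem top_con {S : Finset V} (h0 : (0 : V) ∉ S) (hV : ∀ z ∈ S, Vz S z = ⊤) {y : V} :
    ∀ q ∈ con S y, Vz (con S y) q = ⊤ := by
  intro q hq
  obtain ⟨hq0, z, hz, rfl⟩ := mem_con.1 hq
  have hzy : z ≠ y := fun e => hq0 (by rw [e, qm_self])
  have := Vz_con h0 hz hzy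
  rw [hV z hz, Submodule.map_top, range_mkQ, top_le_iff] at this
  exact this

theorem top_card : ∀ (n : ℕ) {V : Type} [AddCommGroup V] [Module (ZMod 2) V] {S : Finset V}, Cfg n S →
    (∀ z ∈ S, Vz S z = ⊤) → (n + 1).choose 2 ≤ S.card := by
  intro n
  induction n with
  | zero => intros; simp
  | succ n ih =>
    intro V _ _ S hc hV
    have := hc.fin
    obtain ⟨y, hy, -⟩ := exists_notMem hc (K := ⊥) (by rw [finrank_bot]; omega)
    have h1 := ih (hc.con hy) (top_con hc.z hV)
    have h2 := con_card hy hc.z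
    obtain ⟨h, B, E, T, d⟩ := exists_DS hc hy
    have h3 := d.rkV
    rw [hV y hy, finrank_top, hc.dim] at h3
    have h4 := d.cardD
    have h5 : (n + 1 + 1).choose 2 = (n + 1) + (n + 1).choose 2 := by
      rw [Nat.choose_succ_succ' (n + 1) 1, Nat.choose_one_right]
    omega

end cf
end ML

namespace ML

set_option linter.unusedSectionVars false
open Module Submodule

section cg
variable {V : Type} [AddCommGroup V] [Module (ZMod 2) V]
open scoped Classical

def supp {ι : Type} [Fintype ι] (g : ι → V →ₗ[ZMod 2] ZMod 2) (v : V) : Finset ι :=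
  Finset.univ.filter (fun i => g i v = 1)

theorem mem_supp {ι : Type} [Fintype ι] {g : ι → V →ₗ[ZMod 2] ZMod 2} {v : V} {i : ι} :
    i ∈ supp g v ↔ g i v = 1 := by simp [supp]

theorem supp_add {ι : Type} [Fintype ι] (g : ι → V →ₗ[ZMod 2] ZMod 2) (u v : V) :
    supp g (u + v) = symmDiff (supp g u) (supp g v) := by
  ext i
  rw [Finset.mem_symmDiff, mem_supp, mem_supp, mem_supp, map_add]
  generalize g i u = x
  generalize g i v = y
  revert x y
  decide

theorem supp_ext {ι : Type} [Fintype ι] {g : ι → V →ₗ[ZMod 2] ZMod 2} {u v : V}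
    (h : supp g u = supp g v) (i : ι) : g i u = g i v := by
  have : i ∈ supp g u ↔ i ∈ supp g v := by rw [h]
  rw [mem_supp, mem_supp] at this
  revert this
  generalize g i u = x
  generalize g i v = y
  revert x y
  decide

theorem card_sd {ι : Type} (A B : Finset ι) : (symmDiff A B).card + 2 * (A ∩ B).card = A.card + B.card := by
  have h1 : symmDiff A B = (A \ B) ∪ (B \ A) := rfl
  have hd : Disjoint (A \ B) (B \ A) := by
    rw [Finset.disjoint_left]; intro x hx hx'
    simp only [Finset.mem_sdiff] at hx hx'
    exact hx.2 hx'.1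
  rw [h1, Finset.card_union_of_disjoint hd]
  have h2 := Finset.card_sdiff_add_card_inter A B
  have h3 := Finset.card_sdiff_add_card_inter B A
  rw [Finset.inter_comm B A] at h3
  omega

structure Lift {ι : Type} [Fintype ι] (S : Finset V) (x : V) (g : ι → V →ₗ[ZMod 2] ZMod 2) : Prop where
  card : Fintype.card ι = finrank (ZMod 2) V
  ker : ∀ v, (∀ i, g i v = 0) → v = 0 ∨ v = x
  gx : ∀ i, g i x = 0
  two : ∀ s ∈ S, s ≠ x → (supp g s).card = 2

theorem exists_lift [Finite V] {S : Finset V} (h0 : (0 : V) ∉ S) {x : V} (hx : x ∈ S) (hG : Graphic (con S x)) :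
    ∃ (ι : Type) (_ : Fintype ι) (g : ι → V →ₗ[ZMod 2] ZMod 2), Lift S x g := by
  obtain ⟨ι, _, g, h1, h2, h3⟩ := hG
  refine ⟨ι, inferInstance, fun i => (g i).comp (qm x), ?_, ?_, ?_, ?_⟩
  · rw [h1, finrank_qm (fun e => h0 (e ▸ hx))]
  · intro v hv
    exact qm_zero.1 (h2 _ hv)
  · intro i
    rw [LinearMap.comp_apply, qm_self, map_zero]
  · intro s hs hsx
    exact h3 (qm x s) (qm_mem_con.2 ⟨fun e => h0 (e ▸ hs), hsx, Or.inl hs⟩)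

theorem Lift.inj {ι : Type} [Fintype ι] {S : Finset V} {x : V} {g : ι → V →ₗ[ZMod 2] ZMod 2} (l : Lift S x g)
    {h : V →ₗ[ZMod 2] ZMod 2} (hx : h x = 1) {v : V} (hv : h v = 0) (hg : ∀ i, g i v = 0) : v = 0 := by
  rcases l.ker v hg with h | h
  · exact h
  · rw [h, hx] at hv; exact absurd hv one_ne_zero

theorem con_ge [Finite V] {S : Finset V} (h0 : (0 : V) ∉ S) {p : V} (h : V →ₗ[ZMod 2] ZMod 2)
    (hp1 : h p = 1) : (S.filter (fun s => h s = 0)).card +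
      (S.filter (fun s => h s = 1 ∧ s ≠ p ∧ s + p ∉ S)).card ≤ (con S p).card := by
  rw [← Finset.card_union_of_disjoint]
  · apply Finset.card_le_card_of_injOn (qm p)
    · intro s hs
      simp only [Finset.coe_union, Finset.coe_filter, mem_union, Set.mem_ofPred_eq] at hs
      rw [Finset.mem_coe, qm_mem_con]
      rcases hs with hs | hs
      · exact ⟨fun e => h0 (e ▸ hs.1), fun e => by rw [e, hp1] at hs; exact one_ne_zero hs.2, Or.inl hs.1⟩
      · exact ⟨fun e => h0 (e ▸ hs.1), hs.2.2.1, Or.inl hs.1⟩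
    · intro s hs t ht hst
      simp only [Finset.coe_union, Finset.coe_filter, mem_union, Set.mem_ofPred_eq] at hs ht
      rcases qm_eq.1 hst with e | e
      · exact e
      · exfalso
        have e' : s + p = t := by rw [e, adc']
        have hh := congrArg h e
        rw [map_add, hp1] at hh
        rcases hs with hs | hs <;> rcases ht with ht | ht
        · rw [hs.2, ht.2] at hh; exact absurd hh (by decide)
        · exact ht.2.2.2 (e ▸ hs.1)
        · exact hs.2.2.2 (e' ▸ ht.1)
        · rw [hs.2.1, ht.2.1] at hh; exact absurd hh (by decide)
  · rw [Finset.disjoint_left]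
    intro s hs hs'
    simp only [Finset.mem_filter] at hs hs'
    rw [hs.2] at hs'
    exact zero_ne_one hs'.2.1

theorem nogood {n : ℕ} (hn : 6 ≤ n) {S : Finset V} (hc : Cfg (n + 1) S) (h : V →ₗ[ZMod 2] ZMod 2)
    (hH : (S.filter (fun s => h s = 0)).card ≤ n.choose 2 + 4)
    (hX : n + 1 ≤ (S.filter (fun s => h s = 1)).card)
    (hs : ∀ s ∈ S, ∀ t ∈ S, h s = 1 → h t = 1 → s ≠ t → s + t ∈ S) : False := by
  have := hc.fin
  set X := S.filter (fun s => h s = 1) with hXd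
  have hXS : ∀ s, s ∈ X ↔ s ∈ S ∧ h s = 1 := fun s => by rw [hXd, Finset.mem_filter]
  have hs' : ∀ s ∈ X, ∀ t ∈ X, s ≠ t → s + t ∈ S := fun s h1 t h2 hne =>
    hs s ((hXS s).1 h1).1 t ((hXS t).1 h2).1 ((hXS s).1 h1).2 ((hXS t).1 h2).2 hne
  -- all four-term relations are impossible
  have h4 : ∀ a ∈ X, ∀ b ∈ X, ∀ c ∈ X, a ≠ b → a ≠ c → b ≠ c → a + b + c ∉ X := by
    intro a ha b hb c hc' hab hac hbc hd
    have hP : IsF7 S (span (ZMod 2) {a, b, c}) := f7_of' hc.z ((hXS a).1 ha).1 ((hXS b).1 hb).1 ((hXS c).1 hc').1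
      (hs' _ ha _ hb hab) (hs' _ ha _ hc' hac) (hs' _ hb _ hc' hbc) ((hXS _).1 hd).1
    have hmemP : ∀ v ∈ span (ZMod 2) {a, b, c}, v = 0 ∨ v = a ∨ v = b ∨ v = c ∨ v = a + b ∨ v = a + c ∨
        v = b + c ∨ v = a + b + c := by
      intro v hv
      rw [mem_span_triple] at hv
      obtain ⟨x, y, z, rfl⟩ := hv
      rcases z2 x with rfl | rfl <;> rcases z2 y with rfl | rfl <;> rcases z2 z with rfl | rfl <;> simp
    obtain ⟨p, hp⟩ : ∃ p, p ∈ X \ {a, b, c, a + b + c} := by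
      apply Finset.card_pos.1
      have := Finset.le_card_sdiff {a, b, c, a + b + c} X
      have h5 : ({a, b, c, a + b + c} : Finset V).card ≤ 4 := Finset.card_le_four
      omega
    simp only [Finset.mem_sdiff, Finset.mem_insert, Finset.mem_singleton, not_or] at hp
    obtain ⟨hpX, hpa, hpb, hpc, hpd⟩ := hp
    have hh := ((hXS p).1 hpX).2
    have hA := ((hXS a).1 ha).2
    have hB := ((hXS b).1 hb).2
    have hC := ((hXS c).1 hc').2
    have hpP : p ∉ span (ZMod 2) {a, b, c} := by
      intro hcon
      rcases hmemP p hcon with e | e | e | e | e | e | e | e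
      · rw [e, map_zero] at hh; exact zero_ne_one hh
      · exact hpa e
      · exact hpb e
      · exact hpc e
      · rw [e, map_add, hA, hB] at hh; exact absurd hh (by decide)
      · rw [e, map_add, hA, hC] at hh; exact absurd hh (by decide)
      · rw [e, map_add, hB, hC] at hh; exact absurd hh (by decide)
      · exact hpd e
    refine kill2 hc.sp hc.ag (span (ZMod 2) {a, b, c} ⊔ span (ZMod 2) {p})
      (by rw [finrank_sup_sp hpP, hP.1]) {p + (a + b), p + (a + c), p + (b + c)} Finset.card_le_three ?_
    intro u hu hu0
    rcases mem_sup_sp.1 hu with hu | hu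
    · exact Or.inl (hP.2 u hu hu0)
    · have e : u = p + (u + p) := by rw [add_comm u p, adc]
      rw [e]
      rcases hmemP _ hu with e | e | e | e | e | e | e | e <;> rw [e]
      · left; rw [add_zero]; exact ((hXS p).1 hpX).1
      · left; exact hs' _ hpX _ ha hpa
      · left; exact hs' _ hpX _ hb hpb
      · left; exact hs' _ hpX _ hc' hpc
      · right; simp
      · right; simp
      · right; simp
      · left; exact hs' _ hpX _ hd hpd
  -- injectivity of sums
  have hcard : (X.powersetCard 2).card ≤ (S.filter (fun s => h s = 0)).card := by
    apply Finset.card_le_card_of_injOn (fun A => ∑ s ∈ A, s)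
    · intro A hA
      rw [Finset.mem_coe, Finset.mem_powersetCard] at hA
      obtain ⟨a, b, hab, rfl⟩ := Finset.card_eq_two.1 hA.2
      have ha := hA.1 (Finset.mem_insert_self a _)
      have hb := hA.1 (Finset.mem_insert_of_mem (Finset.mem_singleton_self b))
      simp only [Finset.sum_pair hab]
      rw [Finset.mem_coe, Finset.mem_filter, map_add, ((hXS a).1 ha).2, ((hXS b).1 hb).2]
      exact ⟨hs' a ha b hb hab, by decide⟩
    · intro A hA A' hA' he
      rw [Finset.mem_coe, Finset.mem_powersetCard] at hA hA'
      obtain ⟨a, b, hab, rfl⟩ := Finset.card_eq_two.1 hA.2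
      obtain ⟨c, d, hcd, rfl⟩ := Finset.card_eq_two.1 hA'.2
      have ha := hA.1 (Finset.mem_insert_self a _)
      have hb := hA.1 (Finset.mem_insert_of_mem (Finset.mem_singleton_self b))
      have hc := hA'.1 (Finset.mem_insert_self c _)
      have hd := hA'.1 (Finset.mem_insert_of_mem (Finset.mem_singleton_self d))
      simp only [Finset.sum_pair hab, Finset.sum_pair hcd] at he
      by_cases h1 : a = c
      · subst h1; rw [add_left_cancel he]
      by_cases h2 : b = c
      · subst h2
        rw [add_comm a b] at he
        rw [add_left_cancel he, Finset.pair_comm]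
      · exfalso
        refine h4 a ha b hb c hc hab h1 h2 ?_
        rw [he, add_comm c d, adc']; exact hd
  rw [Finset.card_powersetCard] at hcard
  have h6 : (n + 1).choose 2 ≤ X.card.choose 2 := Nat.choose_le_choose 2 hX
  have h7 : (n + 1).choose 2 = n + n.choose 2 := by rw [Nat.choose_succ_succ' n 1, Nat.choose_one_right]
  omega

theorem finish [Finite V] {ι : Type} [Fintype ι] {S : Finset V} {p : V} {g : ι → V →ₗ[ZMod 2] ZMod 2}
    (l : Lift S p g) (h : V →ₗ[ZMod 2] ZMod 2) (hp : h p = 1) (c : ι)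
    (hcc : ∀ s ∈ S, h s = 1 → s ≠ p → g c s = 1) : Graphic S := by
  refine ⟨Option ι, inferInstance, fun o => o.elim h (fun i => if i = c then g i + h else g i), ?_, ?_, ?_⟩
  · rw [Fintype.card_option, l.card]
  · intro v hv
    have hv0 : h v = 0 := hv none
    refine l.inj hp hv0 fun i => ?_
    have := hv (some i)
    simp only [Option.elim_some] at this
    split_ifs at this with hi
    · rwa [LinearMap.add_apply, hv0, add_zero] at this
    · exact this
  · intro s hs
    by_cases hsp : s = p
    · subst hsp
      have : (Finset.univ.filter (fun o : Option ι => (o.elim h (fun i => if i = c then g i + h else g i) : V →ₗ[ZMod 2] ZMod 2) s = 1))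
          = {none, some c} := by
        ext o
        rcases o with _ | i
        · simp [hp]
        · by_cases hi : i = c
          · simp [hi, l.gx, hp]
          · simp [hi, l.gx]
      rw [this, Finset.card_pair (by simp)]
    rcases z2 (h s) with h0 | h1
    · have : (Finset.univ.filter (fun o : Option ι => (o.elim h (fun i => if i = c then g i + h else g i) : V →ₗ[ZMod 2] ZMod 2) s = 1))
          = (supp g s).map Function.Embedding.some := by
        ext o
        rcases o with _ | i
        · simp [h0]
        · by_cases hi : i = c
          · simp [hi, h0, mem_supp]
          · simp [hi, mem_supp]
      rw [this, Finset.card_map, l.two s hs hsp]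
    · have hc1 := hcc s hs h1 hsp
      have : (Finset.univ.filter (fun o : Option ι => (o.elim h (fun i => if i = c then g i + h else g i) : V →ₗ[ZMod 2] ZMod 2) s = 1))
          = insert none (((supp g s).erase c).map Function.Embedding.some) := by
        ext o
        rcases o with _ | i
        · simp [h1]
        · by_cases hi : i = c
          · simp [hi, h1, hc1]
          · simp [hi, mem_supp]
      rw [this, Finset.card_insert_of_notMem (by simp), Finset.card_map,
        Finset.card_erase_of_mem (mem_supp.2 hc1), l.two s hs hsp]

theorem common {ι : Type} (A : Finset (Finset ι)) (h2 : ∀ a ∈ A, a.card = 2)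
    (hi : ∀ a ∈ A, ∀ b ∈ A, a ≠ b → ¬ Disjoint a b) (h4 : 4 ≤ A.card) : ∃ c, ∀ a ∈ A, c ∈ a := by
  by_contra hcon
  push Not at hcon
  obtain ⟨Z, hZ⟩ : A.Nonempty := Finset.card_pos.1 (by omega)
  obtain ⟨a, b, hab, rfl⟩ := Finset.card_eq_two.1 (h2 Z hZ)
  have hx : ∀ B ∈ A, ∀ C ∈ A, ∃ x ∈ B, x ∈ C := by
    intro B hB C hC
    by_cases e : B = C
    · subst e
      obtain ⟨x, hx⟩ : B.Nonempty := Finset.card_pos.1 (by rw [h2 B hB]; omega)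
      exact ⟨x, hx, hx⟩
    · exact Finset.not_disjoint_iff.1 (hi B hB C hC e)
  have htwo : ∀ B ∈ A, ∀ x ∈ B, ∃ y, y ≠ x ∧ B = {x, y} := by
    intro B hB x hxB
    obtain ⟨u, v, huv, rfl⟩ := Finset.card_eq_two.1 (h2 B hB)
    rcases Finset.mem_insert.1 hxB with rfl | h
    · exact ⟨v, huv.symm, rfl⟩
    · rw [Finset.mem_singleton] at h; subst h
      exact ⟨u, huv, Finset.pair_comm _ _⟩
  obtain ⟨B, hB, haB⟩ := hcon a
  obtain ⟨C, hC, hbC⟩ := hcon b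
  have hbB : b ∈ B := by
    obtain ⟨x, hx1, hx2⟩ := hx _ hZ B hB
    simp only [Finset.mem_insert, Finset.mem_singleton] at hx1
    rcases hx1 with rfl | rfl
    · exact absurd hx2 haB
    · exact hx2
  have haC : a ∈ C := by
    obtain ⟨x, hx1, hx2⟩ := hx _ hZ C hC
    simp only [Finset.mem_insert, Finset.mem_singleton] at hx1
    rcases hx1 with rfl | rfl
    · exact hx2
    · exact absurd hx2 hbC
  obtain ⟨c, hcb, rfl⟩ := htwo B hB b hbB
  obtain ⟨d, hda, rfl⟩ := htwo C hC a haC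
  have hcd : c = d := by
    obtain ⟨x, hx1, hx2⟩ := hx _ hB _ hC
    simp only [Finset.mem_insert, Finset.mem_singleton, not_or] at hx1 hx2 haB hbC
    rcases hx1 with rfl | rfl
    · rcases hx2 with rfl | rfl
      · exact absurd rfl hab
      · exact absurd rfl hbC.2
    · rcases hx2 with rfl | rfl
      · exact absurd rfl haB.2
      · rfl
  subst hcd
  have hsub : A ⊆ {{a, b}, {b, c}, {a, c}} := by
    intro D hD
    obtain ⟨x, hx1, hx2⟩ := hx _ hZ D hD
    obtain ⟨y, hy1, hy2⟩ := hx _ hB D hD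
    obtain ⟨z, hz1, hz2⟩ := hx _ hC D hD
    simp only [Finset.mem_insert, Finset.mem_singleton] at hx1 hy1 hz1 ⊢
    have hp : ∀ u v, u ≠ v → u ∈ D → v ∈ D → D = {u, v} := by
      intro u v huv hu hv
      symm
      apply Finset.eq_of_subset_of_card_le
      · intro t ht
        simp only [Finset.mem_insert, Finset.mem_singleton] at ht
        rcases ht with rfl | rfl <;> assumption
      · rw [h2 D hD, Finset.card_pair huv]
    rcases hx1 with rfl | rfl
    · rcases hy1 with rfl | rfl
      · left; exact hp _ _ hab hx2 hy2
      · right; right; exact hp _ _ hda.symm hx2 hy2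
    · rcases hz1 with rfl | rfl
      · left; exact hp _ _ hab hz2 hx2
      · right; left; exact hp _ _ hcb.symm hx2 hz2
  have := (Finset.card_le_card hsub).trans Finset.card_le_three
  omega

end cg
end ML

namespace ML

set_option linter.unusedSectionVars false
open Module Submodule

section ch
variable {V : Type} [AddCommGroup V] [Module (ZMod 2) V]
open scoped Classical

theorem seven {ι : Type} [Fintype ι] (g : ι → V →ₗ[ZMod 2] ZMod 2) (a b c : V)
    (h1 : (supp g a).card = 2) (h2 : (supp g b).card = 2) (h3 : (supp g c).card = 2)
    (h4 : (supp g (a + b)).card = 2) (h5 : (supp g (a + c)).card = 2) (h6 : (supp g (b + c)).card = 2)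
    (h7 : (supp g (a + b + c)).card = 2) : False := by
  have hs : ∀ v, (supp g v).card = ∑ i, if g i v = 1 then 1 else 0 := by
    intro v; rw [supp, Finset.card_filter]
  have h : 4 ∣ ∑ i, ((if g i a = 1 then 1 else 0) + (if g i b = 1 then 1 else 0) + (if g i c = 1 then 1 else 0)
    + (if g i (a + b) = 1 then 1 else 0) + (if g i (a + c) = 1 then 1 else 0)
    + (if g i (b + c) = 1 then 1 else 0) + (if g i (a + b + c) = 1 then 1 else 0)) := by
    apply Finset.dvd_sum
    intro i _
    simp only [map_add]
    generalize g i a = x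
    generalize g i b = y
    generalize g i c = z
    revert x y z
    decide
  simp only [Finset.sum_add_distrib, ← hs, h1, h2, h3, h4, h5, h6, h7] at h
  norm_num at h

theorem pairlem {ι : Type} {Y D : Finset ι} {a : ι}
    (ha : a ∈ D) (haY : a ∉ Y) (hY : Y.card = 4) (hYD : (symmDiff Y D).card = 2)
    (hp : ∀ u ∈ Y, (symmDiff {a, u} D).card = 2) : False := by
  have h1 := card_sd Y D
  have h2 : (Y ∩ D).card + 1 ≤ D.card := by
    rw [← Finset.card_erase_add_one ha]
    apply Nat.add_le_add_right
    apply Finset.card_le_card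
    intro u hu
    rw [Finset.mem_inter] at hu
    exact Finset.mem_erase.2 ⟨fun e => haY (e ▸ hu.1), hu.2⟩
  have h3 : ∀ u ∈ Y, D.card = 2 * (({a, u} : Finset ι) ∩ D).card := by
    intro u hu
    have h := card_sd {a, u} D
    rw [hp u hu, Finset.card_pair (show a ≠ u from fun e => haY (e ▸ hu))] at h
    omega
  have h5 : ∀ u ∈ Y, u ∈ D := by
    intro u hu
    by_contra hn
    have e : ({a, u} : Finset ι) ∩ D = {a} := by
      ext t
      simp only [Finset.mem_inter, Finset.mem_insert, Finset.mem_singleton]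
      constructor
      · rintro ⟨rfl | rfl, ht⟩
        · rfl
        · exact absurd ht hn
      · rintro rfl; exact ⟨Or.inl rfl, ha⟩
    have := h3 u hu
    rw [e, Finset.card_singleton] at this
    omega
  have h6 : Y ∩ D = Y := Finset.inter_eq_left.2 h5
  obtain ⟨u, hu⟩ : Y.Nonempty := Finset.card_pos.1 (by omega)
  have h7 := h3 u hu
  have h8 : (({a, u} : Finset ι) ∩ D).card ≤ 2 :=
    (Finset.card_le_card Finset.inter_subset_left).trans Finset.card_le_two
  rw [h6] at h1 h2
  omega

/-- vector representing the edge `ij` -/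
def Edge {ι : Type} [Fintype ι] (g : ι → V →ₗ[ZMod 2] ZMod 2) (i j : ι) (t : V) : Prop :=
  ∀ k, g k t = (if k = i then 1 else 0) + (if k = j then 1 else 0)

theorem edge_of_supp {ι : Type} [Fintype ι] {g : ι → V →ₗ[ZMod 2] ZMod 2} {i j : ι} (hij : i ≠ j) {t : V}
    (h : supp g t = {i, j}) : Edge g i j t := by
  intro k
  have : k ∈ supp g t ↔ k ∈ ({i, j} : Finset ι) := by rw [h]
  rw [mem_supp] at this
  by_cases h1 : k = i
  · have h2 : k ≠ j := fun e => hij (h1 ▸ e)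
    simp only [h1, Finset.mem_insert, true_or, iff_true] at this
    simp [h1, hij, this]
  · by_cases h2 : k = j
    · simp only [h2, Finset.mem_insert, Finset.mem_singleton, or_true, iff_true] at this
      simp [h2, hij.symm, this]
    · simp only [Finset.mem_insert, Finset.mem_singleton, h1, h2, or_self, iff_false] at this
      simp only [h1, h2, if_false, add_zero]
      exact (z2 _).resolve_right this

theorem twoW {ι κ : Type} [Fintype ι] [Fintype κ] (F : Finset V) (h : V →ₗ[ZMod 2] ZMod 2)
    (hF : ∀ t ∈ F, h t = 0) (g : ι → V →ₗ[ZMod 2] ZMod 2) (g' : κ → V →ₗ[ZMod 2] ZMod 2)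
    (gi : ∀ v, h v = 0 → (∀ i, g i v = 0) → v = 0) (gi' : ∀ v, h v = 0 → (∀ i, g' i v = 0) → v = 0)
    (g2' : ∀ t ∈ F, (supp g' t).card = 2) {v0 : V} (hv0 : h v0 = 0)
    (h4 : (supp g v0).card = 4) (h2 : (supp g' v0).card = 2) {w w' : ι} (hw : w ∉ supp g v0)
    (hw' : w' ∉ supp g v0) (hww : w ≠ w') (hE : ∀ j ∈ supp g v0, ∃ t ∈ F, Edge g j w t)
    (hE' : ∀ j ∈ supp g v0, ∃ t ∈ F, Edge g j w' t) : False := by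
  set Q := supp g v0 with hQ
  have hE1 : ∀ j, ∃ t, j ∈ Q → t ∈ F ∧ Edge g j w t := fun j => by
    by_cases hj : j ∈ Q
    · obtain ⟨t, ht⟩ := hE j hj; exact ⟨t, fun _ => ht⟩
    · exact ⟨0, fun h => absurd h hj⟩
  have hE1' : ∀ j, ∃ t, j ∈ Q → t ∈ F ∧ Edge g j w' t := fun j => by
    by_cases hj : j ∈ Q
    · obtain ⟨t, ht⟩ := hE' j hj; exact ⟨t, fun _ => ht⟩
    · exact ⟨0, fun h => absurd h hj⟩
  choose e he using hE1
  choose e' he' using hE1'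
  have geq : ∀ u v, h u = 0 → h v = 0 → (∀ i, g i u = g i v) → u = v := by
    intro u v hu hv huv
    exact ad_eq_zero.1 (gi (u + v) (by rw [map_add, hu, hv, add_zero]) (fun i => by rw [map_add, huv, ads]))
  have geq' : ∀ u v, h u = 0 → h v = 0 → (∀ i, g' i u = g' i v) → u = v := by
    intro u v hu hv huv
    exact ad_eq_zero.1 (gi' (u + v) (by rw [map_add, hu, hv, add_zero]) (fun i => by rw [map_add, huv, ads]))
  obtain ⟨j0, hj0⟩ : Q.Nonempty := Finset.card_pos.1 (by omega)
  set d := e j0 + e' j0 with hd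
  have hh : ∀ j ∈ Q, h (e j) = 0 := fun j hj => hF _ (he j hj).1
  have hh' : ∀ j ∈ Q, h (e' j) = 0 := fun j hj => hF _ (he' j hj).1
  have hd0 : h d = 0 := by rw [hd, map_add, hh j0 hj0, hh' j0 hj0, add_zero]
  have hgd : ∀ k, g k d = (if k = w then 1 else 0) + (if k = w' then 1 else 0) := by
    intro k
    rw [hd, map_add, (he j0 hj0).2 k, (he' j0 hj0).2 k]
    generalize (if k = j0 then (1 : ZMod 2) else 0) = x
    generalize (if k = w then (1 : ZMod 2) else 0) = y
    generalize (if k = w' then (1 : ZMod 2) else 0) = z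
    revert x y z; decide
  have hee : ∀ j ∈ Q, e j + d = e' j := by
    intro j hj
    apply geq _ _ (by rw [map_add, hh j hj, hd0, add_zero]) (hh' j hj)
    intro k
    rw [map_add, (he j hj).2 k, (he' j hj).2 k, hgd]
    generalize (if k = j then (1 : ZMod 2) else 0) = x
    generalize (if k = w then (1 : ZMod 2) else 0) = y
    generalize (if k = w' then (1 : ZMod 2) else 0) = z
    revert x y z; decide
  have hdne : d ≠ 0 := by
    intro e0
    have := hgd w
    rw [e0, map_zero, if_pos rfl, if_neg hww, add_zero] at this
    exact zero_ne_one this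
  obtain ⟨a, ha⟩ : ∃ a, g' a d = 1 := by
    by_contra hcon
    push Not at hcon
    exact hdne (gi' d hd0 (fun i => (z2 _).resolve_right (hcon i)))
  have ht : ∀ j, ∃ t, j ∈ Q → (t = e j ∨ t = e j + d) ∧ t ∈ F ∧ t + d ∈ F ∧ g' a t = 1 ∧ g j t = 1 ∧
      ∀ k ∈ Q, k ≠ j → g k t = 0 := by
    intro j
    by_cases hj : j ∈ Q
    swap
    · exact ⟨0, fun h => absurd h hj⟩
    have hne : ∀ k ∈ Q, k ≠ w ∧ k ≠ w' := fun k hk => ⟨fun e => hw (e ▸ hk), fun e => hw' (e ▸ hk)⟩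
    by_cases h1 : g' a (e j) = 1
    · refine ⟨e j, fun _ => ⟨Or.inl rfl, (he j hj).1, hee j hj ▸ (he' j hj).1, h1, ?_, ?_⟩⟩
      · rw [(he j hj).2, if_pos rfl, if_neg (hne j hj).1, add_zero]
      · intro k hk hkj
        rw [(he j hj).2, if_neg hkj, if_neg (hne k hk).1, add_zero]
    · refine ⟨e j + d, fun _ => ⟨Or.inr rfl, hee j hj ▸ (he' j hj).1, by rw [adc']; exact (he j hj).1, ?_, ?_, ?_⟩⟩
      · rw [map_add, (z2 _).resolve_right h1, ha, zero_add]
      · rw [hee j hj, (he' j hj).2, if_pos rfl, if_neg (hne j hj).2, add_zero]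
      · intro k hk hkj
        rw [hee j hj, (he' j hj).2, if_neg hkj, if_neg (hne k hk).2, add_zero]
  choose t ht using ht
  have hy : ∀ j, ∃ y, j ∈ Q → y ≠ a ∧ supp g' (t j) = {a, y} := by
    intro j
    by_cases hj : j ∈ Q
    swap
    · exact ⟨a, fun h => absurd h hj⟩
    obtain ⟨-, hF1, -, h1, -⟩ := ht j hj
    obtain ⟨u, v, huv, hsu⟩ := Finset.card_eq_two.1 (g2' _ hF1)
    have : a ∈ supp g' (t j) := mem_supp.2 h1
    rw [hsu, Finset.mem_insert, Finset.mem_singleton] at this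
    rcases this with rfl | rfl
    · exact ⟨v, fun _ => ⟨huv.symm, hsu⟩⟩
    · exact ⟨u, fun _ => ⟨huv, by rw [hsu, Finset.pair_comm]⟩⟩
  choose y hy using hy
  have hinj : Set.InjOn y (Q : Set ι) := by
    intro j hj k hk hjk
    by_contra hne
    have e1 : t j = t k := by
      apply geq' _ _ (hF _ (ht j hj).2.1) (hF _ (ht k hk).2.1)
      apply supp_ext
      rw [(hy j hj).2, (hy k hk).2, hjk]
    have h1 := (ht j hj).2.2.2.2.1
    rw [e1, (ht k hk).2.2.2.2.2 j hj hne] at h1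
    exact zero_ne_one h1
  set Y := Q.image y with hYd
  have hYc : Y.card = 4 := by rw [hYd, Finset.card_image_of_injOn hinj, h4]
  have haY : a ∉ Y := by
    rw [hYd, Finset.mem_image]
    rintro ⟨j, hj, e⟩
    exact (hy j hj).1 e
  have hQ4 : ∀ x : ZMod 2, Q.card • x = 0 := by rw [h4]; decide
  have hsum : supp g' (∑ j ∈ Q, t j) = Y := by
    ext i
    rw [mem_supp, map_sum]
    have e1 : ∀ j ∈ Q, g' i (t j) = (if i = a then 1 else 0) + (if i = y j then 1 else 0) := fun j hj =>
      edge_of_supp (hy j hj).1.symm (hy j hj).2 i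
    rw [Finset.sum_congr rfl e1, Finset.sum_add_distrib, Finset.sum_const, hQ4, zero_add]
    by_cases hi : i ∈ Y
    · simp only [hi, iff_true]
      rw [hYd, Finset.mem_image] at hi
      obtain ⟨j, hj, rfl⟩ := hi
      rw [Finset.sum_eq_single j]
      · simp
      · intro k hk hkj
        exact if_neg (fun e => hkj (hinj hk hj e.symm))
      · intro hn; exact absurd hj hn
    · simp only [hi, iff_false]
      rw [Finset.sum_eq_zero]
      · exact zero_ne_one
      · intro j hj
        exact if_neg (fun e => hi (by rw [hYd, e]; exact Finset.mem_image_of_mem y hj))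
  have hsume : ∑ j ∈ Q, e j = v0 := by
    apply geq _ _ (by rw [map_sum]; exact Finset.sum_eq_zero hh) hv0
    intro i
    rw [map_sum, Finset.sum_congr rfl (fun j hj => (he j hj).2 i), Finset.sum_add_distrib, Finset.sum_const,
      hQ4, add_zero, Finset.sum_ite_eq]
    by_cases hi : i ∈ Q
    · rw [if_pos hi]; exact (mem_supp.1 hi).symm
    · rw [if_neg hi]; exact ((z2 _).resolve_right (fun e => hi (mem_supp.2 e))).symm
  have hts : ∀ R : Finset ι, R ⊆ Q → ∑ j ∈ R, t j = ∑ j ∈ R, e j ∨ ∑ j ∈ R, t j = ∑ j ∈ R, e j + d := by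
    intro R
    induction R using Finset.induction_on with
    | empty => intro _; left; simp
    | insert j R hj ih =>
      intro hR
      rw [Finset.sum_insert hj, Finset.sum_insert hj]
      have hjQ := hR (Finset.mem_insert_self j R)
      rcases ih (fun x hx => hR (Finset.mem_insert_of_mem hx)) with h1 | h1 <;> rcases (ht j hjQ).1 with h3 | h3 <;>
        rw [h1, h3]
      · left; rfl
      · right; abel
      · right; abel
      · left; rw [add_add_add_comm, ads, add_zero]
  rcases hts Q (Finset.Subset.refl _) with h1 | h1
  · rw [hsume] at h1
    rw [h1] at hsum
    rw [hsum] at h2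
    omega
  · rw [hsume] at h1
    have h3 : v0 = ∑ j ∈ Q, t j + d := by rw [h1, adc']
    rw [h3, supp_add, hsum] at h2
    refine pairlem (D := supp g' d) (mem_supp.2 ha) haY hYc h2 ?_
    intro u hu
    rw [hYd, Finset.mem_image] at hu
    obtain ⟨j, hj, rfl⟩ := hu
    rw [← (hy j hj).2, ← supp_add]
    exact g2' _ (ht j hj).2.2.1

end ch
end ML

namespace ML

set_option linter.unusedSectionVars false
open Module Submodule

section ci
variable {V : Type} [AddCommGroup V] [Module (ZMod 2) V]
open scoped Classical

theorem HH {ι κ : Type} [Fintype ι] [Fintype κ] {n : ℕ} (F : Finset V) (h : V →ₗ[ZMod 2] ZMod 2)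
    (hF : ∀ t ∈ F, h t = 0) (cι : Fintype.card ι = n + 1)
    (g : ι → V →ₗ[ZMod 2] ZMod 2) (g' : κ → V →ₗ[ZMod 2] ZMod 2)
    (gi : ∀ v, h v = 0 → (∀ i, g i v = 0) → v = 0) (gi' : ∀ v, h v = 0 → (∀ i, g' i v = 0) → v = 0)
    (g2 : ∀ t ∈ F, (supp g t).card = 2)
    (g2' : ∀ t ∈ F, (supp g' t).card = 2) (hFc : n.choose 2 + 4 ≤ F.card) {v0 : V} (hv0 : h v0 = 0)
    (h4 : (supp g v0).card = 4) (h2 : (supp g' v0).card = 2) : False := by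
  have geq : ∀ u v, h u = 0 → h v = 0 → (∀ i, g i u = g i v) → u = v := by
    intro u v hu hv huv
    exact ad_eq_zero.1 (gi (u + v) (by rw [map_add, hu, hv, add_zero]) (fun i => by rw [map_add, huv, ads]))
  set P := F.image (supp g) with hP
  have hPc : P.card = F.card := by
    apply Finset.card_image_of_injOn
    intro s hs t ht hst
    exact geq s t (hF s hs) (hF t ht) (supp_ext hst)
  have hPs : P ⊆ Finset.powersetCard 2 Finset.univ := by
    intro A hA
    obtain ⟨t, ht, rfl⟩ := Finset.mem_image.1 hA
    exact Finset.mem_powersetCard.2 ⟨Finset.subset_univ _, g2 t ht⟩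
  set N := Finset.powersetCard 2 (Finset.univ : Finset ι) \ P with hN
  have hNc : N.card + 4 ≤ n := by
    have h1 := Finset.card_sdiff_add_card_eq_card hPs
    rw [Finset.card_powersetCard, Finset.card_univ, cι, Nat.choose_succ_succ' n 1, Nat.choose_one_right] at h1
    rw [← hN] at h1
    simp only [Nat.reduceAdd] at h1
    omega
  have hed : ∀ i j, i ≠ j → ({i, j} : Finset ι) ∈ P → ∃ t ∈ F, Edge g i j t := by
    intro i j hij hA
    obtain ⟨t, ht, e⟩ := Finset.mem_image.1 hA
    exact ⟨t, ht, edge_of_supp hij e⟩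
  set Q := supp g v0 with hQ
  set O := (Finset.univ : Finset ι) \ Q with hO
  have hOc : O.card + 4 = n + 1 := by
    have h1 := Finset.card_sdiff_add_card_eq_card (Finset.subset_univ Q)
    rw [Finset.card_univ, cι, h4] at h1
    exact h1
  have hOQ : ∀ o, o ∈ O ↔ o ∉ Q := fun o => by simp [hO]
  set W := O.filter (fun o => ∀ j ∈ Q, ({j, o} : Finset ι) ∈ P) with hW
  by_cases hW2 : 1 < W.card
  · obtain ⟨w, hw, w', hw', hne⟩ := Finset.one_lt_card.1 hW2
    rw [hW, Finset.mem_filter] at hw hw'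
    refine twoW F h hF g g' gi gi' g2' hv0 h4 h2 ((hOQ w).1 hw.1) ((hOQ w').1 hw'.1) hne ?_ ?_
    · intro j hj
      exact hed j w (fun e => (hOQ w).1 hw.1 (e ▸ hj)) (hw.2 j hj)
    · intro j hj
      exact hed j w' (fun e => (hOQ w').1 hw'.1 (e ▸ hj)) (hw'.2 j hj)
  have hq : ∀ o, ∃ q, o ∈ O \ W → q ∈ Q ∧ ({q, o} : Finset ι) ∉ P := by
    intro o
    by_cases ho : o ∈ O \ W
    · have h1 := Finset.mem_sdiff.1 ho
      have h3 : ¬ ∀ j ∈ Q, ({j, o} : Finset ι) ∈ P := fun hh => h1.2 (Finset.mem_filter.2 ⟨h1.1, hh⟩)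
      push Not at h3
      obtain ⟨q, hq⟩ := h3
      exact ⟨q, fun _ => hq⟩
    · exact ⟨o, fun hh => absurd hh ho⟩
  choose q hq using hq
  have hqo : ∀ o ∈ O \ W, ∀ o' ∈ O \ W, q o' ≠ o := fun o ho o' ho' e =>
    (hOQ o).1 (Finset.mem_sdiff.1 ho).1 (e ▸ (hq o' ho').1)
  set T := (O \ W).image (fun o => ({q o, o} : Finset ι)) with hT
  have hTc : T.card = (O \ W).card := by
    apply Finset.card_image_of_injOn
    intro o ho o' ho' e
    have h1 : o ∈ ({q o', o'} : Finset ι) := by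
      have : ({q o, o} : Finset ι) = {q o', o'} := e
      rw [← this]; simp
    rw [Finset.mem_insert, Finset.mem_singleton] at h1
    rcases h1 with h1 | h1
    · exact absurd h1.symm (hqo o ho o' ho')
    · exact h1
  have hTN : T ⊆ N := by
    intro A hA
    obtain ⟨o, ho, rfl⟩ := Finset.mem_image.1 hA
    refine Finset.mem_sdiff.2 ⟨Finset.mem_powersetCard.2 ⟨Finset.subset_univ _, ?_⟩, (hq o ho).2⟩
    exact Finset.card_pair (hqo o ho o ho)
  have hWO : (O \ W).card + W.card = O.card := Finset.card_sdiff_add_card_eq_card (Finset.filter_subset _ _)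
  have hTe : T = N := Finset.eq_of_subset_of_card_le hTN (by omega)
  have hin : ∀ i ∈ Q, ∀ j ∈ Q, i ≠ j → ∃ t ∈ F, Edge g i j t := by
    intro i hi j hj hij
    apply hed i j hij
    by_contra hn'
    have : ({i, j} : Finset ι) ∈ T := by
      rw [hTe]
      exact Finset.mem_sdiff.2 ⟨Finset.mem_powersetCard.2 ⟨Finset.subset_univ _, Finset.card_pair hij⟩, hn'⟩
    obtain ⟨o, ho, e⟩ := Finset.mem_image.1 this
    have h1 : o ∈ ({i, j} : Finset ι) := by rw [← e]; simp
    have h3 : o ∉ Q := (hOQ o).1 (Finset.mem_sdiff.1 ho).1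
    rw [Finset.mem_insert, Finset.mem_singleton] at h1
    rcases h1 with rfl | rfl
    · exact h3 hi
    · exact h3 hj
  obtain ⟨i1, hi1⟩ : Q.Nonempty := Finset.card_pos.1 (by omega)
  obtain ⟨i2, i3, i4, h23, h24, h34, hQe⟩ := Finset.card_eq_three.1
    (show (Q.erase i1).card = 3 by rw [Finset.card_erase_of_mem hi1, h4])
  have m : ∀ k, k ∈ Q ↔ k = i1 ∨ k = i2 ∨ k = i3 ∨ k = i4 := by
    intro k
    rw [← Finset.insert_erase hi1, hQe]
    simp
  have n1 : ∀ k ∈ ({i2, i3, i4} : Finset ι), i1 ≠ k := by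
    intro k hk
    rw [← hQe] at hk
    exact (Finset.mem_erase.1 hk).1.symm
  have h12 := n1 i2 (by simp)
  have h13 := n1 i3 (by simp)
  have h14 := n1 i4 (by simp)
  obtain ⟨a, ha, ea⟩ := hin i1 hi1 i2 ((m i2).2 (by simp)) h12
  obtain ⟨b, hb, eb⟩ := hin i1 hi1 i3 ((m i3).2 (by simp)) h13
  obtain ⟨c, hc, ec⟩ := hin i1 hi1 i4 ((m i4).2 (by simp)) h14
  have key : ∀ i j k u v, i ∈ Q → j ∈ Q → i ≠ j → u ∈ F → v ∈ F → Edge g k i u → Edge g k j v → u + v ∈ F := by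
    intro i j k u v hi hj hij hu hv eu ev
    obtain ⟨t, ht, et⟩ := hin i hi j hj hij
    have : u + v = t := by
      apply geq _ _ (by rw [map_add, hF u hu, hF v hv, add_zero]) (hF t ht)
      intro l
      rw [map_add, eu l, ev l, et l]
      generalize (if l = k then (1 : ZMod 2) else 0) = x
      generalize (if l = i then (1 : ZMod 2) else 0) = y
      generalize (if l = j then (1 : ZMod 2) else 0) = z
      revert x y z; decide
    rw [this]; exact ht
  have hab := key i2 i3 i1 a b ((m i2).2 (by simp)) ((m i3).2 (by simp)) h23 ha hb ea eb
  have hac := key i2 i4 i1 a c ((m i2).2 (by simp)) ((m i4).2 (by simp)) h24 ha hc ea ec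
  have hbc := key i3 i4 i1 b c ((m i3).2 (by simp)) ((m i4).2 (by simp)) h34 hb hc eb ec
  have habc : a + b + c = v0 := by
    apply geq _ _ (by rw [map_add, map_add, hF a ha, hF b hb, hF c hc]; rfl) hv0
    intro l
    rw [map_add, map_add, ea l, eb l, ec l]
    have hl : g l v0 = if l ∈ Q then 1 else 0 := by
      by_cases hl : l ∈ Q
      · rw [if_pos hl]; exact mem_supp.1 hl
      · rw [if_neg hl]; exact (z2 _).resolve_right (fun e => hl (mem_supp.2 e))
    rw [hl]
    simp only [m]
    by_cases e1 : l = i1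
    · have e2 : l ≠ i2 := fun e => h12 (e1 ▸ e)
      have e3 : l ≠ i3 := fun e => h13 (e1 ▸ e)
      have e4 : l ≠ i4 := fun e => h14 (e1 ▸ e)
      simp [e1, h12, h13, h14]
      decide
    · by_cases e2 : l = i2
      · simp [e2, h12.symm, h23, h24]
      · by_cases e3 : l = i3
        · simp [e3, h13.symm, h23.symm, h34]
        · by_cases e4 : l = i4
          · simp [e4, h14.symm, h24.symm, h34.symm]
          · simp [e1, e2, e3, e4]
  exact seven g' a b c (g2' _ ha) (g2' _ hb) (g2' _ hc) (g2' _ hab) (g2' _ hac) (g2' _ hbc) (habc ▸ h2)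

theorem hprime {n : ℕ} (hn : 6 ≤ n) {S : Finset V} (hc : Cfg (n + 1) S) (hS : (n + 1).choose 2 + 5 ≤ S.card)
    (IH : ∀ p ∈ S, n.choose 2 + 5 ≤ (con S p).card → Graphic (con S p)) (h : V →ₗ[ZMod 2] ZMod 2)
    (hne : ∃ s ∈ S, h s = 1) (hH : n.choose 2 + 4 ≤ (S.filter (fun s => h s = 0)).card) : Graphic S := by
  have := hc.fin
  have hch : (n + 1).choose 2 = n + n.choose 2 := by
    rw [Nat.choose_succ_succ' n 1, Nat.choose_one_right]
  set F := S.filter (fun s => h s = 0) with hF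
  set X := S.filter (fun s => h s = 1) with hX
  have hFX : F.card + X.card = S.card := by
    have h1 := Finset.card_filter_add_card_filter_not (s := S) (fun s => h s = 0)
    have e : S.filter (fun s => h s = 1) = S.filter (fun s => ¬ h s = 0) := by
      ext s
      simp only [Finset.mem_filter]
      rcases z2 (h s) with e | e <;> simp [e]
    rw [← e] at h1
    exact h1
  have bad : ∀ p ∈ S, h p = 1 → ¬ Graphic (con S p) → F.card = n.choose 2 + 4 ∧
      ∀ s ∈ S, h s = 1 → s ≠ p → s + p ∈ S := by
    intro p hp hp1 hG
    have h1 := con_ge hc.z (S := S) (p := p) h hp1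
    have h2 : (con S p).card < n.choose 2 + 5 := by
      by_contra hcon
      exact hG (IH p hp (by omega))
    rw [← hF] at h1
    refine ⟨by omega, ?_⟩
    intro s hs hs1 hsp
    by_contra hcon
    have : 0 < (S.filter (fun s => h s = 1 ∧ s ≠ p ∧ s + p ∉ S)).card :=
      Finset.card_pos.2 ⟨s, Finset.mem_filter.2 ⟨hs, hs1, hsp, hcon⟩⟩
    omega
  by_cases hgood : ∃ p ∈ S, h p = 1 ∧ Graphic (con S p)
  swap
  · exfalso
    push Not at hgood
    obtain ⟨s0, hs0, hs01⟩ := hne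
    have h1 := (bad s0 hs0 hs01 (hgood s0 hs0 hs01)).1
    refine nogood hn hc h (by rw [← hF]; omega) (by rw [← hX]; omega) ?_
    intro s hs t ht hs1 ht1 hst
    exact (bad t ht ht1 (hgood t ht ht1)).2 s hs hs1 hst
  obtain ⟨p, hp, hp1, hG⟩ := hgood
  obtain ⟨ι, _, g, l⟩ := exists_lift hc.z hp hG
  have hhne : ∀ u v : V, h u = 0 → h v = 1 → u ≠ v := by
    intro u v hu hv e
    rw [e, hv] at hu
    exact one_ne_zero hu
  have hcι : Fintype.card ι = n + 1 := by rw [l.card, hc.dim]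
  have g2 : ∀ t ∈ F, (supp g t).card = 2 := by
    intro t ht
    have := Finset.mem_filter.1 ht
    exact l.two t this.1 (hhne t p this.2 hp1)
  have hF0 : ∀ t ∈ F, h t = 0 := fun t ht => (Finset.mem_filter.1 ht).2
  have hFle : F.card ≤ (n + 1).choose 2 := by
    rw [← hcι, ← Finset.card_univ, ← Finset.card_powersetCard]
    apply Finset.card_le_card_of_injOn (supp g)
    · intro t ht
      exact Finset.mem_powersetCard.2 ⟨Finset.subset_univ _, g2 t ht⟩
    · intro s hs t ht hst
      refine ad_eq_zero.1 (l.inj hp1 (v := s + t) ?_ ?_)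
      · rw [map_add, hF0 s hs, hF0 t ht, add_zero]
      · intro i; rw [map_add, supp_ext hst, ads]
  have hinjX : ∀ s ∈ X.erase p, ∀ t ∈ X.erase p, supp g s = supp g t → s = t := by
    intro s hs t ht hst
    rw [Finset.mem_erase, hX, Finset.mem_filter] at hs ht
    refine ad_eq_zero.1 (l.inj hp1 (v := s + t) ?_ ?_)
    · rw [map_add, hs.2.2, ht.2.2, ads]
    · intro i; rw [map_add, supp_ext hst, ads]
  have hpX : p ∈ X := Finset.mem_filter.2 ⟨hp, hp1⟩
  have hcomm : ∃ c, ∀ A ∈ (X.erase p).image (supp g), c ∈ A := by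
    apply common
    · intro A hA
      obtain ⟨s, hs, rfl⟩ := Finset.mem_image.1 hA
      rw [Finset.mem_erase, hX, Finset.mem_filter] at hs
      exact l.two s hs.2.1 hs.1
    · intro A hA B hB hAB hdis
      obtain ⟨s, hs, rfl⟩ := Finset.mem_image.1 hA
      obtain ⟨t, ht, rfl⟩ := Finset.mem_image.1 hB
      rw [Finset.mem_erase, hX, Finset.mem_filter] at hs ht
      have hst : s ≠ t := fun e => hAB (by rw [e])
      have h4 : (supp g (s + t)).card = 4 := by
        have := card_sd (supp g s) (supp g t)
        rw [Finset.disjoint_iff_inter_eq_empty.1 hdis, Finset.card_empty, l.two s hs.2.1 hs.1,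
          l.two t ht.2.1 ht.1] at this
        rw [supp_add]; omega
      have hv0 : h (s + t) = 0 := by rw [map_add, hs.2.2, ht.2.2, ads]
      have hstS : s + t ∉ S := by
        intro hm
        have := g2 (s + t) (Finset.mem_filter.2 ⟨hm, hv0⟩)
        omega
      have hGs : Graphic (con S s) := by
        by_contra hG'
        have := (bad s hs.2.1 hs.2.2 hG').2 t ht.2.1 ht.2.2 hst.symm
        rw [add_comm] at this
        exact hstS this
      obtain ⟨κ, _, g', l'⟩ := exists_lift hc.z hs.2.1 hGs
      refine HH F h hF0 hcι g g' (fun v hv hg => l.inj hp1 hv hg) (fun v hv hg => l'.inj hs.2.2 hv hg) g2 ?_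
        hH hv0 h4 ?_
      · intro u hu
        have := Finset.mem_filter.1 hu
        exact l'.two u this.1 (hhne u s this.2 hs.2.2)
      · have : supp g' (s + t) = supp g' t := by
          ext i
          rw [mem_supp, mem_supp, map_add, l'.gx, zero_add]
        rw [this]
        exact l'.two t ht.2.1 hst.symm
    · rw [Finset.card_image_of_injOn hinjX, Finset.card_erase_of_mem hpX]
      omega
  obtain ⟨c, hcc⟩ := hcomm
  refine finish l h hp1 c ?_
  intro s hs hs1 hsp
  exact mem_supp.1 (hcc _ (Finset.mem_image_of_mem _ (Finset.mem_erase.2 ⟨hsp, Finset.mem_filter.2 ⟨hs, hs1⟩⟩)))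

end ci
end ML

namespace ML

set_option linter.unusedSectionVars false
open Module Submodule

section cj
variable {V : Type} [AddCommGroup V] [Module (ZMod 2) V]
open scoped Classical

theorem lift_ne {n : ℕ} (hn : 1 ≤ n) {S : Finset V} (hc : Cfg (n + 1) S) {ι : Type} [Fintype ι] {x : V}
    {g : ι → V →ₗ[ZMod 2] ZMod 2} (l : Lift S x g) (i : ι) : ∃ s ∈ S, g i s = 1 := by
  have := hc.fin
  by_contra hcon
  push Not at hcon
  have hi : g i = 0 := by
    apply LinearMap.ext_on hc.sp
    intro s hs
    exact (z2 _).resolve_right (hcon s hs)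
  have hsum : ∑ j, g j = 0 := by
    apply LinearMap.ext_on hc.sp
    intro s hs
    rw [LinearMap.sum_apply, LinearMap.zero_apply]
    by_cases hsx : s = x
    · rw [hsx]; exact Finset.sum_eq_zero (fun j _ => l.gx j)
    · have h2 := l.two s hs hsx
      have : ∑ j, g j s = ((supp g s).card : ZMod 2) := by
        rw [supp, Finset.card_filter, Nat.cast_sum]
        apply Finset.sum_congr rfl
        intro j _
        rcases z2 (g j s) with e | e <;> simp [e]
      rw [this, h2]; rfl
  have hcι : Fintype.card ι = n + 1 := by rw [l.card, hc.dim]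
  obtain ⟨j0, hj0⟩ : ∃ j, j ≠ i := by
    have : Nontrivial ι := Fintype.one_lt_card_iff_nontrivial.1 (by omega)
    exact exists_ne i
  let φ : V →ₗ[ZMod 2] ({j // j ∈ (Finset.univ.erase i).erase j0} → ZMod 2) := LinearMap.pi (fun j => g j.1)
  have hker : LinearMap.ker φ ≤ span (ZMod 2) {x} := by
    intro v hv
    rw [LinearMap.mem_ker] at hv
    have h1 : ∀ j, j ≠ i → j ≠ j0 → g j v = 0 := by
      intro j h1 h2
      exact congrFun hv ⟨j, by simp [h1, h2]⟩
    have h2 : g i v = 0 := by rw [hi]; rfl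
    have h3 : g j0 v = 0 := by
      have := LinearMap.congr_fun hsum v
      rw [LinearMap.sum_apply, LinearMap.zero_apply, Finset.sum_eq_single j0] at this
      · exact this
      · intro j _ hj
        by_cases e : j = i
        · rw [e]; exact h2
        · exact h1 j e hj
      · simp
    rw [mem_sp]
    apply l.ker
    intro j
    by_cases e : j = i
    · rw [e]; exact h2
    · by_cases e' : j = j0
      · rw [e']; exact h3
      · exact h1 j e e'
  have hr := LinearMap.finrank_range_add_finrank_ker φ
  have h1 : finrank (ZMod 2) (LinearMap.ker φ) ≤ 1 :=
    (Submodule.finrank_mono hker).trans ((finrank_span_le_card _).trans (by simp))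
  have h2 : finrank (ZMod 2) (LinearMap.range φ) ≤ n - 1 := by
    refine (Submodule.finrank_le _).trans ?_
    rw [finrank_fintype_fun_eq_card, Fintype.card_coe, Finset.card_erase_of_mem (by simp [hj0]),
      Finset.card_erase_of_mem (by simp), Finset.card_univ, hcι]
    omega
  rw [hc.dim] at hr
  omega

theorem case1 {n : ℕ} (hn : 6 ≤ n) {S : Finset V} (hc : Cfg (n + 1) S) (hS : (n + 1).choose 2 + 5 ≤ S.card)
    (IH : ∀ p ∈ S, n.choose 2 + 5 ≤ (con S p).card → Graphic (con S p)) {x : V} (hx : x ∈ S)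
    (hG : Graphic (con S x)) : Graphic S := by
  have := hc.fin
  obtain ⟨ι, _, g, l⟩ := exists_lift hc.z hx hG
  have hcι : Fintype.card ι = n + 1 := by rw [l.card, hc.dim]
  have hch : (n + 1).choose 2 = n + n.choose 2 := by
    rw [Nat.choose_succ_succ' n 1, Nat.choose_one_right]
  have hc2 : 2 * (n + 1).choose 2 = (n + 1) * n := by
    have := Nat.add_one_mul_choose_eq n 1
    rw [Nat.choose_one_right] at this
    simp only [Nat.succ_eq_add_one, Nat.reduceAdd] at this
    omega
  have hsum : ∑ i, (S.filter (fun s => g i s = 1)).card = 2 * (S.card - 1) := by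
    have h1 : ∑ i, (S.filter (fun s => g i s = 1)).card = ∑ s ∈ S, (supp g s).card := by
      simp only [supp, Finset.card_filter]
      exact Finset.sum_comm
    have hx0 : (supp g x).card = 0 := by
      rw [Finset.card_eq_zero, Finset.eq_empty_iff_forall_notMem]
      intro i hi
      rw [mem_supp, l.gx] at hi
      exact zero_ne_one hi
    rw [h1, ← Finset.add_sum_erase S _ hx, hx0, zero_add,
      Finset.sum_const_nat (m := 2) (fun s hs => l.two s (Finset.mem_of_mem_erase hs) (Finset.ne_of_mem_erase hs)),
      Finset.card_erase_of_mem hx, mul_comm]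
  obtain ⟨k, hk⟩ := Nat.exists_eq_add_of_le hS
  obtain ⟨i, hi⟩ : ∃ i, (S.filter (fun s => g i s = 1)).card ≤ n + 1 + k := by
    by_contra hcon
    push Not at hcon
    have h1 : Fintype.card ι • (n + 2 + k) ≤ ∑ i, (S.filter (fun s => g i s = 1)).card := by
      rw [← Finset.card_univ]
      apply Finset.card_nsmul_le_sum
      intro i _
      have := hcon i
      omega
    rw [hsum, hcι, smul_eq_mul, hk] at h1
    have h2 : 2 * ((n + 1).choose 2 + 5 + k - 1) = (n + 1) * n + 8 + 2 * k := by omega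
    rw [h2] at h1
    nlinarith
  apply hprime hn hc hS IH (g i) (lift_ne (by omega) hc l i)
  have h1 := Finset.card_filter_add_card_filter_not (s := S) (fun s => g i s = 1)
  have e : S.filter (fun s => ¬ g i s = 1) = S.filter (fun s => g i s = 0) := by
    ext s
    simp only [Finset.mem_filter]
    rcases z2 (g i s) with e | e <;> simp [e]
  rw [e] at h1
  omega

theorem mainT : ∀ (m : ℕ) {V : Type} [AddCommGroup V] [Module (ZMod 2) V] {S : Finset V}, Cfg (m + 6) S →
    (m + 6).choose 2 + 5 ≤ S.card → Graphic S := by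
  intro m
  induction m with
  | zero =>
    intro V _ _ S hc hS
    exact T6 hc ((by decide : 20 = (0 + 6).choose 2 + 5) ▸ hS)
  | succ m ih =>
    intro V _ _ S hc hS
    have := hc.fin
    rw [show m + 1 + 6 = (m + 6) + 1 by omega] at hc hS
    set n := m + 6 with hn
    have IH : ∀ p ∈ S, n.choose 2 + 5 ≤ (con S p).card → Graphic (con S p) := fun p hp hcard => ih (hc.con hp) hcard
    have hch : (n + 1).choose 2 = n + n.choose 2 := by
      rw [Nat.choose_succ_succ' n 1, Nat.choose_one_right]
    by_cases hgood : ∃ x ∈ S, Graphic (con S x)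
    · obtain ⟨x, hx, hG⟩ := hgood
      exact case1 (by omega) hc hS IH hx hG
    exfalso
    push Not at hgood
    have hle : ∀ x ∈ S, (con S x).card ≤ n.choose 2 + 4 := by
      intro x hx
      by_contra hcon
      exact hgood x hx (IH x hx (by omega))
    have hL : ∀ z ∈ S, 2 * (n + 1 - 1) ≤ (D2 S z).card := by
      intro z hz
      have h1 := con_card hz hc.z
      have h2 := hle z hz
      omega
    have hV := dimV (by omega) hc hL
    have hF : ¬ ∃ P, IsF7 S P := by
      rintro ⟨P, hP⟩
      refine E1F (m + 1) (S := S) (by rw [show m + 1 + 6 = n + 1 by omega]; exact hc) ?_ hP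
      intro z hz
      have := hV z hz
      omega
    have htop : ∀ z ∈ S, Vz S z = ⊤ := by
      intro z hz
      have h1 := f7free_card hc hF hz
      have h2 := hL z hz
      apply Submodule.eq_top_of_finrank_eq
      have h3 := Submodule.finrank_le (Vz S z)
      rw [hc.dim] at h3 ⊢
      omega
    obtain ⟨y, hy⟩ : S.Nonempty := Finset.card_pos.1 (by omega)
    have h1 := top_card n (hc.con hy) (top_con hc.z htop)
    have h2 := hle y hy
    omega

end cj
end ML

namespace ML

set_option linter.unusedSectionVars false
open Module Submodule

section ck
open scoped Classical

/-- every nonempty set of edges has a vertex of degree one -/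
def Leafy {ε ι : Type*} (a b : ε → ι) : Prop :=
  ∀ J : Finset ε, J.Nonempty → ∃ i, ∃ e ∈ J, (i = a e ∨ i = b e) ∧ ∀ f ∈ J, (i = a f ∨ i = b f) → f = e

theorem leafy_iff {ε ι : Type*} [Fintype ι] (F : Type*) [Field F] (a b : ε → ι) (hab : ∀ e, a e ≠ b e) :
    LinearIndependent F (fun e => (Pi.single (a e) 1 - Pi.single (b e) 1 : ι → F)) ↔ Leafy a b := by
  set φ : ε → ι → F := fun e => (Pi.single (a e) 1 - Pi.single (b e) 1 : ι → F) with hφ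
  have h0 : ∀ e i, ¬ (i = a e ∨ i = b e) → φ e i = 0 := by
    intro e i h
    push Not at h
    simp [hφ, h.1, h.2]
  have h1 : ∀ e i, (i = a e ∨ i = b e) → φ e i ≠ 0 := by
    intro e i h
    rcases h with rfl | rfl
    · simp [hφ, hab e]
    · simp [hφ, (hab e).symm]
  have hs : ∀ e, ∑ i, φ e i = 0 := by
    intro e
    simp [hφ, Finset.sum_sub_distrib]
  constructor
  · intro hli J hJ
    by_contra hcon
    push Not at hcon
    set T := J.biUnion (fun e => ({a e, b e} : Finset ι)) with hT
    have hmT : ∀ i, i ∈ T ↔ ∃ e ∈ J, (i = a e ∨ i = b e) := by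
      intro i; simp [hT]
    have hcard : T.card ≤ J.card := by
      have hle : ∀ i ∈ T, 2 ≤ (J.filter (fun e => i = a e ∨ i = b e)).card := by
        intro i hi
        obtain ⟨e, he, hie⟩ := (hmT i).1 hi
        obtain ⟨f, hf, hif, hfe⟩ := hcon i e he hie
        exact Finset.one_lt_card.2 ⟨e, Finset.mem_filter.2 ⟨he, hie⟩, f, Finset.mem_filter.2 ⟨hf, hif⟩, hfe.symm⟩
      have h2 := Finset.card_nsmul_le_sum T _ 2 hle
      have h3 : ∑ i ∈ T, (J.filter (fun e => i = a e ∨ i = b e)).card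
          = ∑ e ∈ J, (T.filter (fun i => i = a e ∨ i = b e)).card := by
        simp only [Finset.card_filter]
        exact Finset.sum_comm
      have h4 : ∑ e ∈ J, (T.filter (fun i => i = a e ∨ i = b e)).card ≤ J.card • 2 := by
        apply Finset.sum_le_card_nsmul
        intro e _
        refine (Finset.card_le_card (t := {a e, b e}) ?_).trans Finset.card_le_two
        intro i hi
        simpa using (Finset.mem_filter.1 hi).2
      rw [h3] at h2
      simp only [smul_eq_mul] at h2 h4
      omega
    obtain ⟨e0, he0⟩ := hJ
    have ht0 : a e0 ∈ T := (hmT _).2 ⟨e0, he0, Or.inl rfl⟩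
    let ρ : (ι → F) →ₗ[F] ({t // t ∈ T.erase (a e0)} → F) := LinearMap.pi (fun t => LinearMap.proj t.1)
    have hJli : LinearIndependent F (fun e : J => ρ (φ e.1)) := by
      rw [Fintype.linearIndependent_iff]
      intro c hc
      have hli' : LinearIndependent F (fun e : J => φ e.1) := hli.comp _ Subtype.val_injective
      rw [Fintype.linearIndependent_iff] at hli'
      apply hli'
      set w := ∑ e : J, c e • φ e.1 with hw
      have hρ : ρ w = 0 := by
        rw [hw, map_sum, ← hc]
        simp
      have hoff : ∀ i, i ∉ T → w i = 0 := by
        intro i hi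
        rw [hw, Finset.sum_apply]
        apply Finset.sum_eq_zero
        intro e _
        rw [Pi.smul_apply, h0 e.1 i (fun h => hi ((hmT i).2 ⟨e.1, e.2, h⟩)), smul_zero]
      have hsw : ∑ i, w i = 0 := by
        rw [hw]
        simp only [Finset.sum_apply, Pi.smul_apply, smul_eq_mul]
        rw [Finset.sum_comm]
        apply Finset.sum_eq_zero
        intro e _
        rw [← Finset.mul_sum, hs, mul_zero]
      have hne : ∀ i, i ≠ a e0 → w i = 0 := by
        intro i hi
        by_cases hiT : i ∈ T
        · exact congrFun hρ ⟨i, Finset.mem_erase.2 ⟨hi, hiT⟩⟩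
        · exact hoff i hiT
      funext i
      by_cases hi : i = a e0
      · rw [Finset.sum_eq_single (a e0) (fun i _ h => hne i h) (by simp)] at hsw
        rw [hi]; exact hsw
      · exact hne i hi
    have := hJli.fintype_card_le_finrank
    rw [finrank_fintype_fun_eq_card, Fintype.card_coe, Fintype.card_coe, Finset.card_erase_of_mem ht0] at this
    have : 0 < T.card := Finset.card_pos.2 ⟨_, ht0⟩
    omega
  · intro hL
    rw [linearIndependent_iff']
    intro s c hc
    by_contra hcon
    push Not at hcon
    obtain ⟨e1, he1, hce1⟩ := hcon
    obtain ⟨i, e, he, hie, hu⟩ := hL (s.filter (fun e => c e ≠ 0)) ⟨e1, Finset.mem_filter.2 ⟨he1, hce1⟩⟩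
    rw [Finset.mem_filter] at he
    have h3 := congrFun hc i
    rw [Finset.sum_apply, Finset.sum_eq_single e] at h3
    · rw [Pi.smul_apply, smul_eq_mul] at h3
      exact mul_ne_zero he.2 (h1 e i hie) h3
    · intro f hf hfe
      rw [Pi.smul_apply, smul_eq_mul]
      by_cases hcf : c f = 0
      · rw [hcf, zero_mul]
      · rw [h0 f i (fun h => hfe (hu f (Finset.mem_filter.2 ⟨hf, hcf⟩) h)), mul_zero]
    · intro h; exact absurd he.1 h

theorem regular_of {α : Type*} (M : Matroid α) {V : Type} [AddCommGroup V] [Module (ZMod 2) V] (ψ : α → V)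
    (hψ : M.IsRepBy (ZMod 2) ψ) {ι : Type} [Fintype ι] [Nonempty ι]
    (g : ι → V →ₗ[ZMod 2] ZMod 2) (hg : ∀ v, (∀ i, g i v = 0) → v = 0) (h2 : ∀ e ∈ M.E, (supp g (ψ e)).card = 2) : M.IsRegularM := by
  have hex : ∀ e, ∃ a b, e ∈ M.E → a ≠ b ∧ supp g (ψ e) = {a, b} := by
    intro e
    by_cases he : e ∈ M.E
    · obtain ⟨a, b, h⟩ := Finset.card_eq_two.1 (h2 e he)
      exact ⟨a, b, fun _ => h⟩
    · have i0 : ι := Classical.arbitrary ι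
      exact ⟨i0, i0, fun h => absurd h he⟩
  choose a b hab using hex
  intro F _
  let eq := LinearEquiv.funCongrLeft F F (Fintype.equivFin ι).symm
  refine ⟨Fintype.card ι, fun e => eq (Pi.single (a e) 1 - Pi.single (b e) 1 : ι → F), ?_⟩
  intro I hI
  rw [hψ I hI]
  have hab' : ∀ e : I, a e ≠ b e := fun e => (hab e.1 (hI e.2)).1
  let G : V →ₗ[ZMod 2] (ι → ZMod 2) := LinearMap.pi g
  have hG : LinearMap.ker G = ⊥ := by
    rw [LinearMap.ker_eq_bot']
    intro v hv
    exact hg v (fun i => congrFun hv i)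
  have e1 : LinearIndependent (ZMod 2) (I.restrict ψ) ↔ Leafy (fun e : I => a e) (fun e : I => b e) := by
    rw [← leafy_iff (ZMod 2) _ _ hab', ← LinearMap.linearIndependent_iff G hG]
    apply iff_of_eq
    congr 1
    funext e
    funext k
    have := edge_of_supp (hab e.1 (hI e.2)).1 (hab e.1 (hI e.2)).2 k
    change g k (ψ e) = _
    rw [this, Pi.sub_apply, Pi.single_apply, Pi.single_apply]
    generalize (if k = a e then (1 : ZMod 2) else 0) = x
    generalize (if k = b e then (1 : ZMod 2) else 0) = y
    revert x y; decide
  rw [e1, ← leafy_iff F _ _ hab', ← LinearMap.linearIndependent_iff eq.toLinearMap (LinearEquiv.ker eq)]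
  rfl

end ck
end ML

namespace ML

set_option linter.unusedSectionVars false
set_option linter.deprecated false
open Module Submodule

section cl
open scoped Classical

theorem rep_con {α : Type*} {M : Matroid α} {V V' : Type*} [AddCommGroup V] [Module (ZMod 2) V] [AddCommGroup V']
    [Module (ZMod 2) V'] {ψ : α → V} (hψ : M.IsRepBy (ZMod 2) ψ) {C : Set α} (hC : C ⊆ M.E)
    (f : V →ₗ[ZMod 2] V') (hf : LinearMap.ker f = span (ZMod 2) (ψ '' C)) :
    (M.con C).IsRepBy (ZMod 2) (f ∘ ψ) := by
  intro J hJ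
  have hJ' : J ⊆ M.E \ C := hJ
  change (M ／ C).Indep J ↔ LinearIndepOn (ZMod 2) (f ∘ ψ) J
  have hi : ∀ I ⊆ M.E, (M.Indep I ↔ LinearIndepOn (ZMod 2) ψ I) := hψ
  obtain ⟨I, hI⟩ := M.exists_isBasis C hC
  have hIE : I ⊆ M.E := hI.subset.trans hC
  have hsp : span (ZMod 2) (ψ '' I) = span (ZMod 2) (ψ '' C) := by
    apply le_antisymm (span_mono (image_mono hI.subset))
    rw [span_le]
    rintro _ ⟨c, hc, rfl⟩
    by_contra hn
    have hcI : c ∉ I := fun h => hn (subset_span (mem_image_of_mem _ h))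
    have h1 : M.Indep (insert c I) := by
      rw [hi _ (insert_subset (hC hc) hIE), linearIndepOn_insert hcI]
      exact ⟨(hi I hIE).1 hI.indep, hn⟩
    exact hcI (hI.mem_of_insert_indep hc h1)
  have hdis : Disjoint C J := by
    rw [Set.disjoint_left]; intro a ha haJ; exact (hJ' haJ).2 ha
  have hIJ : Disjoint I J := hdis.mono_left hI.subset
  rw [hI.contract_indep_iff, and_iff_left hdis, union_comm,
    hi _ (union_subset hIE (fun a ha => (hJ' ha).1)), linearIndepOn_union_iff_quotient hIJ,
    and_iff_right ((hi I hIE).1 hI.indep)]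
  have hle : span (ZMod 2) (ψ '' I) ≤ LinearMap.ker f := by rw [hf, hsp]
  have hk : LinearMap.ker ((span (ZMod 2) (ψ '' I)).liftQ f hle) = ⊥ := by
    rw [ker_liftQ, hf, hsp]
    exact (LinearMap.le_ker_iff_map).1 (by rw [ker_mkQ]) |>.trans rfl
  rw [LinearIndepOn, LinearIndepOn, ← LinearMap.linearIndependent_iff _ hk]
  rfl

theorem many_core {α : Type*} (M : Matroid α) (r : ℕ) (hr : 7 ≤ r)
    (hbin : M.IsBinaryM) (hsimple : M.IsSimpleM)
    (hrank : M.rkM = r) (hAG : ¬ M.HasAGMinor) (p : ℤ)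
    (hsize : (M.E.ncard : ℤ) = (r.choose 2 : ℤ) + 4 + p)
    (x : α) (hx : x ∈ M.E) (hxnonreg : ¬ (M.con {x}).IsRegularM) :
    (r : ℤ) - 2 + p ≤ ({ℓ : Set α | M.IsLineThru x ℓ}.ncard : ℤ) := by
  obtain ⟨n, φ, hφ⟩ := hbin
  let V := span (ZMod 2) (φ '' M.E)
  let ψ : α → V := fun e => if h : e ∈ M.E then ⟨φ e, subset_span (mem_image_of_mem φ h)⟩ else 0
  have hψv : ∀ e ∈ M.E, (ψ e : Fin n → ZMod 2) = φ e := by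
    intro e he; simp only [ψ, dif_pos he]
  have hrep : M.IsRepBy (ZMod 2) ψ := by
    intro I hI
    rw [hφ I hI, ← LinearMap.linearIndependent_iff V.subtype V.ker_subtype]
    apply iff_of_eq
    congr 1
    funext e
    exact (hψv e.1 (hI e.2)).symm
  have hi : ∀ I ⊆ M.E, (M.Indep I ↔ LinearIndepOn (ZMod 2) ψ I) := hrep
  have hinj : Set.InjOn ψ M.E := by
    intro e he f hf hef
    have h1 := (hi {e, f} (by intro a; rintro (rfl | rfl) <;> assumption)).1 (hsimple e he f hf)
    exact h1.injOn (by simp) (by simp) hef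
  have hne : ∀ e ∈ M.E, ψ e ≠ 0 := by
    intro e he
    have h1 := (hi {e, e} (by intro a; rintro (rfl | rfl) <;> assumption)).1 (hsimple e he e he)
    exact h1.ne_zero (by simp)
  have hEfin : M.E.Finite := Set.Finite.of_finite_image (Set.toFinite (ψ '' M.E)) hinj
  set S : Finset V := (Set.toFinite (ψ '' M.E)).toFinset with hS
  have hmS : ∀ v, v ∈ S ↔ ∃ e ∈ M.E, ψ e = v := by intro v; simp [hS]
  have hSc : S.card = M.E.ncard := by
    rw [← Set.ncard_image_of_injOn hinj, Set.ncard_eq_toFinset_card _ (Set.toFinite (ψ '' M.E))]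
  have hspan : span (ZMod 2) (ψ '' M.E) = ⊤ := by
    apply Submodule.map_injective_of_injective V.injective_subtype
    rw [Submodule.map_span, Submodule.map_top, range_subtype, ← image_comp]
    change span _ _ = span _ _
    congr 1
    exact image_congr (fun e he => hψv e he)
  have hdim : finrank (ZMod 2) V = r := by
    rw [← hrank, Matroid.rkM, Matroid.rks]
    symm
    apply IsGreatest.csSup_eq
    constructor
    · obtain ⟨I, hI, hIb⟩ : ∃ I ⊆ M.E, LinearIndepOn (ZMod 2) ψ I ∧ ψ '' M.E ⊆ span (ZMod 2) (ψ '' I) := by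
        obtain ⟨I, hI⟩ := M.exists_isBase
        refine ⟨I, hI.subset_ground, (hi I hI.subset_ground).1 hI.indep, ?_⟩
        rintro _ ⟨c, hc, rfl⟩
        by_contra hn
        have hcI : c ∉ I := fun h => hn (subset_span (mem_image_of_mem _ h))
        have h1 : M.Indep (insert c I) := by
          rw [hi _ (insert_subset hc hI.subset_ground), linearIndepOn_insert hcI]
          exact ⟨(hi I hI.subset_ground).1 hI.indep, hn⟩
        exact hcI (hI.mem_of_insert_indep h1)
      refine ⟨I, hI, (hi I hI).2 hIb.1, ?_⟩
      have htop : span (ZMod 2) (ψ '' I) = ⊤ := by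
        rw [eq_top_iff, ← hspan, span_le]; exact hIb.2
      have : Fintype I := (hEfin.subset hI).fintype
      have h3 := finrank_span_eq_card (R := ZMod 2) hIb.1
      rw [← image_eq_range, htop, finrank_top] at h3
      rw [h3, Set.ncard_eq_toFinset_card', Set.toFinset_card]
    · rintro m ⟨I, hI, hInd, rfl⟩
      have : Fintype I := (hEfin.subset hI).fintype
      have h3 := ((hi I hI).1 hInd).fintype_card_le_finrank
      rwa [Set.ncard_eq_toFinset_card', Set.toFinset_card]
  have hAGf : AGfree S := by
    intro f hker hy
    apply hAG
    set C : Set α := {e | e ∈ M.E ∧ f (ψ e) = 0} with hC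
    have hCE : C ⊆ M.E := fun e he => he.1
    have hk : LinearMap.ker f = span (ZMod 2) (ψ '' C) := by
      apply le_antisymm
      · refine hker.trans (span_mono ?_)
        rintro s ⟨hs, hs0⟩
        obtain ⟨e, he, rfl⟩ := (hmS s).1 hs
        exact ⟨e, ⟨he, hs0⟩, rfl⟩
      · rw [span_le]
        rintro _ ⟨e, he, rfl⟩
        exact he.2
    have hrc := rep_con hrep hCE f hk
    have hex : ∀ y : Fin 4 → ZMod 2, ∃ e, y 0 = 1 → e ∈ M.E ∧ f (ψ e) = y := by
      intro y
      by_cases h1 : y 0 = 1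
      · obtain ⟨s, hs, hsy⟩ := hy y h1
        obtain ⟨e, he, rfl⟩ := (hmS s).1 hs
        exact ⟨e, fun _ => ⟨he, hsy⟩⟩
      · exact ⟨x, fun h => absurd h h1⟩
    choose k hk' using hex
    set K : Set α := k '' agVecs with hK
    have hKE : K ⊆ M.E \ C := by
      rintro _ ⟨y, hy1, rfl⟩
      have hy1' : y 0 = 1 := hy1
      refine ⟨(hk' y hy1).1, fun h => ?_⟩
      have := h.2
      rw [(hk' y hy1).2] at this
      rw [this] at hy1'
      exact zero_ne_one hy1'
    have hNE : ((M.con C).del ((M.E \ C) \ K)).E = K := by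
      change (M.E \ C) \ ((M.E \ C) \ K) = K
      rw [sdiff_sdiff_right_self]
      exact inter_eq_right.2 hKE
    refine ⟨(M.con C).del ((M.E \ C) \ K), ⟨C, _, rfl⟩, f ∘ ψ, ?_, ?_⟩
    · intro J hJ
      rw [hNE] at hJ
      rw [← hrc J (hJ.trans hKE)]
      change ((M.con C) ↾ _).Indep J ↔ _
      rw [Matroid.restrict_indep_iff, and_iff_left]
      rw [← hNE] at hJ
      exact hJ
    · rw [hNE]
      refine ⟨?_, ?_, ?_⟩
      · rintro _ ⟨y, hy1, rfl⟩
        change f (ψ (k y)) ∈ _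
        rw [(hk' y hy1).2]; exact hy1
      · rintro _ ⟨y, hy1, rfl⟩ _ ⟨y', hy1', rfl⟩ e
        change f (ψ (k y)) = f (ψ (k y')) at e
        rw [(hk' y hy1).2, (hk' y' hy1').2] at e
        rw [e]
      · intro y hy1
        exact ⟨k y, mem_image_of_mem _ hy1, (hk' y hy1).2⟩
  have hcfg : Cfg r S := by
    refine ⟨inferInstance, hdim, ?_, ?_, hAGf⟩
    · rw [hS, Set.Finite.coe_toFinset, hspan]
    · rw [hmS]
      rintro ⟨e, he, h0⟩
      exact hne e he h0
  have hxS : ψ x ∈ S := (hmS _).2 ⟨x, hx, rfl⟩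
  obtain ⟨m, rfl⟩ : ∃ m, r = (m + 6) + 1 := ⟨r - 7, by omega⟩
  have hsmall : (con S (ψ x)).card ≤ (m + 6).choose 2 + 4 := by
    by_contra hcon
    obtain ⟨ι, _, g, hg1, hg2, hg3⟩ := mainT m (hcfg.con hxS) (by omega)
    have : Nonempty ι := Fintype.card_pos_iff.1 (by omega)
    apply hxnonreg
    refine regular_of _ (qm (ψ x) ∘ ψ) ?_ g hg2 ?_
    · apply rep_con hrep (by simpa using hx)
      rw [image_singleton]
      exact ker_mkQ _
    · intro e he
      have he' : e ∈ M.E \ {x} := he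
      apply hg3
      rw [Function.comp_apply, qm_mem_con]
      exact ⟨hne e he'.1, fun h => he'.2 (hinj he'.1 hx h), Or.inl ((hmS _).2 ⟨e, he'.1, rfl⟩)⟩
  have hcc := con_card hxS hcfg.z
  have hlines : (D2 S (ψ x)).card ≤ 2 * {ℓ : Set α | M.IsLineThru x ℓ}.ncard := by
    have hfin : {ℓ : Set α | M.IsLineThru x ℓ}.Finite := by
      apply hEfin.finite_subsets.subset
      intro ℓ hℓ
      exact hℓ.1.1.subset_ground
    let L : V → Set α := fun s => {e | e ∈ M.E ∧ (ψ e = ψ x ∨ ψ e = s ∨ ψ e = s + ψ x)}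
    have hD : ∀ s ∈ D2 S (ψ x), s ≠ ψ x := by
      intro s hs e
      have := (mem_D2.1 hs).2
      rw [e, ads] at this
      exact hcfg.z this
    rw [Set.ncard_eq_toFinset_card _ hfin]
    refine (Finset.card_le_mul_card_image (f := L) (D2 S (ψ x)) 2 ?_).trans
      (Nat.mul_le_mul_left 2 (Finset.card_le_card ?_))
    · intro ℓ hℓ
      obtain ⟨s, hs, rfl⟩ := Finset.mem_image.1 hℓ
      refine (Finset.card_le_card (t := {s, s + ψ x}) ?_).trans Finset.card_le_two
      intro t ht
      rw [Finset.mem_filter] at ht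
      obtain ⟨e, he, het⟩ := (hmS t).1 (mem_D2.1 ht.1).1
      have h1 : e ∈ L t := ⟨he, Or.inr (Or.inl het)⟩
      rw [ht.2] at h1
      rw [Finset.mem_insert, Finset.mem_singleton, ← het]
      rcases h1.2 with h | h
      · exact absurd (het ▸ h) (hD t ht.1)
      · exact h
    · intro ℓ hℓ
      obtain ⟨s, hs, rfl⟩ := Finset.mem_image.1 hℓ
      rw [Set.Finite.mem_toFinset]
      obtain ⟨e, he, hes⟩ := (hmS s).1 (mem_D2.1 hs).1
      obtain ⟨f, hf, hfs⟩ := (hmS _).1 (mem_D2.1 hs).2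
      have hxe : x ≠ e := by
        rintro rfl; exact hD s hs hes.symm
      have hxf : x ≠ f := by
        rintro rfl
        have : s = 0 := by
          have h2 : ψ x + (s + ψ x) = 0 := by rw [← hfs, ads]
          rwa [add_comm s, adc] at h2
        exact hcfg.z (this ▸ (mem_D2.1 hs).1)
      have hef : e ≠ f := by
        rintro rfl
        rw [hes] at hfs
        have h2 : ψ x = 0 := by simpa using hfs.symm
        exact hne x hx h2
      have hL : L s = {x, e, f} := by
        ext t
        simp only [L, Set.mem_ofPred_eq, Set.mem_insert_iff, Set.mem_singleton_iff]
        constructor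
        · rintro ⟨ht, h | h | h⟩
          · left; exact hinj ht hx h
          · right; left; exact hinj ht he (h.trans hes.symm)
          · right; right; exact hinj ht hf (h.trans hfs.symm)
        · rintro (rfl | rfl | rfl)
          · exact ⟨hx, Or.inl rfl⟩
          · exact ⟨he, Or.inr (Or.inl hes)⟩
          · exact ⟨hf, Or.inr (Or.inr hfs)⟩
      have hLE : ({x, e, f} : Set α) ⊆ M.E := by
        intro t; rintro (rfl | rfl | rfl) <;> assumption
      change M.IsLineThru x (L s)
      rw [hL]
      refine ⟨⟨⟨?_, hLE⟩, ?_⟩, ?_, by simp⟩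
      · rw [hi _ hLE, linearIndepOn_insert (by simp [hxe, hxf])]
        rintro ⟨-, h2⟩
        apply h2
        have : ψ x = ψ e + ψ f := by rw [hes, hfs, adc]
        rw [this]
        exact add_mem (subset_span (mem_image_of_mem _ (by simp))) (subset_span (mem_image_of_mem _ (by simp)))
      · intro D hDs
        obtain ⟨t, ht, htD⟩ := Set.exists_of_ssubset hDs
        rcases ht with rfl | rfl | rfl
        · refine (hsimple e he f hf).subset ?_
          intro u hu
          rcases hDs.1 hu with rfl | h | h
          · exact absurd hu htD
          · exact Or.inl h
          · exact Or.inr h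
        · refine (hsimple x hx f hf).subset ?_
          intro u hu
          rcases hDs.1 hu with h | rfl | h
          · exact Or.inl h
          · exact absurd hu htD
          · exact Or.inr h
        · refine (hsimple x hx e he).subset ?_
          intro u hu
          rcases hDs.1 hu with h | h | rfl
          · exact Or.inl h
          · exact Or.inr h
          · exact absurd hu htD
      · exact Set.ncard_eq_three.2 ⟨x, e, f, hxe, hxf, hef, rfl⟩
  have hch : (m + 6 + 1).choose 2 = (m + 6) + (m + 6).choose 2 := by
    rw [Nat.choose_succ_succ' (m + 6) 1, Nat.choose_one_right]
  rw [← hSc, hch] at hsize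
  push_cast at hsize ⊢
  omega

end cl
end ML

theorem many_lines {α : Type*} (M : Matroid α) (r : ℕ) (hr : 7 ≤ r)
    (hbin : M.IsBinaryM) (hsimple : M.IsSimpleM) (hnonreg : ¬ M.IsRegularM)
    (hrank : M.rkM = r) (hAG : ¬ M.HasAGMinor) (p : ℤ)
    (hsize : (M.E.ncard : ℤ) = (r.choose 2 : ℤ) + 4 + p)
    (x : α) (hx : x ∈ M.E) (hxnonreg : ¬ (M.con {x}).IsRegularM) :
    (r : ℤ) - 2 + p ≤ ({ℓ : Set α | M.IsLineThru x ℓ}.ncard : ℤ) := by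
  exact ML.many_core M r hr hbin hsimple hrank hAG p hsize x hx hxnonreg
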